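/- Let (V,E,Ψ) be a strongly connected planar box-like self-affine GIFS satisfying the ROSC in which every T_e is diagonal, with positive weights (p_e) and graph-directed measure family (μ_v)_{v∈V}. Let q≥0 and suppose min{γ_A(q),γ_B(q)} ≥ t(q). Then for every v∈V the L^q-spectrum τ_{μ_v}(q) exists and equals the minimum of x+y over pairs (x,y)∈ℝ² with ρ(F^{(q)}_{x,y})=1 and τ_A(q) ≤ x ≤ γ_B(q)−τ_B(q), which also equals the minimum of x+y over pairs (x,y)∈ℝ² with ρ(F^{(q)}_{x,y})=1 and τ_B(q) ≤ y ≤ γ_A(q)−τ_A(q). Moreover: (b1) if ∑_{e∈E} f^{(q)}_e(τ_A(q)) log(a_e/b_e) ≥ 0 then this common value equals γ_A(q); (b2) if ∑_{e∈E} f^{(q)}_e(γ_B(q)−τ_B(q)) log(a_e/b_e) ≤ 0 then it equals γ_B(q); (b3) otherwise there exist x∈[τ_A(q), γ_B(q)−τ_B(q)] and y∈[τ_B(q), γ_A(q)−τ_A(q)] with ρ(F^{(q)}_{x,y})=1 and ∑_{e∈E} f^{(q)}_e(x) log(a_e/b_e)=0 such that the common value equals x+y. -/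

import Mathlib

open MeasureTheory Filter Set
open scoped Classical

noncomputable section

namespace LqGIFS

/-! ### Mesh cubes, moment sums, L^q spectra, box dimension -/

/-- Closed cube of the `δ`-mesh of `ℝ`. -/
def meshCube1 (δ : ℝ) (k : ℤ) : Set ℝ := Set.Icc ((k : ℝ) * δ) (((k : ℝ) + 1) * δ)

/-- Closed cube of the `δ`-mesh of `ℝ²`. -/
def meshCube2 (δ : ℝ) (k : ℤ × ℤ) : Set (ℝ × ℝ) :=
  (Set.Icc ((k.1 : ℝ) * δ) (((k.1 : ℝ) + 1) * δ)) ×ˢ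
    (Set.Icc ((k.2 : ℝ) * δ) (((k.2 : ℝ) + 1) * δ))

/-- The moment sum `D_δ^q(ν)` for a measure on `ℝ` (cubes of zero measure are omitted,
so that at `q = 0` this counts the mesh cubes of positive measure). -/
def Dq1 (ν : Measure ℝ) (δ q : ℝ) : ℝ :=
  ∑' k : ℤ, if ν (meshCube1 δ k) = 0 then 0 else (ν (meshCube1 δ k)).toReal ^ q

/-- The moment sum `D_δ^q(ν)` for a measure on `ℝ²`. -/
def Dq2 (ν : Measure (ℝ × ℝ)) (δ q : ℝ) : ℝ :=
  ∑' k : ℤ × ℤ, if ν (meshCube2 δ k) = 0 then 0 else (ν (meshCube2 δ k)).toReal ^ q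

/-- The `L^q`-spectrum of a measure on `ℝ` exists and equals `s` (i.e. upper and lower
`L^q`-spectra coincide and equal `s`). -/
def HasLq1 (ν : Measure ℝ) (q s : ℝ) : Prop :=
  Tendsto (fun δ : ℝ => Real.log (Dq1 ν δ q) / (-Real.log δ))
    (nhdsWithin 0 (Set.Ioi 0)) (nhds s)

/-- The `L^q`-spectrum of a measure on `ℝ²` exists and equals `s`. -/
def HasLq2 (ν : Measure (ℝ × ℝ)) (q s : ℝ) : Prop :=
  Tendsto (fun δ : ℝ => Real.log (Dq2 ν δ q) / (-Real.log δ))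
    (nhdsWithin 0 (Set.Ioi 0)) (nhds s)

/-- Number of closed `δ`-mesh cubes of `ℝ²` meeting `X`. -/
def boxCount (X : Set (ℝ × ℝ)) (δ : ℝ) : ℕ :=
  Set.ncard {k : ℤ × ℤ | (X ∩ meshCube2 δ k).Nonempty}

/-- The box dimension of `X` exists and equals `d`. -/
def HasBoxDim (X : Set (ℝ × ℝ)) (d : ℝ) : Prop :=
  Tendsto (fun δ : ℝ => Real.log (boxCount X δ) / (-Real.log δ))
    (nhdsWithin 0 (Set.Ioi 0)) (nhds d)

/-! ### Matrices: 1-norm, spectral radius, permutation matrices -/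

/-- The 1-norm `‖A‖ = ∑_{i,j} |a_{ij}|` of a square matrix. -/
def mnorm {ι : Type*} [Fintype ι] (A : Matrix ι ι ℝ) : ℝ := ∑ i, ∑ j, |A i j|

/-- The spectral radius of a square real matrix, via the Gelfand formula. -/
def specRad {ι : Type*} [Fintype ι] [DecidableEq ι] (A : Matrix ι ι ℝ) : ℝ :=
  Filter.limsup (fun k : ℕ => (mnorm (A ^ k)) ^ ((k : ℝ)⁻¹)) Filter.atTop

/-- A square 0-1 matrix with exactly one 1 in each row and each column. -/
def IsPermMatrix {ι : Type*} (Z : Matrix ι ι ℝ) : Prop :=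
  (∀ i j, Z i j = 0 ∨ Z i j = 1) ∧ (∀ i, ∃! j, Z i j = 1) ∧ (∀ j, ∃! i, Z i j = 1)

/-! ### Directed graphs -/

/-- Strong connectivity of the finite directed graph with edge set `E`,
initial vertex map `ini` and terminal vertex map `ter`. -/
def GraphSC {V E : Type*} (ini ter : E → V) : Prop :=
  ∀ v v' : V, Relation.TransGen (fun u u' : V => ∃ e, ini e = u ∧ ter e = u') v v'

/-- The matrix `F^{(q)}_{x,y}` with entry `p_{e'}^q a_{e'}^x b_{e'}^y` at `(e,e')` when
`t(e) = i(e')`, and `0` otherwise. -/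
def FmatG {V E : Type*} (ini ter : E → V) (p a b : E → ℝ) (q x y : ℝ) :
    Matrix E E ℝ :=
  fun e e' => if ter e = ini e' then p e' ^ q * a e' ^ x * b e' ^ y else 0

/-- `f` is the entrywise product of the normalized left and right Perron vectors of the
irreducible matrix `F^{(q)}_{x,y(x)}` (spectral radius 1). -/
def IsPerronData {V E : Type*} [Fintype E] [DecidableEq E] (ini ter : E → V)
    (p a b : E → ℝ) (q x yx : ℝ) (f : E → ℝ) : Prop :=
  specRad (FmatG ini ter p a b q x yx) = 1 ∧
  ∃ u v : E → ℝ, (∀ e, 0 < u e) ∧ (∀ e, 0 < v e) ∧ (∑ e, u e) = 1 ∧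
    (FmatG ini ter p a b q x yx).mulVec u = u ∧
    (FmatG ini ter p a b q x yx).vecMul v = v ∧
    (∑ e, v e * u e) = 1 ∧ (∀ e, f e = v e * u e)

/-! ### Planar box-like graph-directed self-affine systems -/

/-- A planar box-like self-affine GIFS: a finite directed graph together with, for each
edge `e`, a contraction `ψ_e(z) = T_e z + t_e` whose linear part is the diagonal matrix
`diag(±a_e, ±b_e)` (when `diag e = true`) or the anti-diagonal matrix with entries
`±a_e` (top right) and `±b_e` (bottom left) (when `diag e = false`), `0 < a_e, b_e < 1`. -/
structure BoxLikeGIFS (V E : Type*) where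
  init : E → V
  term : E → V
  a : E → ℝ
  b : E → ℝ
  sa : E → ℝ
  sb : E → ℝ
  diag : E → Bool
  trans : E → ℝ × ℝ
  a_mem : ∀ e, a e ∈ Set.Ioo (0 : ℝ) 1
  b_mem : ∀ e, b e ∈ Set.Ioo (0 : ℝ) 1
  sa_mem : ∀ e, sa e = 1 ∨ sa e = -1
  sb_mem : ∀ e, sb e = 1 ∨ sb e = -1
  edge_exists : ∀ v, ∃ e, init e = v

namespace BoxLikeGIFS

variable {V E : Type*}

/-- The contraction `ψ_e`. -/
def map (S : BoxLikeGIFS V E) (e : E) : ℝ × ℝ → ℝ × ℝ := fun z =>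
  if S.diag e then
    (S.sa e * S.a e * z.1 + (S.trans e).1, S.sb e * S.b e * z.2 + (S.trans e).2)
  else
    (S.sa e * S.a e * z.2 + (S.trans e).1, S.sb e * S.b e * z.1 + (S.trans e).2)

def StronglyConnected (S : BoxLikeGIFS V E) : Prop := GraphSC S.init S.term

/-- The open unit square `(0,1)²`. -/
def unitSq : Set (ℝ × ℝ) := Set.Ioo (0 : ℝ) 1 ×ˢ Set.Ioo (0 : ℝ) 1

/-- The rectangular open set condition. -/
def ROSC (S : BoxLikeGIFS V E) : Prop :=
  (∀ e : E, S.map e '' unitSq ⊆ unitSq) ∧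
  ∀ e e' : E, e ≠ e' → S.init e = S.init e' →
    Disjoint (S.map e '' unitSq) (S.map e' '' unitSq)

/-- Positive weights summing to one at each vertex. -/
def IsWeights [Fintype E] (S : BoxLikeGIFS V E) (p : E → ℝ) : Prop :=
  (∀ e, 0 < p e) ∧ ∀ v : V, (∑ e : E, if S.init e = v then p e else 0) = 1

/-- `μ` is the associated graph-directed box-like self-affine measure family. -/
def IsGDMeasure [Fintype E] (S : BoxLikeGIFS V E) (p : E → ℝ)
    (μ : V → Measure (ℝ × ℝ)) : Prop :=
  (∀ v, IsProbabilityMeasure (μ v)) ∧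
  ∀ v : V, μ v =
    ∑ e : E, if S.init e = v then
      ENNReal.ofReal (p e) • ((μ (S.term e)).map (S.map e)) else (0 : Measure (ℝ × ℝ))

/-- `X` is the associated graph-directed self-affine carpet family. -/
def IsGDAttractor (S : BoxLikeGIFS V E) (X : V → Set (ℝ × ℝ)) : Prop :=
  (∀ v, (X v).Nonempty ∧ IsCompact (X v)) ∧
  ∀ v : V, X v = ⋃ e : E, ⋃ _ : S.init e = v, S.map e '' X (S.term e)

/-- The matrix `F^{(q)}_{x,y}` of the system. -/
def Fmat (S : BoxLikeGIFS V E) (p : E → ℝ) (q x y : ℝ) : Matrix E E ℝ :=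
  FmatG S.init S.term p S.a S.b q x y

/-- The `(2#E) × (2#E)` block matrix `𝒢^{(q)}_{x,y}`, indexed by `E × Bool`
(`false` = first index of the block, `true` = second). -/
def Gmat (S : BoxLikeGIFS V E) (p : E → ℝ) (τx τy : V → ℝ) (q x y : ℝ) :
    Matrix (E × Bool) (E × Bool) ℝ := fun i j =>
  if S.term i.1 = S.init j.1 then
    if S.diag j.1 then
      if i.2 = false ∧ j.2 = false then
        p j.1 ^ q * S.a j.1 ^ (x + τx (S.term j.1)) * S.b j.1 ^ (y - τx (S.term j.1))
      else if i.2 = true ∧ j.2 = true then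
        p j.1 ^ q * S.b j.1 ^ (x + τy (S.term j.1)) * S.a j.1 ^ (y - τy (S.term j.1))
      else 0
    else
      if i.2 = false ∧ j.2 = true then
        p j.1 ^ q * S.a j.1 ^ (x + τy (S.term j.1)) * S.b j.1 ^ (y - τy (S.term j.1))
      else if i.2 = true ∧ j.2 = false then
        p j.1 ^ q * S.b j.1 ^ (x + τx (S.term j.1)) * S.a j.1 ^ (y - τx (S.term j.1))
      else 0
  else 0

/-! ### Words -/

/-- An admissible word: consecutive edges are composable. -/
def Admissible (S : BoxLikeGIFS V E) (w : List E) : Prop :=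
  List.Chain' (fun e e' => S.term e = S.init e') w

/-- `(c_w, d_w)`: width and height of the rectangle `ψ_w([0,1]²)`. -/
def wdims (S : BoxLikeGIFS V E) : List E → ℝ × ℝ
  | [] => (1, 1)
  | e :: w =>
      if S.diag e then (S.a e * (wdims S w).1, S.b e * (wdims S w).2)
      else (S.a e * (wdims S w).2, S.b e * (wdims S w).1)

/-- Whether `T_w` is diagonal (`true`) or anti-diagonal (`false`). -/
def wordDiag (S : BoxLikeGIFS V E) : List E → Bool
  | [] => true
  | e :: w => S.diag e == wordDiag S w

/-- The larger singular value `α₁(w) = max(c_w, d_w)` of `T_w`. -/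
def alpha1 (S : BoxLikeGIFS V E) (w : List E) : ℝ := max (S.wdims w).1 (S.wdims w).2

/-- The smaller singular value `α₂(w) = min(c_w, d_w)` of `T_w`. -/
def alpha2 (S : BoxLikeGIFS V E) (w : List E) : ℝ := min (S.wdims w).1 (S.wdims w).2

/-- Initial vertex of a (nonempty) word. -/
def wordInit [Nonempty V] (S : BoxLikeGIFS V E) (w : List E) : V :=
  (w.head?.map S.init).getD (Classical.arbitrary V)

/-- Terminal vertex of a (nonempty) word. -/
def wordTerm [Nonempty V] (S : BoxLikeGIFS V E) (w : List E) : V :=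
  (w.getLast?.map S.term).getD (Classical.arbitrary V)

/-- `p_w = p_{w_1} ⋯ p_{w_k}`. -/
def wordProb (p : E → ℝ) (w : List E) : ℝ := (w.map p).prod

/-- `τ_w(q)`: given the values `τx v`, `τy v` of the `L^q`-spectra of the two coordinate
projections of `μ_v`, this is the `L^q`-spectrum of the projection of `μ_{t(w)} ∘ ψ_w⁻¹`
onto the longest side of `ψ_w([0,1]²)`, i.e. `τx (t w)` if `π_w = π_x` and `τy (t w)`
otherwise. -/
def wordTau [Nonempty V] (S : BoxLikeGIFS V E) (τx τy : V → ℝ) (w : List E) : ℝ :=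
  if ((S.wdims w).2 ≤ (S.wdims w).1 ↔ S.wordDiag w = true) then τx (S.wordTerm w)
  else τy (S.wordTerm w)

/-- The modified singular value function
`φ^{s,q}(w) = p_w^q α₁(w)^{τ_w(q)} α₂(w)^{s - τ_w(q)}`. -/
def msvf [Nonempty V] (S : BoxLikeGIFS V E) (p : E → ℝ) (τx τy : V → ℝ)
    (s q : ℝ) (w : List E) : ℝ :=
  wordProb p w ^ q * S.alpha1 w ^ (S.wordTau τx τy w) *
    S.alpha2 w ^ (s - S.wordTau τx τy w)

/-- The modified singular value function matrix `A_k^{s,q}`. -/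
def Amat [Nonempty V] [Fintype E] (S : BoxLikeGIFS V E) (p : E → ℝ) (τx τy : V → ℝ)
    (s q : ℝ) (k : ℕ) : Matrix V V ℝ := fun v v' =>
  ∑ f : Fin k → E,
    if S.Admissible (List.ofFn f) ∧ S.wordInit (List.ofFn f) = v ∧
        S.wordTerm (List.ofFn f) = v'
    then S.msvf p τx τy s q (List.ofFn f) else 0

/-- The family `E^*_δ` of admissible words whose shortest side drops below `δ`
exactly at the last letter. -/
def EstarDelta (S : BoxLikeGIFS V E) (δ : ℝ) : Set (List E) :=
  {w | w ≠ [] ∧ S.Admissible w ∧ S.alpha2 w < δ ∧ δ ≤ S.alpha2 w.dropLast}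

end BoxLikeGIFS

/-! ### Partition of the projections, for the splitting proposition -/

/-- The projection family: `(v, false) ↦ μ_v^x` and `(v, true) ↦ μ_v^y`. -/
def projMeas {V : Type*} (μ : V → Measure (ℝ × ℝ)) (i : V × Bool) : Measure ℝ :=
  if i.2 then (μ i.1).map Prod.snd else (μ i.1).map Prod.fst

/-- `A`, `B` is a partition of the projection family `{μ_v^x, μ_v^y}_v` into two disjoint
families of cardinality `#V`, on each of which the `L^q`-spectra exist and share a common
value, and which splits `{μ_v^x, μ_v^y}` for each `v`. -/
def GoodPartition {V : Type*} [Fintype V] (μ : V → Measure (ℝ × ℝ))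
    (A B : Finset (V × Bool)) : Prop :=
  Disjoint A B ∧ A ∪ B = Finset.univ ∧
  A.card = Fintype.card V ∧ B.card = Fintype.card V ∧
  ∃ τA τB : ℝ → ℝ,
    (∀ q : ℝ, 0 ≤ q → ∀ i ∈ A, HasLq1 (projMeas μ i) q (τA q)) ∧
    (∀ q : ℝ, 0 ≤ q → ∀ i ∈ B, HasLq1 (projMeas μ i) q (τB q)) ∧
    ∀ v : V, ((v, false) ∈ A ∧ (v, true) ∈ B) ∨ ((v, false) ∈ B ∧ (v, true) ∈ A)

end LqGIFS

end

open LqGIFS MeasureTheory Filter Set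

namespace LqGIFS

/-! ### Spectral radius bounds for nonnegative matrices -/

section SpectralRadius

variable {ι : Type*} [Fintype ι]

lemma mulVec_mono_of_nonneg {A : Matrix ι ι ℝ} (hA : ∀ i j, 0 ≤ A i j) {u w : ι → ℝ}
    (h : ∀ i, u i ≤ w i) (i : ι) : A.mulVec u i ≤ A.mulVec w i :=
  Finset.sum_le_sum fun j _ => mul_le_mul_of_nonneg_left (h j) (hA i j)

lemma pow_entry_nonneg {A : Matrix ι ι ℝ} (hA : ∀ i j, 0 ≤ A i j) (k : ℕ) (i j : ι) :
    0 ≤ (A ^ k) i j := by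
  induction k generalizing i j with
  | zero =>
    rw [pow_zero, Matrix.one_apply]
    split_ifs <;> norm_num
  | succ k ih =>
    rw [pow_succ, Matrix.mul_apply]
    exact Finset.sum_nonneg fun l _ => mul_nonneg (ih i l) (hA l j)

lemma pow_mulVec_le {A : Matrix ι ι ℝ} (hA : ∀ i j, 0 ≤ A i j) {u : ι → ℝ} {κ : ℝ} (hκ : 0 ≤ κ)
    (h : ∀ i, A.mulVec u i ≤ κ * u i) (k : ℕ) (i : ι) : (A ^ k).mulVec u i ≤ κ ^ k * u i := by
  induction k generalizing i with
  | zero => simp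
  | succ k ih =>
    rw [pow_succ', ← Matrix.mulVec_mulVec]
    refine (mulVec_mono_of_nonneg hA (w := fun i => κ ^ k * u i) ih i).trans ?_
    have : A.mulVec (fun i => κ ^ k * u i) = κ ^ k • A.mulVec u := by
      rw [← Matrix.mulVec_smul]; rfl
    rw [this, Pi.smul_apply, smul_eq_mul, pow_succ, mul_assoc]
    exact mul_le_mul_of_nonneg_left (h i) (pow_nonneg hκ k)

lemma le_pow_mulVec {A : Matrix ι ι ℝ} (hA : ∀ i j, 0 ≤ A i j) {u : ι → ℝ} {κ : ℝ} (hκ : 0 ≤ κ)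
    (h : ∀ i, κ * u i ≤ A.mulVec u i) (k : ℕ) (i : ι) : κ ^ k * u i ≤ (A ^ k).mulVec u i := by
  induction k generalizing i with
  | zero => simp
  | succ k ih =>
    rw [pow_succ' A, ← Matrix.mulVec_mulVec]
    refine le_trans ?_ (mulVec_mono_of_nonneg hA (u := fun i => κ ^ k * u i) ih i)
    have : A.mulVec (fun i => κ ^ k * u i) = κ ^ k • A.mulVec u := by
      rw [← Matrix.mulVec_smul]; rfl
    rw [this, Pi.smul_apply, smul_eq_mul, pow_succ, mul_assoc]
    exact mul_le_mul_of_nonneg_left (h i) (pow_nonneg hκ k)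

lemma exists_pos_le_of_forall_pos {u : ι → ℝ} (hu : ∀ i, 0 < u i) : ∃ m, 0 < m ∧ ∀ i, m ≤ u i := by
  rcases isEmpty_or_nonempty ι with h | h
  · exact ⟨1, one_pos, fun i => h.elim i⟩
  · obtain ⟨i, hi⟩ := Finite.exists_min u
    exact ⟨u i, hu i, hi⟩

lemma exists_pos_ge (u : ι → ℝ) : ∃ M, 0 < M ∧ ∀ i, u i ≤ M := by
  rcases isEmpty_or_nonempty ι with h | h
  · exact ⟨1, one_pos, fun i => h.elim i⟩
  · obtain ⟨i, hi⟩ := Finite.exists_max u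
    exact ⟨max (u i) 1, by positivity, fun j => (hi j).trans (le_max_left _ _)⟩

lemma mnorm_nonneg (A : Matrix ι ι ℝ) : 0 ≤ mnorm A :=
  Finset.sum_nonneg fun _ _ => Finset.sum_nonneg fun _ _ => abs_nonneg _

lemma exists_mnorm_pow_le {A : Matrix ι ι ℝ} (hA : ∀ i j, 0 ≤ A i j) {u : ι → ℝ}
    (hu : ∀ i, 0 < u i) {κ : ℝ} (hκ : 0 ≤ κ) (h : ∀ i, A.mulVec u i ≤ κ * u i) :
    ∃ C, 0 < C ∧ ∀ k : ℕ, mnorm (A ^ k) ≤ C * κ ^ k := by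
  obtain ⟨m, hm, hmu⟩ := exists_pos_le_of_forall_pos hu
  refine ⟨(∑ i, u i) / m + 1, by
    have : 0 ≤ ∑ i, u i := Finset.sum_nonneg fun i _ => (hu i).le
    positivity, fun k => ?_⟩
  have h1 : m * mnorm (A ^ k) ≤ κ ^ k * ∑ i, u i := by
    rw [mnorm, Finset.mul_sum, Finset.mul_sum]
    refine Finset.sum_le_sum fun i _ => le_trans ?_ (pow_mulVec_le hA hκ h k i)
    rw [Finset.mul_sum]
    refine Finset.sum_le_sum fun j _ => ?_
    rw [abs_of_nonneg (pow_entry_nonneg hA k i j), mul_comm]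
    exact mul_le_mul_of_nonneg_left (hmu j) (pow_entry_nonneg hA k i j)
  have h2 : mnorm (A ^ k) ≤ (∑ i, u i) / m * κ ^ k := by
    rw [div_mul_eq_mul_div, le_div_iff₀ hm]; linarith
  nlinarith [pow_nonneg hκ k]

lemma exists_le_mnorm_pow [Nonempty ι] {A : Matrix ι ι ℝ} (hA : ∀ i j, 0 ≤ A i j) {u : ι → ℝ}
    (hu : ∀ i, 0 < u i) {κ : ℝ} (hκ : 0 ≤ κ) (h : ∀ i, κ * u i ≤ A.mulVec u i) :
    ∃ C, 0 < C ∧ ∀ k : ℕ, C * κ ^ k ≤ mnorm (A ^ k) := by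
  obtain ⟨M, hM, hMu⟩ := exists_pos_ge u
  refine ⟨(∑ i, u i) / M, div_pos (Finset.sum_pos (fun i _ => hu i) Finset.univ_nonempty) hM,
    fun k => ?_⟩
  rw [div_mul_eq_mul_div, div_le_iff₀ hM, mnorm, Finset.sum_mul, Finset.sum_mul]
  refine Finset.sum_le_sum fun i _ => ?_
  rw [mul_comm]
  refine (le_pow_mulVec hA hκ h k i).trans ?_
  rw [Finset.sum_mul]
  refine Finset.sum_le_sum fun j _ => ?_
  rw [abs_of_nonneg (pow_entry_nonneg hA k i j)]
  exact mul_le_mul_of_nonneg_left (hMu j) (pow_entry_nonneg hA k i j)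

lemma tendsto_mul_pow_rpow_inv {C κ : ℝ} (hC : 0 < C) (hκ : 0 ≤ κ) :
    Tendsto (fun k : ℕ => (C * κ ^ k) ^ ((k : ℝ)⁻¹)) atTop (nhds κ) := by
  have h1 : Tendsto (fun k : ℕ => C ^ ((k : ℝ)⁻¹) * κ) atTop (nhds (C ^ (0 : ℝ) * κ)) :=
    ((tendsto_const_nhds.rpow tendsto_inv_atTop_nhds_zero_nat (Or.inl hC.ne'))).mul_const κ
  rw [Real.rpow_zero, one_mul] at h1
  refine h1.congr' ?_
  filter_upwards [eventually_ne_atTop 0] with k hk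
  rw [Real.mul_rpow hC.le (pow_nonneg hκ k), Real.pow_rpow_inv_natCast hκ hk]

lemma specRad_le_of_mulVec_le {A : Matrix ι ι ℝ} (hA : ∀ i j, 0 ≤ A i j) {u : ι → ℝ}
    (hu : ∀ i, 0 < u i) {κ : ℝ} (hκ : 0 ≤ κ) (h : ∀ i, A.mulVec u i ≤ κ * u i) :
    specRad A ≤ κ := by
  obtain ⟨C, hC, hb⟩ := exists_mnorm_pow_le hA hu hκ h
  have ht := tendsto_mul_pow_rpow_inv hC hκ
  rw [specRad, ← ht.limsup_eq]
  refine limsup_le_limsup (Eventually.of_forall fun k => ?_) ?_ ht.isBoundedUnder_le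
  · exact Real.rpow_le_rpow (mnorm_nonneg _) (hb k) (by positivity)
  · exact IsBoundedUnder.isCoboundedUnder_le
      ⟨0, eventually_map.2 (Eventually.of_forall fun k => Real.rpow_nonneg (mnorm_nonneg _) _)⟩

lemma le_specRad_of_le_mulVec [Nonempty ι] {A : Matrix ι ι ℝ} (hA : ∀ i j, 0 ≤ A i j) {u : ι → ℝ}
    (hu : ∀ i, 0 < u i) {κ : ℝ} (hκ : 0 ≤ κ) (h : ∀ i, κ * u i ≤ A.mulVec u i) :
    κ ≤ specRad A := by
  obtain ⟨C, hC, hb⟩ := exists_le_mnorm_pow hA hu hκ h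
  obtain ⟨K, hK, hKb⟩ := exists_pos_ge fun i => A.mulVec u i / u i
  obtain ⟨C', hC', hb'⟩ := exists_mnorm_pow_le hA hu hK.le
    fun i => (div_le_iff₀ (hu i)).1 (hKb i)
  have ht := tendsto_mul_pow_rpow_inv hC hκ
  rw [specRad, ← ht.limsup_eq]
  refine limsup_le_limsup (Eventually.of_forall fun k => ?_) ht.isCoboundedUnder_le ?_
  · exact Real.rpow_le_rpow (by positivity) (hb k) (by positivity)
  · refine (tendsto_mul_pow_rpow_inv hC' hK.le).isBoundedUnder_le.mono_le
      (Eventually.of_forall fun k => ?_)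
    exact Real.rpow_le_rpow (mnorm_nonneg _) (hb' k) (by positivity)

end SpectralRadius

/-! ### Uniqueness and continuity of Perron vectors -/

section PerronVector

variable {ι : Type*} [Fintype ι]

lemma eq_zero_of_irreducible {A : Matrix ι ι ℝ} (hA : ∀ i j, 0 ≤ A i j)
    (hirr : ∀ i j, Relation.TransGen (fun i j => 0 < A i j) i j) {z : ι → ℝ} (hz : ∀ i, 0 ≤ z i)
    (hAz : A.mulVec z = z) {i : ι} (hi : z i = 0) (j : ι) : z j = 0 := by
  have zero_propagates : ∀ i j, z i = 0 → 0 < A i j → z j = 0 := by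
    intro i j hi hij
    have h0 : ∑ l, A i l * z l = 0 := (congrFun hAz i).trans hi
    have := (Finset.sum_eq_zero_iff_of_nonneg
      (fun l _ => mul_nonneg (hA i l) (hz l))).1 h0 j (Finset.mem_univ j)
    exact (mul_eq_zero.1 this).resolve_left hij.ne'
  induction hirr i j with
  | single h => exact zero_propagates _ _ hi h
  | tail _ h ih => exact zero_propagates _ _ ih h

lemma perron_unique [Nonempty ι] {A : Matrix ι ι ℝ} (hA : ∀ i j, 0 ≤ A i j)
    (hirr : ∀ i j, Relation.TransGen (fun i j => 0 < A i j) i j) {u w : ι → ℝ}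
    (hu : ∀ i, 0 < u i) (hu1 : ∑ i, u i = 1) (hAu : A.mulVec u = u)
    (hw1 : ∑ i, w i = 1) (hAw : A.mulVec w = w) : w = u := by
  obtain ⟨i₀, hi₀⟩ := Finite.exists_min fun i => w i / u i
  set t := w i₀ / u i₀ with ht
  have hz : ∀ j, (w - t • u) j = 0 := by
    refine eq_zero_of_irreducible hA hirr (i := i₀) ?_ ?_ ?_
    · intro i
      have := (le_div_iff₀ (hu i)).1 (hi₀ i)
      simpa using this
    · rw [Matrix.mulVec_sub, Matrix.mulVec_smul, hAu, hAw]
    · have := (hu i₀).ne'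
      simp [ht, this]
  have hwt : ∀ j, w j = t * u j := fun j => by
    have := hz j
    simp only [Pi.sub_apply, Pi.smul_apply, smul_eq_mul] at this
    linarith
  have ht1 : t = 1 := by
    have : ∑ j, w j = t * ∑ j, u j := by
      rw [Finset.mul_sum]; exact Finset.sum_congr rfl fun j _ => hwt j
    rw [hw1, hu1] at this
    linarith
  funext j
  rw [hwt j, ht1, one_mul]

lemma continuous_of_unique_fixed_vector {A : ℝ → Matrix ι ι ℝ} (hA : Continuous A)
    {u : ℝ → ι → ℝ} (hu : ∀ x, u x ∈ stdSimplex ℝ ι) (hfix : ∀ x, (A x).mulVec (u x) = u x)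
    (huniq : ∀ x, ∀ w ∈ stdSimplex ℝ ι, (A x).mulVec w = w → w = u x) : Continuous u := by
  rw [continuous_iff_seqContinuous]
  intro s x hs
  refine tendsto_of_subseq_tendsto fun ns hns => ?_
  obtain ⟨w, hw, φ, hφ, hlim⟩ := (isCompact_stdSimplex ℝ ι).tendsto_subseq
    (x := fun n => u (s (ns n))) fun n => hu _
  refine ⟨φ, ?_⟩
  have hwu : w = u x := by
    refine huniq x w hw ?_
    have h1 : Tendsto (fun n => A (s (ns (φ n)))) atTop (nhds (A x)) :=
      (hA.tendsto x).comp (hs.comp (hns.comp hφ.tendsto_atTop))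
    have hc : Continuous fun z : Matrix ι ι ℝ × (ι → ℝ) => z.1.mulVec z.2 :=
      Continuous.matrix_mulVec continuous_fst continuous_snd
    have h2 := (hc.tendsto (A x, w)).comp (h1.prodMk_nhds hlim)
    refine tendsto_nhds_unique h2 ?_
    refine hlim.congr fun n => ?_
    exact (hfix _).symm
  rw [← hwu]
  exact hlim

end PerronVector

end LqGIFS

namespace LqGIFS

/-! ### The curve `ρ(F_{x,y}) = 1` -/

section PressureCurve

variable {V E : Type} {ini ter : E → V} {p a b : E → ℝ} {q : ℝ}
  {Y : ℝ → ℝ} {f : ℝ → E → ℝ}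

lemma FmatG_nonneg (hp : ∀ e, 0 < p e) (ha : ∀ e, a e ∈ Ioo (0 : ℝ) 1)
    (hb : ∀ e, b e ∈ Ioo (0 : ℝ) 1) (x y : ℝ) (e e' : E) :
    0 ≤ FmatG ini ter p a b q x y e e' := by
  have := hp e'; have := (ha e').1; have := (hb e').1
  unfold FmatG
  split_ifs <;> positivity

lemma FmatG_pos_iff (hp : ∀ e, 0 < p e) (ha : ∀ e, a e ∈ Ioo (0 : ℝ) 1)
    (hb : ∀ e, b e ∈ Ioo (0 : ℝ) 1) (x y : ℝ) (e e' : E) :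
    0 < FmatG ini ter p a b q x y e e' ↔ ter e = ini e' := by
  have := hp e'; have := (ha e').1; have := (hb e').1
  unfold FmatG
  split_ifs with h
  · exact iff_of_true (by positivity) h
  · exact iff_of_false (lt_irrefl _) h

/-- Changing the exponents multiplies each column by powers of the two ratios of its edge. -/
lemma FmatG_shift (ha : ∀ e, a e ∈ Ioo (0 : ℝ) 1) (hb : ∀ e, b e ∈ Ioo (0 : ℝ) 1)
    (x y x' y' : ℝ) (e e' : E) :
    FmatG ini ter p a b q x' y' e e' =
      FmatG ini ter p a b q x y e e' * (a e' ^ (x' - x) * b e' ^ (y' - y)) := by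
  unfold FmatG
  split_ifs
  · rw [Real.rpow_sub (ha e').1, Real.rpow_sub (hb e').1]
    have := (Real.rpow_pos_of_pos (ha e').1 x).ne'
    have := (Real.rpow_pos_of_pos (hb e').1 y).ne'
    field_simp
  · simp

lemma edge_transGen (hSC : GraphSC ini ter) (e e' : E) :
    Relation.TransGen (fun e e' => ter e = ini e') e e' := by
  suffices H : ∀ v, Relation.TransGen (fun u u' : V => ∃ e, ini e = u ∧ ter e = u') (ter e) v →
      ∀ e', ini e' = v → Relation.TransGen (fun e e' => ter e = ini e') e e' from
    H _ (hSC (ter e) (ini e')) e' rfl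
  intro v hv
  induction hv with
  | single h =>
    obtain ⟨e₁, h1, h2⟩ := h
    intro e' he'
    exact Relation.TransGen.tail (b := e₁) (Relation.TransGen.single h1.symm) (h2.trans he'.symm)
  | tail _ h ih =>
    obtain ⟨e₁, h1, h2⟩ := h
    intro e' he'
    exact (ih e₁ h1).tail (h2.trans he'.symm)

variable [Fintype E]

lemma specRad_lt_one_of_lt [Nonempty E] (hp : ∀ e, 0 < p e) (ha : ∀ e, a e ∈ Ioo (0 : ℝ) 1)
    (hb : ∀ e, b e ∈ Ioo (0 : ℝ) 1) {x y y' : ℝ} {u : E → ℝ} (hu : ∀ e, 0 < u e)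
    (hFu : (FmatG ini ter p a b q x y).mulVec u = u) (hy : y < y') :
    specRad (FmatG ini ter p a b q x y') < 1 := by
  obtain ⟨m, hm⟩ := Finite.exists_max fun e => b e ^ (y' - y)
  refine lt_of_le_of_lt (specRad_le_of_mulVec_le (FmatG_nonneg hp ha hb x y') hu
    (κ := b m ^ (y' - y)) (Real.rpow_nonneg (hb m).1.le _) fun e => ?_)
    (Real.rpow_lt_one (hb m).1.le (hb m).2 (by linarith))
  nth_rewrite 2 [← hFu]
  simp only [Matrix.mulVec, dotProduct]
  rw [Finset.mul_sum]
  refine Finset.sum_le_sum fun e' _ => ?_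
  rw [FmatG_shift ha hb x y x y']
  have h1 := mul_nonneg (FmatG_nonneg (ini := ini) (ter := ter) (q := q) hp ha hb x y e e')
    (hu e').le
  have h2 := mul_le_mul_of_nonneg_left (hm e') h1
  simp only [sub_self, Real.rpow_zero, one_mul]
  linarith

lemma one_lt_specRad_of_lt [Nonempty E] (hp : ∀ e, 0 < p e) (ha : ∀ e, a e ∈ Ioo (0 : ℝ) 1)
    (hb : ∀ e, b e ∈ Ioo (0 : ℝ) 1) {x y y' : ℝ} {u : E → ℝ} (hu : ∀ e, 0 < u e)
    (hFu : (FmatG ini ter p a b q x y).mulVec u = u) (hy : y' < y) :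
    1 < specRad (FmatG ini ter p a b q x y') := by
  obtain ⟨m, hm⟩ := Finite.exists_min fun e => b e ^ (y' - y)
  refine lt_of_lt_of_le (Real.one_lt_rpow_of_pos_of_lt_one_of_neg (hb m).1 (hb m).2
    (by linarith : y' - y < 0)) (le_specRad_of_le_mulVec (FmatG_nonneg hp ha hb x y') hu
    (κ := b m ^ (y' - y)) (Real.rpow_nonneg (hb m).1.le _) fun e => ?_)
  nth_rewrite 1 [← hFu]
  simp only [Matrix.mulVec, dotProduct]
  rw [Finset.mul_sum]
  refine Finset.sum_le_sum fun e' _ => ?_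
  rw [FmatG_shift ha hb x y x y']
  have h1 := mul_nonneg (FmatG_nonneg (ini := ini) (ter := ter) (q := q) hp ha hb x y e e')
    (hu e').le
  have h2 := mul_le_mul_of_nonneg_left (hm e') h1
  simp only [sub_self, Real.rpow_zero, one_mul]
  linarith

lemma eq_of_specRad_eq_one [Nonempty E] (hp : ∀ e, 0 < p e) (ha : ∀ e, a e ∈ Ioo (0 : ℝ) 1)
    (hb : ∀ e, b e ∈ Ioo (0 : ℝ) 1)
    (hP : ∀ x, IsPerronData ini ter p a b q x (Y x) (f x)) {x y : ℝ}
    (h : specRad (FmatG ini ter p a b q x y) = 1) : y = Y x := by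
  obtain ⟨-, u, -, hu, -, -, hFu, -⟩ := hP x
  rcases lt_trichotomy y (Y x) with hlt | heq | hgt
  · exact absurd h (one_lt_specRad_of_lt hp ha hb hu hFu hlt).ne'
  · exact heq
  · exact absurd h (specRad_lt_one_of_lt hp ha hb hu hFu hgt).ne

lemma IsPerronData.pos {x y : ℝ} {g : E → ℝ} (h : IsPerronData ini ter p a b q x y g) (e : E) :
    0 < g e := by
  obtain ⟨-, u, v, hu, hv, -, -, -, -, hg⟩ := h
  rw [hg]; exact mul_pos (hv e) (hu e)

/-- The Perron weights give a subgradient of the pressure. -/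
lemma IsPerronData.subgradient (hp : ∀ e, 0 < p e) (ha : ∀ e, a e ∈ Ioo (0 : ℝ) 1)
    (hb : ∀ e, b e ∈ Ioo (0 : ℝ) 1) {x y x' y' : ℝ} {g g' : E → ℝ}
    (h : IsPerronData ini ter p a b q x y g) (h' : IsPerronData ini ter p a b q x' y' g') :
    (x' - x) * ∑ e, g e * Real.log (a e) + (y' - y) * ∑ e, g e * Real.log (b e) ≤ 0 := by
  obtain ⟨-, u, v, hu, hv, -, hFu, hFv, h1, hg⟩ := h
  obtain ⟨-, u', -, hu', -, -, hFu', -⟩ := h'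
  set F := FmatG ini ter p a b q x y with hF
  set r : E → ℝ := fun e => a e ^ (x' - x) * b e ^ (y' - y) with hr
  have hr0 : ∀ e, 0 < r e := fun e =>
    mul_pos (Real.rpow_pos_of_pos (ha e).1 _) (Real.rpow_pos_of_pos (hb e).1 _)
  have hlogr : ∀ e, Real.log (r e) = (x' - x) * Real.log (a e) + (y' - y) * Real.log (b e) := by
    intro e
    rw [hr]
    simp only
    rw [Real.log_mul (Real.rpow_pos_of_pos (ha e).1 _).ne' (Real.rpow_pos_of_pos (hb e).1 _).ne',
      Real.log_rpow (ha e).1, Real.log_rpow (hb e).1]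
  set ℓ : E → ℝ := fun e => Real.log (u' e / u e) with hℓ
  have hrow : ∀ e, ∑ e', v e * F e e' * u e' = g e := fun e => by
    have := congrFun hFu e
    simp only [Matrix.mulVec, dotProduct] at this
    simp only [mul_assoc, ← Finset.mul_sum]
    rw [this, hg]
  have hcol : ∀ e', ∑ e, v e * F e e' * u e' = g e' := fun e' => by
    have := congrFun hFv e'
    simp only [Matrix.vecMul, dotProduct] at this
    rw [← Finset.sum_mul, this, hg]
  have key : ∑ e, ∑ e', v e * F e e' * u e' * (Real.log (r e') + ℓ e' - ℓ e) ≤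
      ∑ e, ∑ e', v e * F e e' * u e' * (r e' * (u' e' / u e') / (u' e / u e) - 1) := by
    refine Finset.sum_le_sum fun e _ => Finset.sum_le_sum fun e' _ => ?_
    refine mul_le_mul_of_nonneg_left ?_
      (mul_nonneg (mul_nonneg (hv e).le (FmatG_nonneg hp ha hb x y e e')) (hu e').le)
    have hA : 0 < u' e' / u e' := div_pos (hu' e') (hu e')
    have hB : 0 < u' e / u e := div_pos (hu' e) (hu e)
    have := Real.log_le_sub_one_of_pos (div_pos (mul_pos (hr0 e') hA) hB)
    rwa [Real.log_div (mul_pos (hr0 e') hA).ne' hB.ne', Real.log_mul (hr0 e').ne' hA.ne'] at this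
  have hR : ∑ e, ∑ e', v e * F e e' * u e' * (r e' * (u' e' / u e') / (u' e / u e) - 1) = 0 := by
    have : ∀ e, ∑ e', v e * F e e' * u e' * (r e' * (u' e' / u e') / (u' e / u e) - 1) = 0 := by
      intro e
      simp only [mul_sub, mul_one, Finset.sum_sub_distrib]
      rw [hrow e, hg e, sub_eq_zero]
      have h2 : ∀ e', v e * F e e' * u e' * (r e' * (u' e' / u e') / (u' e / u e)) =
          v e * u e / u' e * (FmatG ini ter p a b q x' y' e e' * u' e') := by
        intro e'
        rw [FmatG_shift ha hb x y x' y']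
        have := (hu e).ne'; have := (hu e').ne'; have := (hu' e).ne'
        simp only [← hF, hr]
        field_simp
      simp only [h2, ← Finset.mul_sum]
      have h3 := congrFun hFu' e
      simp only [Matrix.mulVec, dotProduct] at h3
      rw [h3]
      have := (hu' e).ne'
      field_simp
    exact Finset.sum_eq_zero fun e _ => this e
  have hL : ∑ e, ∑ e', v e * F e e' * u e' * (Real.log (r e') + ℓ e' - ℓ e) =
      ∑ e, g e * Real.log (r e) := by
    simp only [mul_sub, Finset.sum_sub_distrib, ← Finset.sum_mul, hrow]
    rw [Finset.sum_comm]
    simp only [← Finset.sum_mul, hcol, mul_add, Finset.sum_add_distrib]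
    ring
  rw [hL, hR] at key
  refine le_trans (le_of_eq ?_) key
  rw [Finset.mul_sum, Finset.mul_sum, ← Finset.sum_add_distrib]
  refine Finset.sum_congr rfl fun e _ => ?_
  rw [hlogr]; ring

lemma sum_mul_log_neg [Nonempty E] {g c : E → ℝ} (hg : ∀ e, 0 < g e)
    (hc : ∀ e, c e ∈ Ioo (0 : ℝ) 1) : ∑ e, g e * Real.log (c e) < 0 :=
  Finset.sum_neg (fun e _ => mul_neg_of_pos_of_neg (hg e) (Real.log_neg (hc e).1 (hc e).2))
    Finset.univ_nonempty

/-- Minus the slope of the curve `y = Y(x)`, read off from the Perron weights. -/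
noncomputable def slope (a b : E → ℝ) (g : E → ℝ) : ℝ :=
  (∑ e, g e * Real.log (a e)) / ∑ e, g e * Real.log (b e)

lemma slope_pos [Nonempty E] {g : E → ℝ} (hg : ∀ e, 0 < g e) (ha : ∀ e, a e ∈ Ioo (0 : ℝ) 1)
    (hb : ∀ e, b e ∈ Ioo (0 : ℝ) 1) : 0 < slope a b g :=
  div_pos_of_neg_of_neg (sum_mul_log_neg hg ha) (sum_mul_log_neg hg hb)

lemma exists_slope_le [Nonempty E] (hb : ∀ e, b e ∈ Ioo (0 : ℝ) 1) : ∃ M, 0 < M ∧ ∀ g : E → ℝ, (∀ e, 0 < g e) →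
      slope a b g ≤ M := by
  obtain ⟨M, hM, hMe⟩ := exists_pos_ge fun e => Real.log (a e) / Real.log (b e)
  refine ⟨M, hM, fun g hg => ?_⟩
  rw [slope, div_le_iff_of_neg (sum_mul_log_neg hg hb), Finset.mul_sum]
  refine Finset.sum_le_sum fun e _ => ?_
  have h1 := (div_le_iff_of_neg (Real.log_neg (hb e).1 (hb e).2)).1 (hMe e)
  have h2 := mul_le_mul_of_nonneg_left h1 (hg e).le
  linarith

lemma sum_mul_log_div (ha : ∀ e, a e ∈ Ioo (0 : ℝ) 1) (hb : ∀ e, b e ∈ Ioo (0 : ℝ) 1)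
    (g : E → ℝ) : ∑ e, g e * Real.log (a e / b e) =
      ∑ e, g e * Real.log (a e) - ∑ e, g e * Real.log (b e) := by
  rw [← Finset.sum_sub_distrib]
  refine Finset.sum_congr rfl fun e _ => ?_
  rw [Real.log_div (ha e).1.ne' (hb e).1.ne', mul_sub]

lemma slope_le_one_iff [Nonempty E] {g : E → ℝ} (hg : ∀ e, 0 < g e)
    (ha : ∀ e, a e ∈ Ioo (0 : ℝ) 1) (hb : ∀ e, b e ∈ Ioo (0 : ℝ) 1) :
    slope a b g ≤ 1 ↔ 0 ≤ ∑ e, g e * Real.log (a e / b e) := by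
  rw [slope, div_le_iff_of_neg (sum_mul_log_neg hg hb), sum_mul_log_div ha hb, one_mul, sub_nonneg]

lemma one_le_slope_iff [Nonempty E] {g : E → ℝ} (hg : ∀ e, 0 < g e)
    (ha : ∀ e, a e ∈ Ioo (0 : ℝ) 1) (hb : ∀ e, b e ∈ Ioo (0 : ℝ) 1) :
    1 ≤ slope a b g ↔ ∑ e, g e * Real.log (a e / b e) ≤ 0 := by
  rw [slope, le_div_iff_of_neg (sum_mul_log_neg hg hb), sum_mul_log_div ha hb, one_mul, sub_nonpos]

lemma curve_supporting_line [Nonempty E] (hp : ∀ e, 0 < p e) (ha : ∀ e, a e ∈ Ioo (0 : ℝ) 1)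
    (hb : ∀ e, b e ∈ Ioo (0 : ℝ) 1) (hP : ∀ x, IsPerronData ini ter p a b q x (Y x) (f x))
    (x x' : ℝ) : Y x - (x' - x) * slope a b (f x) ≤ Y x' := by
  have h := (hP x).subgradient hp ha hb (hP x')
  have hB := sum_mul_log_neg (hP x).pos hb
  have : (x' - x) * slope a b (f x) = ((x' - x) * ∑ e, f x e * Real.log (a e)) /
      ∑ e, f x e * Real.log (b e) := by rw [slope, mul_div_assoc]
  rw [this, sub_le_comm]
  rw [le_div_iff_of_neg hB]
  linarith

lemma curve_strictAnti [Nonempty E] (hp : ∀ e, 0 < p e) (ha : ∀ e, a e ∈ Ioo (0 : ℝ) 1)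
    (hb : ∀ e, b e ∈ Ioo (0 : ℝ) 1) (hP : ∀ x, IsPerronData ini ter p a b q x (Y x) (f x)) :
    StrictAnti Y := by
  intro x x' hx
  have h := curve_supporting_line hp ha hb hP x' x
  have := mul_pos (sub_pos.2 hx) (slope_pos (hP x').pos ha hb)
  linarith

lemma curve_continuous [Nonempty E] (hp : ∀ e, 0 < p e) (ha : ∀ e, a e ∈ Ioo (0 : ℝ) 1)
    (hb : ∀ e, b e ∈ Ioo (0 : ℝ) 1) (hP : ∀ x, IsPerronData ini ter p a b q x (Y x) (f x)) :
    Continuous Y := by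
  obtain ⟨M, hM, hMg⟩ := exists_slope_le (a := a) hb
  have key : ∀ x x', Y x - Y x' ≤ M * |x - x'| := by
    intro x x'
    have h := curve_supporting_line hp ha hb hP x x'
    have h1 := hMg (f x) (hP x).pos
    have h2 := slope_pos (hP x).pos ha hb
    have h3 : (x' - x) * slope a b (f x) ≤ |x - x'| * M := by
      refine (mul_le_mul_of_nonneg_right (le_abs_self _) h2.le).trans ?_
      rw [abs_sub_comm]
      exact mul_le_mul_of_nonneg_left h1 (abs_nonneg _)
    linarith
  refine LipschitzWith.continuous (K := M.toNNReal) (LipschitzWith.of_dist_le_mul fun x x' => ?_)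
  rw [Real.dist_eq, Real.dist_eq, Real.coe_toNNReal _ hM.le, abs_le]
  have := key x' x
  rw [abs_sub_comm] at this
  exact ⟨by linarith, key x x'⟩

lemma perronWeights_continuous [Nonempty E] (hSC : GraphSC ini ter) (hp : ∀ e, 0 < p e)
    (ha : ∀ e, a e ∈ Ioo (0 : ℝ) 1) (hb : ∀ e, b e ∈ Ioo (0 : ℝ) 1)
    (hP : ∀ x, IsPerronData ini ter p a b q x (Y x) (f x)) : Continuous f := by
  have hY := curve_continuous hp ha hb hP
  have hF : Continuous fun x => FmatG ini ter p a b q x (Y x) := by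
    refine continuous_pi fun e => continuous_pi fun e' => ?_
    unfold FmatG
    split_ifs
    · exact (continuous_const.mul (continuous_const.rpow continuous_id
        fun _ => Or.inl (ha e').1.ne')).mul
        (continuous_const.rpow hY fun _ => Or.inl (hb e').1.ne')
    · exact continuous_const
  have hirr : ∀ x e e', Relation.TransGen
      (fun e e' => 0 < FmatG ini ter p a b q x (Y x) e e') e e' := fun x e e' =>
    (edge_transGen hSC e e').lift id fun _ _ h => (FmatG_pos_iff hp ha hb _ _ _ _).2 h
  choose _ u v hu hv hu1 hFu hFv huv hf using hP
  have hcu : Continuous u := continuous_of_unique_fixed_vector hF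
    (fun x => ⟨fun e => (hu x e).le, hu1 x⟩) hFu fun x w hw hFw =>
      perron_unique (FmatG_nonneg hp ha hb _ _) (hirr x) (hu x) (hu1 x) (hFu x) hw.2 hFw
  have hvs : ∀ x, 0 < ∑ e, v x e := fun x =>
    Finset.sum_pos (fun e _ => hv x e) Finset.univ_nonempty
  set v' : ℝ → E → ℝ := fun x => (∑ e, v x e)⁻¹ • v x with hv'
  have hv'pos : ∀ x e, 0 < v' x e := fun x e => mul_pos (inv_pos.2 (hvs x)) (hv x e)
  have hv'1 : ∀ x, ∑ e, v' x e = 1 := fun x => by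
    simp only [hv', Pi.smul_apply, smul_eq_mul, ← Finset.mul_sum]
    exact inv_mul_cancel₀ (hvs x).ne'
  have hFv' : ∀ x, (FmatG ini ter p a b q x (Y x)).transpose.mulVec (v' x) = v' x := fun x => by
    rw [hv', Matrix.mulVec_smul, Matrix.mulVec_transpose, hFv]
  have hcv : Continuous v' := continuous_of_unique_fixed_vector hF.matrix_transpose
    (fun x => ⟨fun e => (hv'pos x e).le, hv'1 x⟩) hFv' fun x w hw hFw =>
      perron_unique (fun e e' => FmatG_nonneg hp ha hb _ _ _ _)
        (fun e e' => Relation.transGen_swap.2 (hirr x e' e)) (hv'pos x) (hv'1 x) (hFv' x) hw.2 hFw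
  have hden : ∀ x, ∑ e, v' x e * u x e = (∑ e, v x e)⁻¹ := fun x => by
    simp only [hv', Pi.smul_apply, smul_eq_mul, mul_assoc, ← Finset.mul_sum, huv, mul_one]
  have hfe : f = fun x e => v' x e * u x e / ∑ e', v' x e' * u x e' := by
    funext x e
    have := (hvs x).ne'
    rw [hden, hf, hv']
    simp only [Pi.smul_apply, smul_eq_mul]
    field_simp
  rw [hfe]
  refine continuous_pi fun e => Continuous.div ?_ ?_ fun x => ?_
  · exact ((continuous_apply e).comp hcv).mul ((continuous_apply e).comp hcu)
  · exact continuous_finsetSum _ fun e' _ =>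
      ((continuous_apply e').comp hcv).mul ((continuous_apply e').comp hcu)
  · rw [hden]; exact inv_ne_zero (hvs x).ne'

lemma slope_continuous [Nonempty E] (hSC : GraphSC ini ter) (hp : ∀ e, 0 < p e)
    (ha : ∀ e, a e ∈ Ioo (0 : ℝ) 1) (hb : ∀ e, b e ∈ Ioo (0 : ℝ) 1)
    (hP : ∀ x, IsPerronData ini ter p a b q x (Y x) (f x)) :
    Continuous fun x => slope a b (f x) := by
  have hf := perronWeights_continuous hSC hp ha hb hP
  refine Continuous.div ?_ ?_ fun x => (sum_mul_log_neg (hP x).pos hb).ne <;>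
  exact continuous_finsetSum _ fun e _ => ((continuous_apply e).comp hf).mul continuous_const

/-- If the slope of `x + Y(x)` at `x` is nonnegative, then moving slightly to the left increases
`x + Y(x)` by at most `η` times the displacement. -/
lemma exists_left_displacement [Nonempty E] (hSC : GraphSC ini ter) (hp : ∀ e, 0 < p e)
    (ha : ∀ e, a e ∈ Ioo (0 : ℝ) 1) (hb : ∀ e, b e ∈ Ioo (0 : ℝ) 1)
    (hP : ∀ x, IsPerronData ini ter p a b q x (Y x) (f x)) {x η : ℝ} (hη : 0 < η)
    (hx : slope a b (f x) ≤ 1) : ∃ θ, 0 < θ ∧ Y (x - θ) ≤ Y x + θ + η * θ := by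
  have hc : Tendsto (fun θ : ℝ => slope a b (f (x - θ))) (nhdsWithin 0 (Ioi 0))
      (nhds (slope a b (f x))) := by
    have h1 := slope_continuous hSC hp ha hb hP
    have h2 : Continuous fun θ : ℝ => slope a b (f (x - θ)) :=
      h1.comp (by fun_prop : Continuous fun θ : ℝ => x - θ)
    have h3 := h2.tendsto 0
    rw [sub_zero] at h3
    exact h3.mono_left nhdsWithin_le_nhds
  obtain ⟨θ, h1, h2⟩ := ((hc.eventually (gt_mem_nhds (show slope a b (f x) < 1 + η by linarith))).and
    self_mem_nhdsWithin).exists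
  refine ⟨θ, h2, ?_⟩
  have h3 := curve_supporting_line hp ha hb hP (x - θ) x
  have h4 := mul_le_mul_of_nonneg_left h1.le (mem_Ioi.1 h2).le
  have h5 : x - (x - θ) = θ := by ring
  rw [h5] at h3
  linarith

/-- If the slope of `x + Y(x)` at `x` is nonpositive, then moving slightly to the right increases
`x + Y(x)` by at most `η` times the displacement. -/
lemma exists_right_displacement [Nonempty E] (hSC : GraphSC ini ter) (hp : ∀ e, 0 < p e)
    (ha : ∀ e, a e ∈ Ioo (0 : ℝ) 1) (hb : ∀ e, b e ∈ Ioo (0 : ℝ) 1)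
    (hP : ∀ x, IsPerronData ini ter p a b q x (Y x) (f x)) {x η : ℝ} (hη : 0 < η)
    (hx : 1 ≤ slope a b (f x)) : ∃ θ, 0 < θ ∧ Y (x + θ) ≤ Y x - θ + η * θ := by
  have hc : Tendsto (fun θ : ℝ => slope a b (f (x + θ))) (nhdsWithin 0 (Ioi 0))
      (nhds (slope a b (f x))) := by
    have h1 := slope_continuous hSC hp ha hb hP
    have h2 : Continuous fun θ : ℝ => slope a b (f (x + θ)) :=
      h1.comp (by fun_prop : Continuous fun θ : ℝ => x + θ)
    have h3 := h2.tendsto 0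
    rw [add_zero] at h3
    exact h3.mono_left nhdsWithin_le_nhds
  obtain ⟨θ, h1, h2⟩ := ((hc.eventually (lt_mem_nhds (show 1 - η < slope a b (f x) by linarith))).and
    self_mem_nhdsWithin).exists
  refine ⟨θ, h2, ?_⟩
  have h3 := curve_supporting_line hp ha hb hP (x + θ) x
  have h4 := mul_le_mul_of_nonneg_left h1.le (mem_Ioi.1 h2).le
  have h5 : x - (x + θ) = -θ := by ring
  rw [h5] at h3
  linarith

/-- A positive fixed vector of `F_{x,Y(x)}`, read on the vertices. -/
lemma exists_vertex_weights (hout : ∀ v, ∃ e, ini e = v) (hp : ∀ e, 0 < p e)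
    (ha : ∀ e, a e ∈ Ioo (0 : ℝ) 1) (hb : ∀ e, b e ∈ Ioo (0 : ℝ) 1) {x y : ℝ} {g : E → ℝ}
    (hP : IsPerronData ini ter p a b q x y g) : ∃ U : V → ℝ, (∀ v, 0 < U v) ∧
      ∀ v, U v = ∑ e, if ini e = v then p e ^ q * a e ^ x * b e ^ y * U (ter e) else 0 := by
  obtain ⟨-, u, -, hu, -, -, hFu, -⟩ := hP
  have hpos : ∀ e, 0 < p e ^ q * a e ^ x * b e ^ y := fun e => by
    have := hp e; have := (ha e).1; have := (hb e).1
    positivity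
  set U : V → ℝ := fun v => ∑ e, if ini e = v then p e ^ q * a e ^ x * b e ^ y * u e else 0
  have hU : ∀ e, U (ter e) = u e := fun e => by
    refine Eq.trans ?_ (congrFun hFu e)
    refine Finset.sum_congr rfl fun e' _ => ?_
    unfold FmatG
    by_cases h : ini e' = ter e
    · simp [h]
    · simp [h, Ne.symm h]
  refine ⟨U, fun v => ?_, fun v => Finset.sum_congr rfl fun e _ => by rw [hU]⟩
  obtain ⟨e, he⟩ := hout v
  refine Finset.sum_pos' (fun e _ => ?_) ⟨e, Finset.mem_univ e, ?_⟩
  · split_ifs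
    · exact (mul_pos (hpos e) (hu e)).le
    · exact le_rfl
  · rw [if_pos he]; exact mul_pos (hpos e) (hu e)

end PressureCurve

end LqGIFS

namespace LqGIFS

/-! ### Moment sums in `[0,∞]` -/

section Moments

open scoped ENNReal

/-- The summand `m ^ q` of a moment sum, with the convention that null sets do not contribute. -/
noncomputable def qpow (q : ℝ) (m : ℝ≥0∞) : ℝ≥0∞ := if m = 0 then 0 else m ^ q

@[simp] lemma qpow_zero_right (q : ℝ) : qpow q 0 = 0 := if_pos rfl

lemma qpow_of_ne_zero (q : ℝ) {m : ℝ≥0∞} (hm : m ≠ 0) : qpow q m = m ^ q := if_neg hm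

lemma qpow_mono {q : ℝ} (hq : 0 ≤ q) {m n : ℝ≥0∞} (h : m ≤ n) : qpow q m ≤ qpow q n := by
  by_cases hm : m = 0
  · simp [hm]
  · rw [qpow_of_ne_zero q hm, qpow_of_ne_zero q (fun hn => hm (le_zero_iff.1 (hn ▸ h)))]
    exact ENNReal.rpow_le_rpow h hq

lemma qpow_mul {q : ℝ} (hq : 0 ≤ q) (m n : ℝ≥0∞) : qpow q (m * n) = qpow q m * qpow q n := by
  by_cases hm : m = 0
  · simp [hm]
  by_cases hn : n = 0
  · simp [hn]
  rw [qpow_of_ne_zero q hm, qpow_of_ne_zero q hn, qpow_of_ne_zero q (mul_ne_zero hm hn),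
    ENNReal.mul_rpow_of_nonneg _ _ hq]

lemma qpow_ofReal {q r : ℝ} (hr : 0 < r) : qpow q (ENNReal.ofReal r) = ENNReal.ofReal (r ^ q) := by
  rw [qpow_of_ne_zero q (by simpa using hr), ENNReal.ofReal_rpow_of_pos hr]

lemma qpow_le_one {q : ℝ} (hq : 0 ≤ q) {m : ℝ≥0∞} (hm : m ≤ 1) : qpow q m ≤ 1 := by
  refine (qpow_mono hq hm).trans ?_
  rw [qpow_of_ne_zero q one_ne_zero, ENNReal.one_rpow]

lemma sum_filter_ne_zero (s : Multiset ℝ≥0∞) : (s.filter (· ≠ 0)).sum = s.sum := by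
  induction s using Multiset.induction with
  | empty => simp
  | cons m s ih =>
    by_cases hm : m = 0
    · rw [Multiset.filter_cons_of_neg _ (by simpa using hm), ih, Multiset.sum_cons, hm, zero_add]
    · rw [Multiset.filter_cons_of_pos (p := (· ≠ 0)) _ hm, Multiset.sum_cons, Multiset.sum_cons, ih]

lemma sum_map_qpow_filter_ne_zero (q : ℝ) (s : Multiset ℝ≥0∞) :
    ((s.filter (· ≠ 0)).map (qpow q)).sum = (s.map (qpow q)).sum := by
  induction s using Multiset.induction with
  | empty => simp
  | cons m s ih =>
    by_cases hm : m = 0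
    · rw [Multiset.filter_cons_of_neg _ (by simpa using hm), ih, Multiset.map_cons,
        Multiset.sum_cons, hm, qpow_zero_right, zero_add]
    · rw [Multiset.filter_cons_of_pos (p := (· ≠ 0)) _ hm, Multiset.map_cons, Multiset.map_cons,
        Multiset.sum_cons, Multiset.sum_cons, ih]

lemma qpow_sum_le {q : ℝ} (hq : 0 ≤ q) (s : Multiset ℝ≥0∞) {M : ℕ}
    (hM : (s.filter (· ≠ 0)).card ≤ M) :
    qpow q s.sum ≤ (M : ℝ≥0∞) ^ q * (s.map (qpow q)).sum := by
  rw [← sum_filter_ne_zero, ← sum_map_qpow_filter_ne_zero]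
  set s' := s.filter (· ≠ 0) with hs'
  by_cases h0 : s' = 0
  · simp [h0]
  obtain ⟨m, hm, hmax⟩ : ∃ m ∈ s', ∀ n ∈ s', n ≤ m := by
    have hne : s'.toFinset.Nonempty := by
      rw [Multiset.toFinset_nonempty]; exact h0
    obtain ⟨m, hm, hmax⟩ := Finset.exists_max_image s'.toFinset id hne
    exact ⟨m, Multiset.mem_toFinset.1 hm, fun n hn => hmax n (Multiset.mem_toFinset.2 hn)⟩
  have hm0 : m ≠ 0 := (Multiset.mem_filter (p := (· ≠ 0)).1 hm).2
  have hsum : s'.sum ≤ M * m := by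
    refine (Multiset.sum_le_card_nsmul s' m hmax).trans ?_
    rw [nsmul_eq_mul]
    gcongr
  have hM0 : (M : ℝ≥0∞) ≠ 0 := by
    have : 0 < s'.card := Multiset.card_pos.2 h0
    exact Nat.cast_ne_zero.2 (by omega)
  refine (qpow_mono hq hsum).trans ?_
  rw [qpow_mul hq, qpow_of_ne_zero q hM0]
  gcongr
  exact Multiset.single_le_sum (fun _ _ => zero_le) _ (Multiset.mem_map_of_mem _ hm)

lemma sum_qpow_le {q : ℝ} (hq : 0 ≤ q) (s : Multiset ℝ≥0∞) {M : ℕ}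
    (hM : (s.filter (· ≠ 0)).card ≤ M) : (s.map (qpow q)).sum ≤ M * qpow q s.sum := by
  rw [← sum_map_qpow_filter_ne_zero]
  refine (Multiset.sum_le_card_nsmul _ (qpow q s.sum) fun y hy => ?_).trans ?_
  · obtain ⟨n, hn, rfl⟩ := Multiset.mem_map.1 hy
    exact qpow_mono hq (Multiset.single_le_sum (fun _ _ => zero_le) _
      (Multiset.mem_filter.1 hn).1)
  · rw [nsmul_eq_mul, Multiset.card_map]
    gcongr

lemma qpow_add_le {q : ℝ} (hq : 0 ≤ q) (m n : ℝ≥0∞) :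
    qpow q (m + n) ≤ 2 ^ q * (qpow q m + qpow q n) := by
  have h := qpow_sum_le hq {m, n} (M := 2) ((Multiset.card_le_card (Multiset.filter_le _ _)).trans
    (by simp))
  simpa using h

/-- The moment sum over the mesh of size `ε` shifted by `θ ε`. -/
noncomputable def shiftedSum (q : ℝ) (ν : Measure ℝ) (ε θ : ℝ) : ℝ≥0∞ :=
  ∑' k : ℤ, qpow q (ν (Icc (((k : ℝ) + θ) * ε) (((k : ℝ) + θ + 1) * ε)))

lemma shiftedSum_le {q : ℝ} (hq : 0 ≤ q) (ν : Measure ℝ) {ε : ℝ} (hε : 0 < ε) (θ θ' : ℝ) :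
    shiftedSum q ν ε θ ≤ 2 ^ q * 2 * shiftedSum q ν ε θ' := by
  set n := ⌊θ - θ'⌋ with hn
  have h1 := Int.floor_le (θ - θ')
  have h2 := Int.lt_floor_add_one (θ - θ')
  rw [← hn] at h1 h2
  set I : ℤ → Set ℝ := fun k => Icc (((k : ℝ) + θ') * ε) (((k : ℝ) + θ' + 1) * ε) with hI
  have hcov : ∀ k : ℤ, Icc (((k : ℝ) + θ) * ε) (((k : ℝ) + θ + 1) * ε) ⊆
      I (k + n) ∪ I (k + n + 1) := by
    intro k x hx
    simp only [hI, mem_union, mem_Icc]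
    push_cast
    by_cases h : x ≤ ((k : ℝ) + n + θ' + 1) * ε
    · exact Or.inl ⟨le_trans (mul_le_mul_of_nonneg_right (by linarith) hε.le) hx.1, h⟩
    · exact Or.inr ⟨le_trans (le_of_eq (by ring)) (not_le.1 h).le,
        hx.2.trans (mul_le_mul_of_nonneg_right (by linarith) hε.le)⟩
  have hterm : ∀ k : ℤ, qpow q (ν (Icc (((k : ℝ) + θ) * ε) (((k : ℝ) + θ + 1) * ε))) ≤
      2 ^ q * (qpow q (ν (I (k + n))) + qpow q (ν (I (k + n + 1)))) := fun k =>
    (qpow_mono hq ((measure_mono (hcov k)).trans (measure_union_le _ _))).trans (qpow_add_le hq _ _)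
  refine (ENNReal.tsum_le_tsum hterm).trans ?_
  rw [ENNReal.tsum_mul_left, ENNReal.tsum_add, mul_assoc]
  gcongr
  have e1 : ∑' k : ℤ, qpow q (ν (I (k + n))) = shiftedSum q ν ε θ' :=
    (Equiv.addRight n).tsum_eq fun k => qpow q (ν (I k))
  have e2 : ∑' k : ℤ, qpow q (ν (I (k + n + 1))) = shiftedSum q ν ε θ' := by
    simp only [add_assoc]
    exact (Equiv.addRight (n + 1)).tsum_eq fun k => qpow q (ν (I k))
  rw [e1, e2, two_mul]

lemma exists_affine_sum_eq (q : ℝ) (ν : Measure ℝ) {δ σ : ℝ} (hδ : 0 < δ) (hσ : σ ≠ 0) (t : ℝ) :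
    ∃ θ, ∑' k : ℤ, qpow q (ν {x | σ * x + t ∈ meshCube1 δ k}) = shiftedSum q ν (δ / |σ|) θ := by
  rcases lt_or_gt_of_ne hσ with hneg | hpos
  · refine ⟨t / δ, ?_⟩
    rw [shiftedSum, ← (Equiv.subLeft (-1 : ℤ)).tsum_eq]
    refine tsum_congr fun k => ?_
    congr 2
    ext x
    simp only [meshCube1, mem_ofPred_eq, mem_Icc, Equiv.subLeft_apply, abs_of_neg hneg]
    push_cast
    have hσ' : 0 < -σ := by linarith
    rw [← mul_div_assoc, ← mul_div_assoc, div_le_iff₀ hσ', le_div_iff₀ hσ']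
    have e1 : ((k : ℝ) + t / δ) * δ = k * δ + t := by field_simp
    have e2 : ((k : ℝ) + t / δ + 1) * δ = (k + 1) * δ + t := by field_simp; ring
    rw [e1, e2]
    constructor <;> rintro ⟨h1, h2⟩ <;> constructor <;> linarith
  · refine ⟨-t / δ, ?_⟩
    rw [shiftedSum]
    refine tsum_congr fun k => ?_
    congr 2
    ext x
    simp only [meshCube1, mem_ofPred_eq, mem_Icc, abs_of_pos hpos]
    rw [← mul_div_assoc, ← mul_div_assoc, div_le_iff₀ hpos, le_div_iff₀ hpos]
    have e1 : ((k : ℝ) + -t / δ) * δ = k * δ - t := by field_simp; ring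
    have e2 : ((k : ℝ) + -t / δ + 1) * δ = (k + 1) * δ - t := by field_simp; ring
    rw [e1, e2]
    constructor <;> rintro ⟨h1, h2⟩ <;> constructor <;> linarith

section TwoFibres

variable {Ω : Type*} [MeasurableSpace Ω] (m : Measure Ω) (A : Set Ω) {B : ℤ → Set Ω} {n : ℤ}

lemma tsum_qpow_inter_eq (q : ℝ) (hB : ∀ j, m (B j) ≠ 0 → j = n - 1 ∨ j = n) :
    ∑' j, qpow q (m (A ∩ B j)) = qpow q (m (A ∩ B (n - 1))) + qpow q (m (A ∩ B n)) := by
  rw [tsum_eq_sum (s := {n - 1, n}), Finset.sum_pair (by omega)]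
  intro j hj
  have : m (B j) = 0 := by
    by_contra h
    exact hj (by simpa using hB j h)
  rw [measure_mono_null inter_subset_right this, qpow_zero_right]

lemma tsum_qpow_inter_le {q : ℝ} (hq : 0 ≤ q) (hB : ∀ j, m (B j) ≠ 0 → j = n - 1 ∨ j = n) :
    ∑' j, qpow q (m (A ∩ B j)) ≤ 2 * qpow q (m A) := by
  rw [tsum_qpow_inter_eq m A q hB, two_mul]
  exact add_le_add (qpow_mono hq (measure_mono inter_subset_left))
    (qpow_mono hq (measure_mono inter_subset_left))

lemma qpow_le_tsum_qpow_inter {q : ℝ} (hq : 0 ≤ q) (hB : ∀ j, m (B j) ≠ 0 → j = n - 1 ∨ j = n)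
    (hcov : ∀ z, ∃ j, z ∈ B j) : qpow q (m A) ≤ 2 ^ q * ∑' j, qpow q (m (A ∩ B j)) := by
  rw [tsum_qpow_inter_eq m A q hB]
  refine (qpow_mono hq ?_).trans (qpow_add_le hq _ _)
  have h1 : A ⊆ ⋃ j, A ∩ B j := fun z hz => by
    obtain ⟨j, hj⟩ := hcov z
    exact mem_iUnion.2 ⟨j, hz, hj⟩
  refine ((measure_mono h1).trans (measure_iUnion_le _)).trans ?_
  rw [tsum_eq_sum (s := {n - 1, n}), Finset.sum_pair (by omega)]
  intro j hj
  have : m (B j) = 0 := by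
    by_contra h
    exact hj (by simpa using hB j h)
  exact measure_mono_null inter_subset_right this

end TwoFibres

lemma exists_mem_meshCube1 {δ : ℝ} (hδ : 0 < δ) (x : ℝ) : ∃ k, x ∈ meshCube1 δ k := by
  refine ⟨⌊x / δ⌋, ?_, ?_⟩
  · rw [← le_div_iff₀ hδ]; exact Int.floor_le _
  · rw [← div_le_iff₀ hδ]; exact (Int.lt_floor_add_one _).le

/-- A segment shorter than the mesh meets at most two consecutive mesh intervals. -/
lemma exists_two_mesh {δ σ : ℝ} (hδ : 0 < δ) (hσ : |σ| < δ) (t : ℝ) :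
    ∃ n : ℤ, ∀ y ∈ Icc (0 : ℝ) 1, ∀ j, σ * y + t ∈ meshCube1 δ j → j = n - 1 ∨ j = n := by
  set lo := min t (t + σ) with hlo
  refine ⟨⌈lo / δ⌉, fun y hy j hj => ?_⟩
  have hσ2 := abs_lt.1 hσ
  have hlow : lo ≤ σ * y + t := by
    rcases le_total 0 σ with h | h
    · exact (min_le_left _ _).trans (by nlinarith [mul_nonneg h hy.1])
    · exact (min_le_right _ _).trans (by nlinarith [hy.2])
  have hupp : σ * y + t < lo + δ := by
    rw [hlo, ← sub_lt_iff_lt_add]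
    refine lt_min ?_ ?_
    · nlinarith [hy.1, hy.2, le_abs_self σ, abs_nonneg σ]
    · nlinarith [hy.1, hy.2, neg_abs_le σ, abs_nonneg σ]
  have h1 : (j : ℝ) < lo / δ + 1 := by
    have := hj.1.trans_lt hupp
    rw [← sub_lt_iff_lt_add, lt_div_iff₀ hδ]; linarith
  have h2 : lo / δ ≤ (j : ℝ) + 1 := by
    rw [div_le_iff₀ hδ]; exact hlow.trans hj.2
  have h3 : ⌈lo / δ⌉ ≤ j + 1 := Int.ceil_le.2 (by push_cast; exact h2)
  have h4 : j < ⌈lo / δ⌉ + 1 := by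
    have := Int.le_ceil (lo / δ)
    exact_mod_cast h1.trans_le (by linarith : lo / δ + 1 ≤ (⌈lo / δ⌉ : ℝ) + 1)
  omega

/-- Comparison of the moment sum of a flat affine image of `m` with that of its projection. -/
lemma fibred_sum_comparison {Ω : Type*} [MeasurableSpace Ω] {q : ℝ} (hq : 0 ≤ q) (m : Measure Ω)
    {X Z : Ω → ℝ} (hX : Measurable X) (hZ : ∀ᵐ z ∂m, Z z ∈ Icc (0 : ℝ) 1) {δ σ₁ σ₂ : ℝ}
    (hδ : 0 < δ) (hσ₁ : σ₁ ≠ 0) (hσ₂ : |σ₂| < δ) (t₁ t₂ : ℝ) :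
    (∑' k : ℤ, ∑' j : ℤ, qpow q (m {z | σ₁ * X z + t₁ ∈ meshCube1 δ k ∧
        σ₂ * Z z + t₂ ∈ meshCube1 δ j}) ≤ 4 * 2 ^ q * 2 ^ q * shiftedSum q (m.map X) (δ / |σ₁|) 0) ∧
    (shiftedSum q (m.map X) (δ / |σ₁|) 0 ≤ 4 * 2 ^ q * 2 ^ q *
      ∑' k : ℤ, ∑' j : ℤ, qpow q (m {z | σ₁ * X z + t₁ ∈ meshCube1 δ k ∧
        σ₂ * Z z + t₂ ∈ meshCube1 δ j})) := by
  obtain ⟨n, hn⟩ := exists_two_mesh hδ hσ₂ t₂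
  set B : ℤ → Set Ω := fun j => {z | σ₂ * Z z + t₂ ∈ meshCube1 δ j} with hBdef
  have hB : ∀ j, m (B j) ≠ 0 → j = n - 1 ∨ j = n := by
    intro j hj
    obtain ⟨z, hz, hz'⟩ : ∃ z, z ∈ B j ∧ Z z ∈ Icc (0 : ℝ) 1 := by
      by_contra! hcon
      exact hj (measure_mono_null (fun z hz => hcon z hz) hZ)
    exact hn _ hz' j hz
  obtain ⟨θ, hθ⟩ := exists_affine_sum_eq q (m.map X) hδ hσ₁ t₁
  have hε : 0 < δ / |σ₁| := div_pos hδ (abs_pos.2 hσ₁)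
  have hmap : ∀ k : ℤ, (m.map X) {x | σ₁ * x + t₁ ∈ meshCube1 δ k} =
      m {z | σ₁ * X z + t₁ ∈ meshCube1 δ k} := fun k => by
    rw [Measure.map_apply hX]
    · rfl
    · exact (measurable_const.mul measurable_id |>.add_const t₁) measurableSet_Icc
  simp only [hmap] at hθ
  have h2 : (1 : ℝ≥0∞) ≤ 2 ^ q := by
    simpa using ENNReal.rpow_le_rpow (by norm_num : (1 : ℝ≥0∞) ≤ 2) hq
  constructor
  · calc _ ≤ ∑' k : ℤ, 2 * qpow q (m {z | σ₁ * X z + t₁ ∈ meshCube1 δ k}) :=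
          ENNReal.tsum_le_tsum fun k => tsum_qpow_inter_le m _ hq hB
      _ = 2 * shiftedSum q (m.map X) (δ / |σ₁|) θ := by rw [ENNReal.tsum_mul_left, hθ]
      _ ≤ 2 * (2 ^ q * 2 * shiftedSum q (m.map X) (δ / |σ₁|) 0) := by
          gcongr; exact shiftedSum_le hq _ hε _ _
      _ = 4 * 2 ^ q * 1 * shiftedSum q (m.map X) (δ / |σ₁|) 0 := by ring
      _ ≤ _ := by gcongr
  · calc _ ≤ 2 ^ q * 2 * shiftedSum q (m.map X) (δ / |σ₁|) θ := shiftedSum_le hq _ hε _ _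
      _ = 2 ^ q * 2 * ∑' k : ℤ, qpow q (m {z | σ₁ * X z + t₁ ∈ meshCube1 δ k}) := by rw [hθ]
      _ ≤ 2 ^ q * 2 * ∑' k : ℤ, 2 ^ q * ∑' j : ℤ, qpow q (m {z | σ₁ * X z + t₁ ∈ meshCube1 δ k ∧
            σ₂ * Z z + t₂ ∈ meshCube1 δ j}) := by
          gcongr with k
          exact qpow_le_tsum_qpow_inter m _ hq hB fun z => exists_mem_meshCube1 hδ _
      _ = 2 * 2 ^ q * 2 ^ q * ∑' k : ℤ, ∑' j : ℤ, qpow q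
            (m {z | σ₁ * X z + t₁ ∈ meshCube1 δ k ∧ σ₂ * Z z + t₂ ∈ meshCube1 δ j}) := by
          rw [ENNReal.tsum_mul_left]; ring
      _ ≤ _ := by gcongr; norm_num

end Moments

end LqGIFS

namespace LqGIFS

/-! ### Geometry of diagonal systems -/

namespace BoxLikeGIFS

open scoped ENNReal

variable {V E : Type} (S : BoxLikeGIFS V E)

/-- The map `(x, y) ↦ (s₁ x + t₁, s₂ y + t₂)`. -/
def coordAffine (s₁ s₂ t₁ t₂ : ℝ) (z : ℝ × ℝ) : ℝ × ℝ := (s₁ * z.1 + t₁, s₂ * z.2 + t₂)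

lemma coordAffine_continuous (s₁ s₂ t₁ t₂ : ℝ) : Continuous (coordAffine s₁ s₂ t₁ t₂) := by
  unfold coordAffine; fun_prop

lemma coordAffine_injective {s₁ s₂ : ℝ} (h₁ : s₁ ≠ 0) (h₂ : s₂ ≠ 0) (t₁ t₂ : ℝ) :
    Function.Injective (coordAffine s₁ s₂ t₁ t₂) := by
  rintro ⟨x, y⟩ ⟨x', y'⟩ h
  simp only [coordAffine, Prod.mk.injEq, add_left_inj, mul_eq_mul_left_iff, h₁, h₂, or_false] at h
  rw [h.1, h.2]

variable {S}

lemma map_eq_coordAffine {e : E} (h : S.diag e = true) : S.map e =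
    coordAffine (S.sa e * S.a e) (S.sb e * S.b e) (S.trans e).1 (S.trans e).2 := by
  funext z
  simp [map, h, coordAffine]

lemma abs_sign_mul {s c : ℝ} (hs : s = 1 ∨ s = -1) (hc : 0 < c) : |s * c| = c := by
  rcases hs with rfl | rfl <;> simp [abs_of_pos hc]

lemma map_continuous {e : E} (h : S.diag e = true) : Continuous (S.map e) := by
  rw [map_eq_coordAffine h]; exact coordAffine_continuous _ _ _ _

/-- The closed unit square. -/
def closedSq : Set (ℝ × ℝ) := Icc (0 : ℝ) 1 ×ˢ Icc (0 : ℝ) 1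

lemma ROSC.mapsTo_closedSq (hR : S.ROSC) {e : E} (h : S.diag e = true) :
    MapsTo (S.map e) closedSq closedSq := by
  have h1 : MapsTo (S.map e) unitSq unitSq := fun z hz => hR.1 e ⟨z, hz, rfl⟩
  have h2 := h1.closure (map_continuous h)
  rwa [unitSq, closure_prod_eq, closure_Ioo zero_ne_one] at h2

/-- The unit square enlarged by `R` in each direction. -/
def enlargedSq (R : ℝ) : Set (ℝ × ℝ) := Icc (-R) (1 + R) ×ˢ Icc (-R) (1 + R)

lemma measurableSet_enlargedSq (R : ℝ) : MeasurableSet (enlargedSq R) :=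
  measurableSet_Icc.prod measurableSet_Icc

lemma affine_mem_enlarged {s t r R x : ℝ} (ht : t ∈ Icc (0 : ℝ) 1) (hst : s + t ∈ Icc (0 : ℝ) 1)
    (hs : |s| ≤ r) (hR : 0 ≤ R) (hx : x ∈ Icc (-R) (1 + R)) :
    s * x + t ∈ Icc (-(r * R)) (1 + r * R) := by
  obtain ⟨h1, h2⟩ := abs_le.1 hs
  obtain ⟨h3, h4⟩ := hx
  have e1 := mul_le_mul_of_nonneg_right h2 hR
  have e2 := mul_le_mul_of_nonneg_right h1 hR
  rcases le_total 0 s with h | h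
  · have := mul_le_mul_of_nonneg_left h3 h
    have := mul_le_mul_of_nonneg_left h4 h
    constructor <;> linarith [ht.1, hst.2]
  · have := mul_le_mul_of_nonpos_left h3 h
    have := mul_le_mul_of_nonpos_left h4 h
    constructor <;> linarith [ht.2, hst.1]

lemma ROSC.mapsTo_enlargedSq (hR : S.ROSC) {e : E} (h : S.diag e = true) {r R : ℝ}
    (ha : S.a e ≤ r) (hb : S.b e ≤ r) (hR0 : 0 ≤ R) :
    MapsTo (S.map e) (enlargedSq R) (enlargedSq (r * R)) := by
  have hm := hR.mapsTo_closedSq h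
  have h0 := hm (x := (0, 0)) (by simp [closedSq])
  have h1 := hm (x := (1, 1)) (by simp [closedSq])
  rw [map_eq_coordAffine h] at h0 h1 ⊢
  simp only [coordAffine, closedSq, mul_zero, zero_add, mul_one, mem_prod] at h0 h1
  intro z hz
  refine ⟨affine_mem_enlarged h0.1 h1.1 ?_ hR0 hz.1, affine_mem_enlarged h0.2 h1.2 ?_ hR0 hz.2⟩
  · rwa [abs_sign_mul (S.sa_mem e) (S.a_mem e).1]
  · rwa [abs_sign_mul (S.sb_mem e) (S.b_mem e).1]

section Measure

variable [Fintype E] {p : E → ℝ} {μ : V → Measure (ℝ × ℝ)}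

lemma IsGDMeasure.apply (hμ : S.IsGDMeasure p μ) (hdiag : ∀ e, S.diag e = true) (v : V)
    {X : Set (ℝ × ℝ)} (hX : MeasurableSet X) : μ v X = ∑ e, if S.init e = v then
      ENNReal.ofReal (p e) * μ (S.term e) (S.map e ⁻¹' X) else 0 := by
  rw [hμ.2 v, Measure.finsetSum_apply]
  refine Finset.sum_congr rfl fun e _ => ?_
  split_ifs
  · rw [Measure.smul_apply, Measure.map_apply (map_continuous (hdiag e)).measurable hX, smul_eq_mul]
  · rfl

lemma IsWeights.sum_ofReal (hp : S.IsWeights p) (v : V) :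
    ∑ e, (if S.init e = v then ENNReal.ofReal (p e) else 0) = 1 := by
  rw [← ENNReal.ofReal_one, ← hp.2 v, ENNReal.ofReal_sum_of_nonneg]
  · refine Finset.sum_congr rfl fun e _ => ?_
    split_ifs <;> simp
  · intro e _
    split_ifs
    exacts [(hp.1 e).le, le_rfl]

lemma exists_ratio_bounds [Fintype V] [Nonempty E] (S : BoxLikeGIFS V E) : ∃ κ r : ℝ,
    0 < κ ∧ κ ≤ 1 ∧ r < 1 ∧ 0 < r ∧
      ∀ e, κ ≤ S.a e ∧ κ ≤ S.b e ∧ S.a e ≤ r ∧ S.b e ≤ r := by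
  obtain ⟨i, hi⟩ := Finite.exists_min fun e => min (S.a e) (S.b e)
  obtain ⟨j, hj⟩ := Finite.exists_max fun e => max (S.a e) (S.b e)
  refine ⟨min (S.a i) (S.b i), max (S.a j) (S.b j), lt_min (S.a_mem i).1 (S.b_mem i).1,
    (min_le_left _ _).trans (S.a_mem i).2.le, max_lt (S.a_mem j).2 (S.b_mem j).2,
    lt_max_of_lt_left (S.a_mem j).1, fun e => ?_⟩
  exact ⟨(hi e).trans (min_le_left _ _), (hi e).trans (min_le_right _ _),
    (le_max_left _ _).trans (hj e), (le_max_right _ _).trans (hj e)⟩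

/-- The measures are carried by the closed unit square. -/
lemma IsGDMeasure.ae_mem_closedSq [Fintype V] [Nonempty E] (hμ : S.IsGDMeasure p μ)
    (hp : S.IsWeights p) (hR : S.ROSC) (hdiag : ∀ e, S.diag e = true) (v : V) :
    ∀ᵐ z ∂μ v, z ∈ closedSq := by
  obtain ⟨κ, r, -, -, hr1, hr0, hr⟩ := exists_ratio_bounds S
  have hprob := hμ.1
  have hstep : ∀ (c : ℝ≥0∞) (R : ℝ), 0 ≤ R → (∀ v, μ v (enlargedSq R)ᶜ ≤ c) →
      ∀ v, μ v (enlargedSq (r * R))ᶜ ≤ c := by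
    intro c R hR0 hc v
    rw [hμ.apply hdiag v (measurableSet_enlargedSq _).compl]
    calc _ ≤ ∑ e, (if S.init e = v then ENNReal.ofReal (p e) else 0) * c := by
          refine Finset.sum_le_sum fun e _ => ?_
          split_ifs
          · gcongr
            refine (measure_mono ?_).trans (hc (S.term e))
            exact fun z hz hz' =>
              hz (hR.mapsTo_enlargedSq (hdiag e) (hr e).2.2.1 (hr e).2.2.2 hR0 hz')
          · simp
      _ = c := by rw [← Finset.sum_mul, hp.sum_ofReal, one_mul]
  have hiter : ∀ (c : ℝ≥0∞) (n : ℕ) (R : ℝ), 0 ≤ R → (∀ v, μ v (enlargedSq R)ᶜ ≤ c) →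
      ∀ v, μ v (enlargedSq (r ^ n * R))ᶜ ≤ c := by
    intro c n R hR0 hc
    induction n with
    | zero => simpa using hc
    | succ n ih =>
      have := hstep c (r ^ n * R) (by positivity) ih
      rwa [← mul_assoc, ← pow_succ'] at this
  have hnull : ∀ R, 0 < R → ∀ v, μ v (enlargedSq R)ᶜ = 0 := by
    intro R hR0 v
    have hmono : Antitone fun n : ℕ => (enlargedSq ((r ^ n)⁻¹ * R))ᶜ := by
      intro n m hnm
      refine compl_subset_compl.2 (prod_mono ?_ ?_) <;>
      · have : (r ^ n)⁻¹ * R ≤ (r ^ m)⁻¹ * R := mul_le_mul_of_nonneg_right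
          (inv_anti₀ (by positivity) (pow_le_pow_of_le_one hr0.le hr1.le hnm)) hR0.le
        exact Icc_subset_Icc (by linarith) (by linarith)
    have hempty : ⋂ n : ℕ, (enlargedSq ((r ^ n)⁻¹ * R))ᶜ = ∅ := by
      rw [← compl_iUnion, compl_empty_iff, eq_univ_iff_forall]
      intro z
      have ht : Tendsto (fun n : ℕ => (r ^ n)⁻¹ * R) atTop atTop := by
        simp only [← inv_pow]
        exact (tendsto_pow_atTop_atTop_of_one_lt ((one_lt_inv₀ hr0).2 hr1)).atTop_mul_const hR0
      obtain ⟨n, hn⟩ := (ht.eventually_ge_atTop (|z.1| + |z.2|)).exists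
      refine mem_iUnion.2 ⟨n, ⟨?_, ?_⟩, ⟨?_, ?_⟩⟩ <;>
      linarith [abs_nonneg z.1, abs_nonneg z.2, le_abs_self z.1, le_abs_self z.2,
        neg_abs_le z.1, neg_abs_le z.2]
    have hlim : Tendsto (fun n : ℕ => ∑ v, μ v (enlargedSq ((r ^ n)⁻¹ * R))ᶜ) atTop (nhds 0) := by
      have : ∀ v, Tendsto (fun n : ℕ => μ v (enlargedSq ((r ^ n)⁻¹ * R))ᶜ) atTop (nhds 0) := by
        intro v
        have h := tendsto_measure_iInter_atTop (μ := μ v)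
          (fun n : ℕ => (measurableSet_enlargedSq ((r ^ n)⁻¹ * R)).compl.nullMeasurableSet)
          hmono ⟨0, measure_ne_top _ _⟩
        rwa [hempty, measure_empty] at h
      simpa using tendsto_finsetSum Finset.univ fun v _ => this v
    refine le_zero_iff.1 (ge_of_tendsto' hlim fun n => ?_)
    have h := hiter (∑ v, μ v (enlargedSq ((r ^ n)⁻¹ * R))ᶜ) n ((r ^ n)⁻¹ * R) (by positivity)
      (fun v => Finset.single_le_sum (f := fun v => μ v (enlargedSq ((r ^ n)⁻¹ * R))ᶜ)
        (fun _ _ => zero_le) (Finset.mem_univ v)) v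
    rwa [mul_inv_cancel_left₀ (by positivity)] at h
  have hall : ∀ᵐ z ∂μ v, ∀ n : ℕ, z ∈ enlargedSq (1 / ((n : ℝ) + 1)) :=
    ae_all_iff.2 fun n => hnull _ (by positivity) v
  filter_upwards [hall] with z hz
  have ht : Tendsto (fun n : ℕ => 1 / ((n : ℝ) + 1)) atTop (nhds 0) :=
    tendsto_one_div_add_atTop_nhds_zero_nat
  have ht1 : Tendsto (fun n : ℕ => -(1 / ((n : ℝ) + 1))) atTop (nhds 0) := by simpa using ht.neg
  have ht2 : Tendsto (fun n : ℕ => 1 + 1 / ((n : ℝ) + 1)) atTop (nhds 1) := by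
    simpa using ht.const_add 1
  exact ⟨⟨le_of_tendsto' ht1 fun n => (hz n).1.1, ge_of_tendsto' ht2 fun n => (hz n).1.2⟩,
    ⟨le_of_tendsto' ht1 fun n => (hz n).2.1, ge_of_tendsto' ht2 fun n => (hz n).2.2⟩⟩

end Measure

end BoxLikeGIFS

end LqGIFS

namespace LqGIFS

/-! ### Words and stopping families -/

namespace BoxLikeGIFS

open scoped ENNReal

variable {V E : Type} (S : BoxLikeGIFS V E)

/-- Terminal vertex of a path starting at `v`; paths list their edges from last to first. -/
def endV (v : V) : List E → V
  | [] => v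
  | e :: _ => S.term e

/-- The multiplicative extension of an edge weight to paths. -/
noncomputable def pathWeight (g : E → ℝ) (w : List E) : ℝ := (w.map g).prod

/-- The composition of the contractions along a path. -/
def pathMap : List E → ℝ × ℝ → ℝ × ℝ
  | [] => id
  | e :: w => pathMap w ∘ S.map e

@[simp] lemma pathWeight_nil (g : E → ℝ) : pathWeight g [] = 1 := by simp [pathWeight]

@[simp] lemma pathWeight_cons (g : E → ℝ) (e : E) (w : List E) :
    pathWeight g (e :: w) = g e * pathWeight g w := by simp [pathWeight]

lemma pathWeight_pos {g : E → ℝ} (hg : ∀ e, 0 < g e) (w : List E) : 0 < pathWeight g w := by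
  induction w with
  | nil => simp
  | cons e w ih => rw [pathWeight_cons]; exact mul_pos (hg e) ih

lemma pathWeight_le_pow {g : E → ℝ} (hg : ∀ e, 0 < g e) {r : ℝ} (hr0 : 0 < r)
    (hr : ∀ e, g e ≤ r) (w : List E) : pathWeight g w ≤ r ^ w.length := by
  induction w with
  | nil => simp
  | cons e w ih =>
    rw [pathWeight_cons, List.length_cons, pow_succ']
    exact mul_le_mul (hr e) ih (pathWeight_pos hg w).le hr0.le

lemma exists_pathMap_eq (hdiag : ∀ e, S.diag e = true) (w : List E) : ∃ σ₁ σ₂ t₁ t₂ : ℝ,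
    |σ₁| = pathWeight S.a w ∧ |σ₂| = pathWeight S.b w ∧
      S.pathMap w = coordAffine σ₁ σ₂ t₁ t₂ := by
  induction w with
  | nil => exact ⟨1, 1, 0, 0, by simp, by simp, by funext z; simp [pathMap, coordAffine]⟩
  | cons e w ih =>
    obtain ⟨σ₁, σ₂, t₁, t₂, h₁, h₂, h⟩ := ih
    refine ⟨σ₁ * (S.sa e * S.a e), σ₂ * (S.sb e * S.b e), σ₁ * (S.trans e).1 + t₁,
      σ₂ * (S.trans e).2 + t₂, ?_, ?_, ?_⟩
    · rw [abs_mul, abs_sign_mul (S.sa_mem e) (S.a_mem e).1, h₁, pathWeight_cons, mul_comm]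
    · rw [abs_mul, abs_sign_mul (S.sb_mem e) (S.b_mem e).1, h₂, pathWeight_cons, mul_comm]
    · funext z
      simp only [pathMap, h, map_eq_coordAffine (hdiag e), coordAffine, Function.comp, Prod.mk.injEq]
      constructor <;> ring

variable {S} in
lemma pathMap_measurable (hdiag : ∀ e, S.diag e = true) (w : List E) : Measurable (S.pathMap w) := by
  obtain ⟨σ₁, σ₂, t₁, t₂, -, -, h⟩ := S.exists_pathMap_eq hdiag w
  rw [h]; exact (coordAffine_continuous _ _ _ _).measurable

variable {S} in
lemma pathMap_injective (hdiag : ∀ e, S.diag e = true) (w : List E) :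
    Function.Injective (S.pathMap w) := by
  obtain ⟨σ₁, σ₂, t₁, t₂, h₁, h₂, h⟩ := S.exists_pathMap_eq hdiag w
  rw [h]
  refine coordAffine_injective ?_ ?_ _ _ <;> rw [← abs_pos]
  · rw [h₁]; exact pathWeight_pos (fun e => (S.a_mem e).1) w
  · rw [h₂]; exact pathWeight_pos (fun e => (S.b_mem e).1) w

variable [Fintype E]

/-- One-edge extensions of a path starting at `v`. -/
noncomputable def children (v : V) (w : List E) : Multiset (List E) :=
  (Finset.univ.filter fun e => S.init e = S.endV v w).val.map (· :: w)

/-- The paths from `v`, of length at most `n`, stopped as soon as the rectangle is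
shorter than `δ` in one direction. -/
noncomputable def cut (δ : ℝ) (v : V) : ℕ → Multiset (List E)
  | 0 => {[]}
  | n + 1 => (cut δ v n).bind fun w =>
      if δ ≤ pathWeight S.a w ∧ δ ≤ pathWeight S.b w then S.children v w else {w}

variable {S}

lemma sum_children {M : Type*} [AddCommMonoid M] (v : V) (w : List E) (Φ : List E → M) :
    ((S.children v w).map Φ).sum = ∑ e, if S.init e = S.endV v w then Φ (e :: w) else 0 := by
  rw [children, Multiset.map_map, ← Finset.sum_filter]
  rfl

lemma sum_cut_eq {M : Type*} [AddCommMonoid M] {v : V} (Φ : List E → M)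
    (hΦ : ∀ w, (∑ e, if S.init e = S.endV v w then Φ (e :: w) else 0) = Φ w) (δ : ℝ) (n : ℕ) :
    ((S.cut δ v n).map Φ).sum = Φ [] := by
  induction n with
  | zero => simp [cut]
  | succ n ih =>
    rw [cut, Multiset.map_bind, Multiset.sum_bind, ← ih]
    congr 1
    refine Multiset.map_congr rfl fun w _ => ?_
    split_ifs
    · rw [sum_children, hΦ]
    · simp

lemma sum_cut_le {v : V} (Φ : List E → ℝ≥0∞)
    (hΦ : ∀ w, (∑ e, if S.init e = S.endV v w then Φ (e :: w) else 0) ≤ Φ w) (δ : ℝ) (n : ℕ) :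
    ((S.cut δ v n).map Φ).sum ≤ Φ [] := by
  induction n with
  | zero => simp [cut]
  | succ n ih =>
    rw [cut, Multiset.map_bind, Multiset.sum_bind]
    refine le_trans (Multiset.sum_map_le_sum_map _ _ fun w _ => ?_) ih
    split_ifs
    · rw [sum_children]; exact hΦ w
    · simp

lemma mem_children {v : V} {w w' : List E} (h : w' ∈ S.children v w) : ∃ e, w' = e :: w := by
  obtain ⟨e, -, rfl⟩ := Multiset.mem_map.1 h
  exact ⟨e, rfl⟩

lemma le_pathWeight_of_mem_cut {κ δ : ℝ} (hκ1 : κ ≤ 1) (hδ0 : 0 < δ) (hδ1 : δ ≤ 1)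
    (hκ : ∀ e, κ ≤ S.a e ∧ κ ≤ S.b e) {v : V} {n : ℕ} {w : List E} (hw : w ∈ S.cut δ v n) :
    κ * δ ≤ pathWeight S.a w ∧ κ * δ ≤ pathWeight S.b w := by
  induction n generalizing w with
  | zero =>
    rw [cut, Multiset.mem_singleton] at hw
    subst hw
    simpa using mul_le_one₀ hκ1 hδ0.le hδ1
  | succ n ih =>
    rw [cut, Multiset.mem_bind] at hw
    obtain ⟨w', hw', hw⟩ := hw
    split_ifs at hw with hc
    · obtain ⟨e, rfl⟩ := mem_children hw
      simp only [pathWeight_cons]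
      exact ⟨mul_le_mul (hκ e).1 hc.1 hδ0.le (S.a_mem e).1.le,
        mul_le_mul (hκ e).2 hc.2 hδ0.le (S.b_mem e).1.le⟩
    · rw [Multiset.mem_singleton] at hw
      exact hw ▸ ih hw'

lemma pathWeight_lt_of_mem_cut {r δ : ℝ} (hr0 : 0 < r)
    (hr : ∀ e, S.a e ≤ r ∧ S.b e ≤ r) {v : V} {n : ℕ} (hn : r ^ n < δ) {w : List E}
    (hw : w ∈ S.cut δ v n) : pathWeight S.a w < δ ∨ pathWeight S.b w < δ := by
  have key : ∀ m, ∀ w ∈ S.cut δ v m,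
      (pathWeight S.a w < δ ∨ pathWeight S.b w < δ) ∨ w.length = m := by
    intro m
    induction m with
    | zero => intro w hw; rw [cut, Multiset.mem_singleton] at hw; simp [hw]
    | succ m ih =>
      intro w hw
      rw [cut, Multiset.mem_bind] at hw
      obtain ⟨w', hw', hw⟩ := hw
      split_ifs at hw with hc
      · obtain ⟨e, rfl⟩ := mem_children hw
        rcases ih w' hw' with h | h
        · rcases h with h | h
          · exact absurd hc.1 (not_le.2 h)
          · exact absurd hc.2 (not_le.2 h)
        · right; simp [h]
      · rw [Multiset.mem_singleton] at hw
        subst hw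
        left
        by_contra! h
        exact hc h
  rcases key n w hw with h | h
  · exact h
  · left
    refine lt_of_le_of_lt (pathWeight_le_pow (fun e => (S.a_mem e).1) hr0 (fun e => (hr e).1) w) ?_
    rwa [h]

/-! ### Decomposition of the measures -/

section Measure

variable {p : E → ℝ} {μ : V → Measure (ℝ × ℝ)}

lemma IsGDMeasure.apply_cut (hμ : S.IsGDMeasure p μ) (hp : S.IsWeights p)
    (hdiag : ∀ e, S.diag e = true) (v : V) {X : Set (ℝ × ℝ)} (hX : MeasurableSet X)
    (δ : ℝ) (n : ℕ) : μ v X = ((S.cut δ v n).map fun w =>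
      ENNReal.ofReal (pathWeight p w) * μ (S.endV v w) (S.pathMap w ⁻¹' X)).sum := by
  rw [sum_cut_eq]
  · simp [endV, pathMap]
  · intro w
    rw [hμ.apply hdiag (S.endV v w) (pathMap_measurable hdiag w hX), Finset.mul_sum]
    refine Finset.sum_congr rfl fun e _ => ?_
    split_ifs
    · rw [pathWeight_cons, ENNReal.ofReal_mul (hp.1 e).le, mul_comm (ENNReal.ofReal (p e)), mul_assoc]
      rfl
    · rw [mul_zero]

lemma measurableSet_unitSq : MeasurableSet unitSq := measurableSet_Ioo.prod measurableSet_Ioo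

lemma ROSC.sum_volume_cut_le (hR : S.ROSC) (hdiag : ∀ e, S.diag e = true) (v : V)
    (Q : Set (ℝ × ℝ)) (hQ : MeasurableSet Q) (δ : ℝ) (n : ℕ) :
    ((S.cut δ v n).map fun w => volume (Q ∩ S.pathMap w '' unitSq)).sum ≤ volume Q := by
  refine (sum_cut_le _ (fun w => ?_) δ n).trans (measure_mono inter_subset_left)
  have himg : ∀ w : List E, MeasurableSet (S.pathMap w '' unitSq) := fun w =>
    measurableSet_unitSq.image_of_measurable_injOn (pathMap_measurable hdiag w)
      (pathMap_injective hdiag w).injOn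
  have hsub : ∀ e : E, S.pathMap (e :: w) '' unitSq ⊆ S.pathMap w '' unitSq := by
    intro e
    rw [pathMap, image_comp]
    exact image_mono (hR.1 e)
  rw [← Finset.sum_filter, ← measure_biUnion_finset]
  · exact measure_mono (iUnion₂_subset fun e _ => inter_subset_inter_right _ (hsub e))
  · intro e he e' he' hne
    simp only [Finset.coe_filter, Finset.mem_univ, true_and, mem_ofPred_eq] at he he'
    refine Disjoint.mono inter_subset_right inter_subset_right ?_
    rw [pathMap, pathMap, image_comp, image_comp]
    exact (disjoint_image_iff (pathMap_injective hdiag w)).2 (hR.2 e e' hne (he.trans he'.symm))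
  · exact fun e _ => hQ.inter (himg _)

lemma exists_interval_of_meets {σ t ℓ δ u x₀ : ℝ} (hℓ0 : 0 < ℓ) (hℓσ : ℓ ≤ |σ|) (hℓδ : ℓ ≤ δ)
    (hx : x₀ ∈ Icc (0 : ℝ) 1) (hu : σ * x₀ + t ∈ Icc u (u + δ)) :
    ∃ c : ℝ, ∀ y ∈ Ioo (c - ℓ / 2) (c + ℓ / 2), y ∈ Icc (u - δ) (u + δ + δ) ∧
      ∃ x ∈ Ioo (0 : ℝ) 1, σ * x + t = y := by
  have hσ : σ ≠ 0 := abs_pos.1 (hℓ0.trans_le hℓσ)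
  have hσ' : 0 < |σ| := abs_pos.2 hσ
  set s := ℓ / |σ| with hs
  have hs0 : 0 < s := by positivity
  have hs1 : s ≤ 1 := (div_le_one hσ').2 hℓσ
  have hsℓ : |σ| * s = ℓ := by rw [hs]; field_simp
  set α := x₀ * (1 - s) with hα
  refine ⟨σ * (α + s / 2) + t, fun y hy => ?_⟩
  obtain ⟨x, rfl⟩ : ∃ x, σ * x + t = y := ⟨(y - t) / σ, by field_simp; ring⟩
  have hxa : |x - (α + s / 2)| < s / 2 := by
    have : |σ * (x - (α + s / 2))| < |σ| * (s / 2) := by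
      rw [abs_lt]; constructor <;> nlinarith [hy.1, hy.2]
    rw [abs_mul] at this
    exact lt_of_mul_lt_mul_left this hσ'.le
  obtain ⟨h1, h2⟩ := abs_lt.1 hxa
  have hα0 : 0 ≤ α := mul_nonneg hx.1 (by linarith)
  have hα1 : α + s ≤ 1 := by nlinarith [hx.2]
  have hd : |x - x₀| ≤ s := by
    rw [abs_le]; constructor <;> nlinarith [hx.1, hx.2]
  have hd' : |σ * (x - x₀)| ≤ δ := by
    rw [abs_mul]
    exact (mul_le_mul_of_nonneg_left hd hσ'.le).trans (hsℓ.le.trans hℓδ)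
  obtain ⟨h3, h4⟩ := abs_le.1 hd'
  refine ⟨⟨by linarith [hu.1], by linarith [hu.2]⟩, x, ⟨by linarith, by linarith⟩, rfl⟩

lemma le_volume_of_meets {σ₁ σ₂ t₁ t₂ ℓ δ : ℝ} {u z : ℝ × ℝ} (hℓ0 : 0 < ℓ) (hℓ₁ : ℓ ≤ |σ₁|)
    (hℓ₂ : ℓ ≤ |σ₂|) (hℓδ : ℓ ≤ δ) (hz : z ∈ closedSq)
    (hu : coordAffine σ₁ σ₂ t₁ t₂ z ∈ Icc u.1 (u.1 + δ) ×ˢ Icc u.2 (u.2 + δ)) :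
    ENNReal.ofReal (ℓ ^ 2) ≤ volume ((Icc (u.1 - δ) (u.1 + δ + δ) ×ˢ Icc (u.2 - δ) (u.2 + δ + δ)) ∩
      coordAffine σ₁ σ₂ t₁ t₂ '' unitSq) := by
  obtain ⟨c₁, hc₁⟩ := exists_interval_of_meets hℓ0 hℓ₁ hℓδ hz.1 hu.1
  obtain ⟨c₂, hc₂⟩ := exists_interval_of_meets hℓ0 hℓ₂ hℓδ hz.2 hu.2
  have hsub : Ioo (c₁ - ℓ / 2) (c₁ + ℓ / 2) ×ˢ Ioo (c₂ - ℓ / 2) (c₂ + ℓ / 2) ⊆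
      (Icc (u.1 - δ) (u.1 + δ + δ) ×ˢ Icc (u.2 - δ) (u.2 + δ + δ)) ∩
        coordAffine σ₁ σ₂ t₁ t₂ '' unitSq := by
    rintro ⟨y₁, y₂⟩ ⟨hy₁, hy₂⟩
    obtain ⟨h₁, x₁, hx₁, e₁⟩ := hc₁ y₁ hy₁
    obtain ⟨h₂, x₂, hx₂, e₂⟩ := hc₂ y₂ hy₂
    exact ⟨⟨h₁, h₂⟩, (x₁, x₂), ⟨hx₁, hx₂⟩, by simp only [coordAffine, e₁, e₂]⟩
  refine le_trans (le_of_eq ?_) (measure_mono hsub)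
  rw [Measure.volume_eq_prod, Measure.prod_prod, Real.volume_Ioo, Real.volume_Ioo,
    ← ENNReal.ofReal_mul (by linarith)]
  congr 1
  ring

lemma card_nsmul_le_sum_filter {ι : Type*} (s : Multiset ι) (P : ι → Prop) (g : ι → ℝ≥0∞)
    (c : ℝ≥0∞) (h : ∀ i ∈ s, P i → c ≤ g i) :
    ((s.filter P).card : ℝ≥0∞) * c ≤ (s.map g).sum := by
  induction s using Multiset.induction with
  | empty => simp
  | cons i s ih =>
    have ih' := ih fun j hj => h j (Multiset.mem_cons_of_mem hj)
    by_cases hi : P i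
    · rw [Multiset.filter_cons_of_pos _ hi, Multiset.card_cons, Multiset.map_cons,
        Multiset.sum_cons, Nat.cast_succ, add_mul, one_mul, add_comm]
      exact add_le_add (h i (Multiset.mem_cons_self _ _) hi) ih'
    · rw [Multiset.filter_cons_of_neg _ hi, Multiset.map_cons, Multiset.sum_cons]
      exact ih'.trans le_add_self

lemma ROSC.card_cut_le (hR : S.ROSC) (hdiag : ∀ e, S.diag e = true) (v : V)
    {κ δ : ℝ} (hκ0 : 0 < κ) (hκ1 : κ ≤ 1) (hδ0 : 0 < δ) (hδ1 : δ ≤ 1)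
    (hκ : ∀ e, κ ≤ S.a e ∧ κ ≤ S.b e) (n : ℕ) (k : ℤ × ℤ) (P : List E → Prop)
    (hP : ∀ w ∈ S.cut δ v n, P w → ∃ z ∈ closedSq, S.pathMap w z ∈ meshCube2 δ k) :
    ((S.cut δ v n).filter P).card ≤ ⌈9 / κ ^ 2⌉₊ := by
  set u : ℝ × ℝ := ((k.1 : ℝ) * δ, (k.2 : ℝ) * δ) with hu
  set Q : Set (ℝ × ℝ) := Icc (u.1 - δ) (u.1 + δ + δ) ×ˢ Icc (u.2 - δ) (u.2 + δ + δ) with hQ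
  have hcube : meshCube2 δ k = Icc u.1 (u.1 + δ) ×ˢ Icc u.2 (u.2 + δ) := by
    simp only [meshCube2, hu, add_mul, one_mul]
  have h1 := card_nsmul_le_sum_filter (S.cut δ v n) P
    (fun w => volume (Q ∩ S.pathMap w '' unitSq)) (ENNReal.ofReal ((κ * δ) ^ 2)) (by
      intro w hw hPw
      obtain ⟨z, hz, hzw⟩ := hP w hw hPw
      obtain ⟨σ₁, σ₂, t₁, t₂, h₁, h₂, h⟩ := S.exists_pathMap_eq hdiag w
      obtain ⟨hc, hd⟩ := le_pathWeight_of_mem_cut hκ1 hδ0 hδ1 hκ hw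
      simp only [h] at hzw ⊢
      rw [hcube] at hzw
      exact le_volume_of_meets (mul_pos hκ0 hδ0) (h₁ ▸ hc) (h₂ ▸ hd)
        (mul_le_of_le_one_left hδ0.le hκ1) hz hzw)
  have h2 := h1.trans (hR.sum_volume_cut_le hdiag v Q (measurableSet_Icc.prod measurableSet_Icc) δ n)
  have h3 : volume Q = ENNReal.ofReal (9 * δ ^ 2) := by
    rw [hQ, Measure.volume_eq_prod, Measure.prod_prod, Real.volume_Icc, Real.volume_Icc,
      ← ENNReal.ofReal_mul (by linarith)]
    congr 1
    ring
  rw [h3, ← ENNReal.ofReal_natCast, ← ENNReal.ofReal_mul (Nat.cast_nonneg _),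
    ENNReal.ofReal_le_ofReal_iff (by positivity)] at h2
  have h4 : (((S.cut δ v n).filter P).card : ℝ) ≤ 9 / κ ^ 2 := by
    rw [le_div_iff₀ (by positivity)]
    have : 0 < δ ^ 2 := by positivity
    nlinarith
  exact_mod_cast h4.trans (Nat.le_ceil _)

end Measure

end BoxLikeGIFS

end LqGIFS

namespace LqGIFS

/-! ### Comparison of planar moment sums with sums over stopping families -/

open scoped ENNReal

/-- The planar moment sum, valued in `[0,∞]`. -/
noncomputable def planarSum (q : ℝ) (ν : Measure (ℝ × ℝ)) (δ : ℝ) : ℝ≥0∞ :=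
  ∑' k : ℤ × ℤ, qpow q (ν (meshCube2 δ k))

lemma tsum_multiset_sum {ι κ : Type*} (s : Multiset ι) (g : ι → κ → ℝ≥0∞) :
    ∑' k, (s.map fun i => g i k).sum = (s.map fun i => ∑' k, g i k).sum := by
  induction s using Multiset.induction with
  | empty => simp
  | cons i s ih => simp only [Multiset.map_cons, Multiset.sum_cons, ENNReal.tsum_add, ih]

namespace BoxLikeGIFS

variable {V E : Type} (S : BoxLikeGIFS V E)

/-- The moment sum, at the scale of the stopped rectangle, of the projection of the measure
onto the longest side. -/
noncomputable def longSum (q : ℝ) (μ : V → Measure (ℝ × ℝ)) (v : V) (δ : ℝ) (w : List E) : ℝ≥0∞ :=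
  if pathWeight S.b w ≤ pathWeight S.a w then
    shiftedSum q ((μ (S.endV v w)).map Prod.fst) (δ / pathWeight S.a w) 0
  else shiftedSum q ((μ (S.endV v w)).map Prod.snd) (δ / pathWeight S.b w) 0

variable {S}

lemma tsum_preimage_comparison {q : ℝ} (hq : 0 ≤ q) {μ : V → Measure (ℝ × ℝ)}
    (hdiag : ∀ e, S.diag e = true) (hsq : ∀ v, ∀ᵐ z ∂μ v, z ∈ closedSq) (v : V) {δ : ℝ} (hδ : 0 < δ)
    (w : List E) (hw : pathWeight S.a w < δ ∨ pathWeight S.b w < δ) :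
    (∑' k : ℤ × ℤ, qpow q (μ (S.endV v w) (S.pathMap w ⁻¹' meshCube2 δ k)) ≤
      4 * 2 ^ q * 2 ^ q * S.longSum q μ v δ w) ∧
    (S.longSum q μ v δ w ≤ 4 * 2 ^ q * 2 ^ q *
      ∑' k : ℤ × ℤ, qpow q (μ (S.endV v w) (S.pathMap w ⁻¹' meshCube2 δ k))) := by
  obtain ⟨σ₁, σ₂, t₁, t₂, h₁, h₂, h⟩ := S.exists_pathMap_eq hdiag w
  have hc := pathWeight_pos (fun e => (S.a_mem e).1) w
  have hd := pathWeight_pos (fun e => (S.b_mem e).1) w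
  have hpre : ∀ k : ℤ × ℤ, S.pathMap w ⁻¹' meshCube2 δ k =
      {z | σ₁ * z.1 + t₁ ∈ meshCube1 δ k.1 ∧ σ₂ * z.2 + t₂ ∈ meshCube1 δ k.2} := by
    intro k
    rw [h]
    rfl
  simp only [hpre, longSum]
  rw [ENNReal.tsum_prod (f := fun i j => qpow q (μ (S.endV v w)
    {z | σ₁ * z.1 + t₁ ∈ meshCube1 δ i ∧ σ₂ * z.2 + t₂ ∈ meshCube1 δ j}))]
  split_ifs with hcd
  · have hlt : |σ₂| < δ := by
      rw [h₂]
      rcases hw with hw | hw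
      · exact hcd.trans_lt hw
      · exact hw
    have := fibred_sum_comparison hq (μ (S.endV v w)) (X := Prod.fst) (Z := Prod.snd)
      measurable_fst ((hsq _).mono fun z hz => hz.2) hδ (abs_pos.1 (h₁ ▸ hc)) hlt t₁ t₂
    rwa [h₁] at this
  · have hlt : |σ₁| < δ := by
      rw [h₁]
      rcases hw with hw | hw
      · exact hw
      · exact (not_le.1 hcd).trans hw
    have := fibred_sum_comparison hq (μ (S.endV v w)) (X := Prod.snd) (Z := Prod.fst)
      measurable_snd ((hsq _).mono fun z hz => hz.1) hδ (abs_pos.1 (h₂ ▸ hd)) hlt t₂ t₁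
    rw [h₂] at this
    rw [ENNReal.tsum_comm]
    simpa only [and_comm] using this

variable [Fintype E] {p : E → ℝ} {μ : V → Measure (ℝ × ℝ)}

lemma planarSum_comparison {q : ℝ} (hq : 0 ≤ q) (hμ : S.IsGDMeasure p μ) (hp : S.IsWeights p)
    (hR : S.ROSC) (hdiag : ∀ e, S.diag e = true) (hsq : ∀ v, ∀ᵐ z ∂μ v, z ∈ closedSq)
    {κ r : ℝ} (hκ0 : 0 < κ) (hκ1 : κ ≤ 1) (hr0 : 0 < r)
    (hκ : ∀ e, κ ≤ S.a e ∧ κ ≤ S.b e) (hr : ∀ e, S.a e ≤ r ∧ S.b e ≤ r) :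
    ∃ C : ℝ≥0∞, C ≠ ∞ ∧ ∀ (v : V) (δ : ℝ) (n : ℕ), 0 < δ → δ ≤ 1 → r ^ n < δ →
      planarSum q (μ v) δ ≤ C * ((S.cut δ v n).map fun w =>
        ENNReal.ofReal (pathWeight p w ^ q) * S.longSum q μ v δ w).sum ∧
      ((S.cut δ v n).map fun w =>
        ENNReal.ofReal (pathWeight p w ^ q) * S.longSum q μ v δ w).sum ≤ C * planarSum q (μ v) δ := by
  set M := ⌈9 / κ ^ 2⌉₊ with hM
  set C₀ : ℝ≥0∞ := 4 * 2 ^ q * 2 ^ q with hC₀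
  have hC₀t : C₀ ≠ ∞ := by
    have : (2 : ℝ≥0∞) ^ q ≠ ∞ := ENNReal.rpow_ne_top_of_nonneg hq ENNReal.ofNat_ne_top
    exact ENNReal.mul_ne_top (ENNReal.mul_ne_top ENNReal.ofNat_ne_top this) this
  have hMq : (M : ℝ≥0∞) ^ q ≠ ∞ := ENNReal.rpow_ne_top_of_nonneg hq (ENNReal.natCast_ne_top _)
  refine ⟨((M : ℝ≥0∞) ^ q + M) * C₀, ENNReal.mul_ne_top
    (ENNReal.add_ne_top.2 ⟨hMq, ENNReal.natCast_ne_top _⟩) hC₀t, fun v δ n hδ0 hδ1 hn => ?_⟩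
  set s := S.cut δ v n with hs
  set m : List E → ℤ × ℤ → ℝ≥0∞ := fun w k => μ (S.endV v w) (S.pathMap w ⁻¹' meshCube2 δ k) with hm
  have hcount : ∀ k : ℤ × ℤ,
      ((s.map fun w => ENNReal.ofReal (pathWeight p w) * m w k).filter (· ≠ 0)).card ≤ M := by
    intro k
    rw [Multiset.filter_map, Multiset.card_map]
    refine le_trans (le_of_eq ?_) (hR.card_cut_le hdiag v hκ0 hκ1 hδ0 hδ1 hκ n k
      (fun w => ENNReal.ofReal (pathWeight p w) * m w k ≠ 0) fun w _ hw => ?_)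
    · congr
    by_contra! hcon
    refine hw (mul_eq_zero_of_right _ (measure_mono_null (fun z hz => ?_) (hsq (S.endV v w))))
    exact fun hz' => hcon z hz' hz
  have hmeas : ∀ k : ℤ × ℤ, MeasurableSet (meshCube2 δ k) := fun k =>
    measurableSet_Icc.prod measurableSet_Icc
  have hdec : ∀ k, μ v (meshCube2 δ k) =
      (s.map fun w => ENNReal.ofReal (pathWeight p w) * m w k).sum := fun k =>
    hμ.apply_cut hp hdiag v (hmeas k) δ n
  have hmap : ∀ k, ((s.map fun w => ENNReal.ofReal (pathWeight p w) * m w k).map (qpow q)).sum =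
      (s.map fun w => ENNReal.ofReal (pathWeight p w ^ q) * qpow q (m w k)).sum := by
    intro k
    rw [Multiset.map_map]
    congr 1
    refine Multiset.map_congr rfl fun w _ => ?_
    rw [Function.comp, qpow_mul hq, qpow_ofReal (pathWeight_pos hp.1 w)]
  have hlt : ∀ w ∈ s, pathWeight S.a w < δ ∨ pathWeight S.b w < δ := fun w hw =>
    pathWeight_lt_of_mem_cut hr0 hr hn hw
  set T₁ := (s.map fun w => ∑' k, ENNReal.ofReal (pathWeight p w ^ q) * qpow q (m w k)).sum with hT₁
  have hA : planarSum q (μ v) δ ≤ (M : ℝ≥0∞) ^ q * T₁ := by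
    rw [hT₁, ← tsum_multiset_sum, ← ENNReal.tsum_mul_left]
    refine ENNReal.tsum_le_tsum fun k => ?_
    rw [hdec, ← hmap]
    exact qpow_sum_le hq _ (hcount k)
  have hB : T₁ ≤ M * planarSum q (μ v) δ := by
    rw [hT₁, ← tsum_multiset_sum, planarSum, ← ENNReal.tsum_mul_left]
    refine ENNReal.tsum_le_tsum fun k => ?_
    rw [hdec, ← hmap]
    exact sum_qpow_le hq _ (hcount k)
  set T₂ := (s.map fun w => ENNReal.ofReal (pathWeight p w ^ q) * S.longSum q μ v δ w).sum
  have hC : T₁ ≤ C₀ * T₂ := by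
    rw [← Multiset.sum_map_mul_left]
    refine Multiset.sum_map_le_sum_map _ _ fun w hw => ?_
    rw [ENNReal.tsum_mul_left, mul_left_comm]
    gcongr
    exact (tsum_preimage_comparison hq hdiag hsq v hδ0 w (hlt w hw)).1
  have hD : T₂ ≤ C₀ * T₁ := by
    rw [← Multiset.sum_map_mul_left]
    refine Multiset.sum_map_le_sum_map _ _ fun w hw => ?_
    rw [ENNReal.tsum_mul_left, mul_left_comm]
    gcongr
    exact (tsum_preimage_comparison hq hdiag hsq v hδ0 w (hlt w hw)).2
  constructor
  · calc _ ≤ (M : ℝ≥0∞) ^ q * (C₀ * T₂) := hA.trans (by gcongr)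
      _ ≤ ((M : ℝ≥0∞) ^ q + M) * (C₀ * T₂) := by gcongr; exact le_self_add
      _ = _ := (mul_assoc _ _ _).symm
  · calc _ ≤ C₀ * (M * planarSum q (μ v) δ) := hD.trans (by gcongr)
      _ = M * C₀ * planarSum q (μ v) δ := by ring
      _ ≤ _ := by gcongr; exact le_add_self

end BoxLikeGIFS

end LqGIFS

namespace LqGIFS

/-! ### From spectra to power bounds and back -/

open scoped ENNReal

lemma toReal_qpow (q : ℝ) {m : ℝ≥0∞} :
    (qpow q m).toReal = if m = 0 then 0 else m.toReal ^ q := by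
  unfold qpow
  split_ifs
  · rfl
  · rw [ENNReal.toReal_rpow]

lemma qpow_ne_top {q : ℝ} (hq : 0 ≤ q) {m : ℝ≥0∞} (hm : m ≠ ∞) : qpow q m ≠ ∞ := by
  unfold qpow
  split_ifs
  · exact ENNReal.zero_ne_top
  · exact ENNReal.rpow_ne_top_of_nonneg hq hm

lemma Dq1_eq_toReal {q : ℝ} (hq : 0 ≤ q) (ν : Measure ℝ) [IsProbabilityMeasure ν] (δ : ℝ) :
    Dq1 ν δ q = (shiftedSum q ν δ 0).toReal := by
  rw [shiftedSum, ENNReal.tsum_toReal_eq fun k => qpow_ne_top hq (measure_ne_top _ _)]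
  simp only [toReal_qpow, add_zero]
  rfl

lemma Dq2_eq_toReal {q : ℝ} (hq : 0 ≤ q) (ν : Measure (ℝ × ℝ)) [IsProbabilityMeasure ν] (δ : ℝ) :
    Dq2 ν δ q = (planarSum q ν δ).toReal := by
  rw [planarSum, ENNReal.tsum_toReal_eq fun k => qpow_ne_top hq (measure_ne_top _ _)]
  simp only [toReal_qpow]
  rfl

lemma shiftedSum_bounds_of_le {q : ℝ} (hq : 0 ≤ q) {ε₀ : ℝ} (hε₀ : 0 < ε₀) : ∃ N : ℕ, 0 < N ∧
    ∀ (ν : Measure ℝ) [IsProbabilityMeasure ν], (∀ᵐ x ∂ν, x ∈ Icc (0 : ℝ) 1) → ∀ ε, ε₀ ≤ ε →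
      shiftedSum q ν ε 0 ≤ N ∧ 1 ≤ (N : ℝ≥0∞) ^ q * shiftedSum q ν ε 0 := by
  set F : Finset ℤ := Finset.Icc (-1) ⌊1 / ε₀⌋ with hF
  have hF0 : 0 < F.card := Finset.card_pos.2 ⟨-1, Finset.left_mem_Icc.2
    (le_trans (by norm_num) (Int.floor_nonneg.2 (by positivity)))⟩
  refine ⟨F.card, hF0, fun ν _ hν ε hε => ?_⟩
  have hε0 : 0 < ε := hε₀.trans_le hε
  have hmem : ∀ x ∈ Icc (0 : ℝ) 1, ∀ k : ℤ, x ∈ Icc (((k : ℝ) + 0) * ε) (((k : ℝ) + 0 + 1) * ε) →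
      k ∈ F := by
    intro x hx k hk
    rw [add_zero] at hk
    rw [hF, Finset.mem_Icc, Int.le_floor, le_div_iff₀ hε₀]
    constructor
    · have : (-1 : ℝ) ≤ k := by
        have : 0 ≤ (k : ℝ) + 1 := nonneg_of_mul_nonneg_left (hx.1.trans hk.2) hε0
        linarith
      exact_mod_cast this
    · rcases le_total 0 (k : ℝ) with h | h
      · exact (mul_le_mul_of_nonneg_left hε h).trans (hk.1.trans hx.2)
      · exact (mul_nonpos_of_nonpos_of_nonneg h hε₀.le).trans zero_le_one
  have hnull : ∀ k ∉ F, ν (Icc (((k : ℝ) + 0) * ε) (((k : ℝ) + 0 + 1) * ε)) = 0 := by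
    intro k hk
    refine measure_mono_null (fun x hx hx' => hk (hmem x hx' k hx)) hν
  have hsum : shiftedSum q ν ε 0 =
      ∑ k ∈ F, qpow q (ν (Icc (((k : ℝ) + 0) * ε) (((k : ℝ) + 0 + 1) * ε))) := by
    rw [shiftedSum, tsum_eq_sum fun k hk => by rw [hnull k hk, qpow_zero_right]]
  constructor
  · rw [hsum]
    refine (Finset.sum_le_card_nsmul F _ 1 fun k _ => qpow_le_one hq prob_le_one).trans ?_
    simp
  · have hone : (1 : ℝ≥0∞) ≤ ∑ k ∈ F, ν (Icc (((k : ℝ) + 0) * ε) (((k : ℝ) + 0 + 1) * ε)) := by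
      calc (1 : ℝ≥0∞) = ν (Icc (0 : ℝ) 1) := ((prob_compl_eq_zero_iff measurableSet_Icc).1 hν).symm
        _ ≤ ν (⋃ k ∈ F, Icc (((k : ℝ) + 0) * ε) (((k : ℝ) + 0 + 1) * ε)) := by
          refine measure_mono fun x hx => ?_
          have hk : x ∈ Icc (((⌊x / ε⌋ : ℝ) + 0) * ε) (((⌊x / ε⌋ : ℝ) + 0 + 1) * ε) := by
            rw [add_zero]
            exact ⟨(le_div_iff₀ hε0).1 (Int.floor_le _),
              (div_le_iff₀ hε0).1 (Int.lt_floor_add_one _).le⟩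
          exact mem_iUnion₂.2 ⟨_, hmem x hx _ hk, hk⟩
        _ ≤ _ := measure_biUnion_finset_le _ _
    have h := qpow_sum_le hq (F.val.map fun k : ℤ =>
      ν (Icc (((k : ℝ) + 0) * ε) (((k : ℝ) + 0 + 1) * ε))) (M := F.card)
      ((Multiset.card_le_card (Multiset.filter_le _ _)).trans (by simp))
    rw [Multiset.map_map] at h
    rw [hsum]
    refine le_trans ?_ h
    rw [← ENNReal.one_rpow q, ← qpow_of_ne_zero q one_ne_zero]
    exact qpow_mono hq hone

lemma rpow_bounds {κ T t : ℝ} (hκ0 : 0 < κ) (hκ1 : κ ≤ 1) (hT : 1 ≤ T) (h₁ : κ ≤ t) (h₂ : t ≤ T)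
    (s : ℝ) : t ^ s ≤ T ^ |s| * κ ^ (-|s|) ∧ T ^ (-|s|) * κ ^ |s| ≤ t ^ s := by
  have up : ∀ s : ℝ, t ^ s ≤ T ^ |s| * κ ^ (-|s|) := by
    intro s
    have ht : 0 < t := hκ0.trans_le h₁
    rcases le_total 0 s with hs | hs
    · rw [abs_of_nonneg hs]
      calc t ^ s ≤ T ^ s := Real.rpow_le_rpow ht.le h₂ hs
        _ ≤ T ^ s * κ ^ (-s) := le_mul_of_one_le_right (Real.rpow_nonneg (by linarith) _)
          (Real.one_le_rpow_of_pos_of_le_one_of_nonpos hκ0 hκ1 (by linarith))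
    · rw [abs_of_nonpos hs, neg_neg]
      calc t ^ s ≤ κ ^ s := Real.rpow_le_rpow_of_nonpos hκ0 h₁ hs
        _ ≤ T ^ (-s) * κ ^ s := le_mul_of_one_le_left (Real.rpow_nonneg hκ0.le _)
          (Real.one_le_rpow hT (by linarith))
  refine ⟨up s, ?_⟩
  have ht : 0 < t := hκ0.trans_le h₁
  have h := up (-s)
  rw [abs_neg, Real.rpow_neg ht.le, Real.rpow_neg hκ0.le] at h
  rw [Real.rpow_neg (by linarith)]
  have hTs : 0 < T ^ |s| := Real.rpow_pos_of_pos (by linarith) _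
  have hκs : 0 < κ ^ |s| := Real.rpow_pos_of_pos hκ0 _
  have hts : 0 < t ^ s := Real.rpow_pos_of_pos ht _
  rw [inv_le_iff_one_le_mul₀ hts] at h
  rw [inv_mul_le_iff₀ hTs]
  have : 1 ≤ T ^ |s| * t ^ s / κ ^ |s| := by
    refine h.trans (le_of_eq ?_)
    rw [div_eq_mul_inv]; ring
  rwa [le_div_iff₀ hκs, one_mul] at this

lemma exists_moment_bounds {q τ : ℝ} (hq : 0 ≤ q) (ν : Measure ℝ) [IsProbabilityMeasure ν]
    (hν : ∀ᵐ x ∂ν, x ∈ Icc (0 : ℝ) 1) (h : HasLq1 ν q τ) {η K : ℝ} (hη : 0 < η) (hK : 1 ≤ K) :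
    ∃ C : ℝ, 0 < C ∧ ∀ ε, 0 < ε → ε ≤ K →
      ENNReal.ofReal (ε ^ (-τ + η)) ≤ ENNReal.ofReal C * shiftedSum q ν ε 0 ∧
      shiftedSum q ν ε 0 ≤ ENNReal.ofReal (C * ε ^ (-τ - η)) := by
  have hev : ∀ᶠ ε in nhdsWithin (0 : ℝ) (Ioi 0),
      |Real.log (Dq1 ν ε q) / (-Real.log ε) - τ| < η := by
    have := (Metric.tendsto_nhds.1 h) η hη
    simpa only [Real.dist_eq] using this
  obtain ⟨ε₁, hε₁, hsub⟩ := mem_nhdsGT_iff_exists_Ioo_subset.1 hev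
  set ε₀ := min ε₁ 2⁻¹ with hε₀
  have hε₀0 : 0 < ε₀ := lt_min hε₁ (by norm_num)
  have hε₀1 : ε₀ < 1 := (min_le_right _ _).trans_lt (by norm_num)
  obtain ⟨N, hN, hbd⟩ := shiftedSum_bounds_of_le hq hε₀0
  have hsmall : ∀ ε, 0 < ε → ε < ε₀ → ENNReal.ofReal (ε ^ (-τ + η)) ≤ shiftedSum q ν ε 0 ∧
      shiftedSum q ν ε 0 ≤ ENNReal.ofReal (ε ^ (-τ - η)) := by
    intro ε hε hεε
    have hlt : |Real.log (Dq1 ν ε q) / (-Real.log ε) - τ| < η :=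
      hsub ⟨hε, hεε.trans_le (min_le_left _ _)⟩
    have hlog : 0 < -Real.log ε := neg_pos.2 (Real.log_neg hε (hεε.trans hε₀1))
    obtain ⟨N', hN', hbd'⟩ := shiftedSum_bounds_of_le hq hε
    obtain ⟨hb1, hb2⟩ := hbd' ν hν ε le_rfl
    have hfin : shiftedSum q ν ε 0 ≠ ∞ := ne_top_of_le_ne_top (ENNReal.natCast_ne_top _) hb1
    have hpos : shiftedSum q ν ε 0 ≠ 0 := by
      intro h0
      rw [h0, mul_zero] at hb2
      exact absurd hb2 (by simp)
    rw [Dq1_eq_toReal hq] at hlt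
    set D := (shiftedSum q ν ε 0).toReal with hD
    have hD0 : 0 < D := ENNReal.toReal_pos hpos hfin
    rw [← ENNReal.ofReal_toReal hfin, ← hD]
    obtain ⟨h1, h2⟩ := abs_lt.1 hlt
    have h3 : Real.log D < (τ + η) * -Real.log ε := (div_lt_iff₀ hlog).1 (by linarith)
    have h4 : (τ - η) * -Real.log ε < Real.log D := (lt_div_iff₀ hlog).1 (by linarith)
    constructor
    · refine ENNReal.ofReal_le_ofReal ?_
      rw [← Real.exp_log hD0, Real.rpow_def_of_pos hε, Real.exp_le_exp]
      nlinarith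
    · refine ENNReal.ofReal_le_ofReal ?_
      rw [← Real.exp_log hD0, Real.rpow_def_of_pos hε, Real.exp_le_exp]
      nlinarith
  set A := K ^ |-τ + η| * ε₀ ^ (-|-τ + η|) with hA
  set B := K ^ (-|-τ - η|) * ε₀ ^ |-τ - η| with hB
  have hA0 : 0 < A := mul_pos (Real.rpow_pos_of_pos (by linarith) _) (Real.rpow_pos_of_pos hε₀0 _)
  have hB0 : 0 < B := mul_pos (Real.rpow_pos_of_pos (by linarith) _) (Real.rpow_pos_of_pos hε₀0 _)
  have hN0 : (0 : ℝ) < N := Nat.cast_pos.2 hN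
  have hNq : (0 : ℝ) < (N : ℝ) ^ q := Real.rpow_pos_of_pos hN0 _
  refine ⟨1 + A * (N : ℝ) ^ q + N / B, by positivity, fun ε hε hεK => ?_⟩
  set C := 1 + A * (N : ℝ) ^ q + N / B with hC
  have hC1 : 1 ≤ C := by
    have : 0 ≤ A * (N : ℝ) ^ q + N / B := by positivity
    linarith
  have hCA : A * (N : ℝ) ^ q ≤ C := by
    have : 0 ≤ 1 + N / B := by positivity
    linarith
  have hCB : N / B ≤ C := by
    have : 0 ≤ 1 + A * (N : ℝ) ^ q := by positivity
    linarith
  rcases lt_or_ge ε ε₀ with hlt | hge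
  · obtain ⟨h1, h2⟩ := hsmall ε hε hlt
    refine ⟨h1.trans (le_mul_of_one_le_left zero_le (ENNReal.one_le_ofReal.2 hC1)), h2.trans ?_⟩
    exact ENNReal.ofReal_le_ofReal (le_mul_of_one_le_left (Real.rpow_nonneg hε.le _) hC1)
  · obtain ⟨h1, h2⟩ := hbd ν hν ε hge
    have hA' := (rpow_bounds hε₀0 hε₀1.le hK hge hεK (-τ + η)).1
    have hB' := (rpow_bounds hε₀0 hε₀1.le hK hge hεK (-τ - η)).2
    constructor
    · calc ENNReal.ofReal (ε ^ (-τ + η)) ≤ ENNReal.ofReal A * 1 := by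
            rw [mul_one]; exact ENNReal.ofReal_le_ofReal hA'
        _ ≤ ENNReal.ofReal A * ((N : ℝ≥0∞) ^ q * shiftedSum q ν ε 0) := by gcongr
        _ = ENNReal.ofReal (A * (N : ℝ) ^ q) * shiftedSum q ν ε 0 := by
          rw [ENNReal.ofReal_mul hA0.le, ← ENNReal.ofReal_rpow_of_pos hN0, ENNReal.ofReal_natCast,
            mul_assoc]
        _ ≤ _ := by gcongr
    · refine h1.trans ?_
      rw [← ENNReal.ofReal_natCast]
      refine ENNReal.ofReal_le_ofReal ?_
      have := (div_le_iff₀ hB0).1 hCB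
      exact this.trans (mul_le_mul_of_nonneg_left hB' (by linarith))

/-- Two-sided power bounds, up to arbitrarily small loss in the exponent, determine the
planar spectrum. -/
lemma hasLq2_of_bounds {q s : ℝ} (hq : 0 ≤ q) (ν : Measure (ℝ × ℝ)) [IsProbabilityMeasure ν]
    (hup : ∀ η, 0 < η → ∃ C : ℝ, 0 < C ∧ ∀ᶠ δ in nhdsWithin (0 : ℝ) (Ioi 0),
      planarSum q ν δ ≤ ENNReal.ofReal (C * δ ^ (-s - η)))
    (hlow : ∀ η, 0 < η → ∃ C : ℝ, 0 < C ∧ ∀ᶠ δ in nhdsWithin (0 : ℝ) (Ioi 0),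
      ENNReal.ofReal (C * δ ^ (-s + η)) ≤ planarSum q ν δ) : HasLq2 ν q s := by
  refine Metric.tendsto_nhds.2 fun η hη => ?_
  obtain ⟨C₁, hC₁, h₁⟩ := hup (η / 2) (by linarith)
  obtain ⟨C₂, hC₂, h₂⟩ := hlow (η / 2) (by linarith)
  have hlim : Tendsto (fun δ : ℝ => -Real.log δ) (nhdsWithin 0 (Ioi 0)) atTop :=
    tendsto_neg_atBot_atTop.comp Real.tendsto_log_nhdsGT_zero
  filter_upwards [h₁, h₂, self_mem_nhdsWithin,
    hlim.eventually_gt_atTop (2 * (|Real.log C₁| + |Real.log C₂|) / η),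
    hlim.eventually_gt_atTop 0] with δ hδ₁ hδ₂ hδ0 hδ hlog
  have hδ0 : 0 < δ := hδ0
  have hfin : planarSum q ν δ ≠ ∞ := ne_top_of_le_ne_top ENNReal.ofReal_ne_top hδ₁
  rw [Dq2_eq_toReal hq]
  set D := (planarSum q ν δ).toReal with hD
  rw [← ENNReal.ofReal_toReal hfin, ← hD] at hδ₁ hδ₂
  have hD2 : C₂ * δ ^ (-s + η / 2) ≤ D := by
    rwa [ENNReal.ofReal_le_ofReal_iff ENNReal.toReal_nonneg] at hδ₂
  have hD0 : 0 < D := lt_of_lt_of_le (mul_pos hC₂ (Real.rpow_pos_of_pos hδ0 _)) hD2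
  have hD1 : D ≤ C₁ * δ ^ (-s - η / 2) := by
    rwa [ENNReal.ofReal_le_ofReal_iff
      (mul_pos hC₁ (Real.rpow_pos_of_pos hδ0 _)).le] at hδ₁
  have l1 := Real.log_le_log hD0 hD1
  have l2 := Real.log_le_log (mul_pos hC₂ (Real.rpow_pos_of_pos hδ0 _)) hD2
  rw [Real.log_mul hC₁.ne' (Real.rpow_pos_of_pos hδ0 _).ne', Real.log_rpow hδ0] at l1
  rw [Real.log_mul hC₂.ne' (Real.rpow_pos_of_pos hδ0 _).ne', Real.log_rpow hδ0] at l2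
  rw [div_lt_iff₀ hη] at hδ
  have a1 := le_abs_self (Real.log C₁)
  have a2 := neg_abs_le (Real.log C₂)
  have a3 := abs_nonneg (Real.log C₁)
  have a4 := abs_nonneg (Real.log C₂)
  rw [Real.dist_eq, abs_lt]
  constructor
  · rw [neg_lt_sub_iff_lt_add, ← sub_lt_iff_lt_add', lt_div_iff₀ hlog]
    nlinarith
  · rw [sub_lt_iff_lt_add, div_lt_iff₀ hlog]
    nlinarith

end LqGIFS

namespace LqGIFS

/-! ### Estimates for a single stopped rectangle -/

lemma long_side_upper {κ δ c d τ x y η : ℝ} (hκ0 : 0 < κ) (hκ1 : κ ≤ 1) (hδ0 : 0 < δ)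
    (hdκ : κ * δ ≤ d) (hdc : d ≤ c) (hc1 : c ≤ 1) (hdδ : d ≤ δ)
    (hx : τ ≤ x) (hη : 0 < η) :
    (δ / c) ^ (-τ - η) ≤
      κ ^ (-|x - τ| - |y|) * (δ ^ (-(x + y) - η) * (c ^ x * d ^ y)) := by
  have hd0 : 0 < d := (mul_pos hκ0 hδ0).trans_le hdκ
  have hc0 : 0 < c := hd0.trans_le hdc
  have hs0 : 0 < c / δ := div_pos hc0 hδ0
  have ht0 : 0 < d / δ := div_pos hd0 hδ0
  have htκ : κ ≤ d / δ := (le_div_iff₀ hδ0).2 hdκ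
  have ht1 : d / δ ≤ 1 := (div_le_one hδ0).2 hdδ
  have hsκ : κ ≤ c / δ := htκ.trans (div_le_div_of_nonneg_right hdc hδ0.le)
  have hs1 : c / δ ≤ δ⁻¹ := by
    rw [div_eq_mul_inv]; exact mul_le_of_le_one_left (inv_nonneg.2 hδ0.le) hc1
  have e1 : (δ / c) ^ (-τ - η) = (c / δ) ^ x * (c / δ) ^ (-(x - τ)) * (c / δ) ^ η := by
    rw [← inv_div c δ, Real.inv_rpow hs0.le, ← Real.rpow_neg hs0.le, ← Real.rpow_add hs0,
      ← Real.rpow_add hs0]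
    congr 1; ring
  have e2 : (c / δ) ^ (-(x - τ)) ≤ κ ^ (-|x - τ|) := by
    rw [abs_of_nonneg (sub_nonneg.2 hx)]
    exact Real.rpow_le_rpow_of_nonpos hκ0 hsκ (by linarith)
  have e3 : (c / δ) ^ η ≤ δ ^ (-η) := by
    rw [Real.rpow_neg hδ0.le, ← Real.inv_rpow hδ0.le]
    exact Real.rpow_le_rpow hs0.le hs1 hη.le
  have e4 : 1 ≤ κ ^ (-|y|) * (d / δ) ^ y := by
    have h := (rpow_bounds hκ0 hκ1 le_rfl htκ ht1 y).2
    rw [Real.one_rpow, one_mul] at h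
    calc (1 : ℝ) = κ ^ (-|y|) * κ ^ |y| := by rw [← Real.rpow_add hκ0]; simp
      _ ≤ _ := mul_le_mul_of_nonneg_left h (Real.rpow_nonneg hκ0.le _)
  have e5 : (c / δ) ^ x * (d / δ) ^ y * δ ^ (-η) = δ ^ (-(x + y) - η) * (c ^ x * d ^ y) := by
    rw [Real.div_rpow hc0.le hδ0.le, Real.div_rpow hd0.le hδ0.le,
      show -(x + y) - η = -x + -y + -η by ring, Real.rpow_add hδ0, Real.rpow_add hδ0,
      Real.rpow_neg hδ0.le x, Real.rpow_neg hδ0.le y]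
    ring
  calc (δ / c) ^ (-τ - η) = (c / δ) ^ x * (c / δ) ^ (-(x - τ)) * (c / δ) ^ η * 1 := by
        rw [e1, mul_one]
    _ ≤ (c / δ) ^ x * κ ^ (-|x - τ|) * δ ^ (-η) * (κ ^ (-|y|) * (d / δ) ^ y) := by
        gcongr
    _ = κ ^ (-|x - τ|) * κ ^ (-|y|) * ((c / δ) ^ x * (d / δ) ^ y * δ ^ (-η)) := by ring
    _ = _ := by rw [e5, ← Real.rpow_add hκ0]; rfl

lemma long_side_lower {κ δ c d τ x y η : ℝ} (hκ0 : 0 < κ) (hκ1 : κ ≤ 1) (hδ0 : 0 < δ) (hδ1 : δ ≤ 1)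
    (hdκ : κ * δ ≤ d) (hdc : d ≤ c) (hc1 : c ≤ 1) (hdδ : d ≤ δ)
    (hx : x = τ ∨ c / d ≤ δ ^ (-η)) (hη : 0 < η) :
    c ^ x * d ^ y ≤ κ ^ (-|x - τ| - |y|) * δ ^ (x + y - η * (1 + |x - τ|)) *
      (δ / c) ^ (-τ + η) := by
  have hd0 : 0 < d := (mul_pos hκ0 hδ0).trans_le hdκ
  have hc0 : 0 < c := hd0.trans_le hdc
  have hs0 : 0 < c / δ := div_pos hc0 hδ0
  have ht0 : 0 < d / δ := div_pos hd0 hδ0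
  have htκ : κ ≤ d / δ := (le_div_iff₀ hδ0).2 hdκ
  have ht1 : d / δ ≤ 1 := (div_le_one hδ0).2 hdδ
  have hsκ : κ ≤ c / δ := htκ.trans (div_le_div_of_nonneg_right hdc hδ0.le)
  have hs1 : c / δ ≤ δ⁻¹ := by
    rw [div_eq_mul_inv]; exact mul_le_of_le_one_left (inv_nonneg.2 hδ0.le) hc1
  have e1 : (c / δ) ^ x = (δ / c) ^ (-τ + η) * (c / δ) ^ η * (c / δ) ^ (x - τ) := by
    rw [← inv_div c δ, Real.inv_rpow hs0.le, ← Real.rpow_neg hs0.le, ← Real.rpow_add hs0,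
      ← Real.rpow_add hs0]
    congr 1; ring
  have e2 : (c / δ) ^ (x - τ) ≤ δ ^ (-η * |x - τ|) * κ ^ (-|x - τ|) := by
    rcases hx with rfl | hx
    · simp
    · have hs : c / δ ≤ δ ^ (-η) := by
        calc c / δ = c / d * (d / δ) := by field_simp
          _ ≤ c / d * 1 := by gcongr
          _ ≤ _ := by rwa [mul_one]
      have h := (rpow_bounds hκ0 hκ1 (Real.one_le_rpow_of_pos_of_le_one_of_nonpos hδ0 hδ1
        (by linarith)) hsκ hs (x - τ)).1
      rwa [← Real.rpow_mul hδ0.le] at h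
  have e3 : (c / δ) ^ η ≤ δ ^ (-η) := by
    rw [Real.rpow_neg hδ0.le, ← Real.inv_rpow hδ0.le]
    exact Real.rpow_le_rpow hs0.le hs1 hη.le
  have e4 : (d / δ) ^ y ≤ κ ^ (-|y|) := by
    have h := (rpow_bounds hκ0 hκ1 le_rfl htκ ht1 y).1
    rwa [Real.one_rpow, one_mul] at h
  have e5 : c ^ x * d ^ y = δ ^ (x + y) * ((c / δ) ^ x * (d / δ) ^ y) := by
    rw [Real.div_rpow hc0.le hδ0.le, Real.div_rpow hd0.le hδ0.le, Real.rpow_add hδ0]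
    have h1 := (Real.rpow_pos_of_pos hδ0 x).ne'
    have h2 := (Real.rpow_pos_of_pos hδ0 y).ne'
    field_simp
  have hpos : 0 < δ / c := div_pos hδ0 hc0
  calc c ^ x * d ^ y
      = δ ^ (x + y) * ((δ / c) ^ (-τ + η) * (c / δ) ^ η * (c / δ) ^ (x - τ) * (d / δ) ^ y) := by
        rw [e5, e1]
    _ ≤ δ ^ (x + y) * ((δ / c) ^ (-τ + η) * δ ^ (-η) * (δ ^ (-η * |x - τ|) * κ ^ (-|x - τ|)) *
          κ ^ (-|y|)) := by gcongr
    _ = κ ^ (-|x - τ|) * κ ^ (-|y|) * (δ ^ (x + y) * δ ^ (-η) * δ ^ (-η * |x - τ|)) *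
          (δ / c) ^ (-τ + η) := by ring
    _ = _ := by
        rw [← Real.rpow_add hκ0, ← Real.rpow_add hδ0, ← Real.rpow_add hδ0]
        congr 3
        ring

/-- Exponential tilting: rectangles that are too eccentric carry little weight. -/
lemma eccentric_bound {κ δ c d x y x' y' θ α η : ℝ} (hκ0 : 0 < κ) (hδ0 : 0 < δ)
    (hcκ : κ * δ ≤ c) (hdκ : κ * δ ≤ d) (hc1 : c ≤ 1) (hd1 : d ≤ 1) (hθ : 0 < θ) (hα : 0 < α)
    (hx : x' ≤ x + θ + α) (hy : y' ≤ y - θ + α) : c / d ≤ δ ^ (-η) ∨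
      c ^ x * d ^ y ≤ κ ^ (-(2 * α)) * δ ^ (η * θ - 2 * α) * (c ^ x' * d ^ y') := by
  refine or_iff_not_imp_left.2 fun hbad => ?_
  rw [not_le] at hbad
  have hκδ := mul_pos hκ0 hδ0
  have hc0 : 0 < c := hκδ.trans_le hcκ
  have hd0 : 0 < d := hκδ.trans_le hdκ
  have h1 : c ^ x * d ^ y = c ^ x' * d ^ y' * (c ^ (x - x') * d ^ (y - y')) := by
    rw [mul_mul_mul_comm, ← Real.rpow_add hc0, ← Real.rpow_add hd0]
    congr 2 <;> ring
  have h2 : c ^ (x - x') ≤ c ^ (-θ) * (κ * δ) ^ (-α) := by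
    calc c ^ (x - x') ≤ c ^ (-θ + -α) :=
          Real.rpow_le_rpow_of_exponent_ge hc0 hc1 (by linarith)
      _ = c ^ (-θ) * c ^ (-α) := Real.rpow_add hc0 _ _
      _ ≤ _ := mul_le_mul_of_nonneg_left
          (Real.rpow_le_rpow_of_nonpos hκδ hcκ (by linarith)) (Real.rpow_nonneg hc0.le _)
  have h3 : d ^ (y - y') ≤ d ^ θ * (κ * δ) ^ (-α) := by
    calc d ^ (y - y') ≤ d ^ (θ + -α) :=
          Real.rpow_le_rpow_of_exponent_ge hd0 hd1 (by linarith)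
      _ = d ^ θ * d ^ (-α) := Real.rpow_add hd0 _ _
      _ ≤ _ := mul_le_mul_of_nonneg_left
          (Real.rpow_le_rpow_of_nonpos hκδ hdκ (by linarith)) (Real.rpow_nonneg hd0.le _)
  have h4 : c ^ (-θ) * d ^ θ ≤ δ ^ (η * θ) := by
    have : (c / d) ^ (-θ) ≤ (δ ^ (-η)) ^ (-θ) :=
      Real.rpow_le_rpow_of_nonpos (Real.rpow_pos_of_pos hδ0 _) hbad.le (by linarith)
    rw [← Real.rpow_mul hδ0.le, neg_mul_neg, Real.div_rpow hc0.le hd0.le,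
      Real.rpow_neg hd0.le, div_inv_eq_mul] at this
    exact this
  rw [h1, mul_comm]
  refine mul_le_mul_of_nonneg_right ?_ (by positivity)
  calc c ^ (x - x') * d ^ (y - y') ≤ c ^ (-θ) * (κ * δ) ^ (-α) * (d ^ θ * (κ * δ) ^ (-α)) := by
        gcongr
    _ = (κ * δ) ^ (-α + -α) * (c ^ (-θ) * d ^ θ) := by rw [Real.rpow_add hκδ]; ring
    _ ≤ (κ * δ) ^ (-α + -α) * δ ^ (η * θ) := by gcongr
    _ = _ := by
        rw [Real.mul_rpow hκ0.le hδ0.le, mul_assoc, ← Real.rpow_add hδ0]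
        congr 2 <;> ring

end LqGIFS

namespace LqGIFS

namespace BoxLikeGIFS

open scoped ENNReal

/-! ### Power bounds for the planar moment sums -/

variable {V E : Type} [Fintype V] {S : BoxLikeGIFS V E} {p : E → ℝ}
  {μ : V → Measure (ℝ × ℝ)} {q x y : ℝ}

lemma exists_sum_cut_bounds [Fintype E] {g : E → ℝ} (hp : ∀ e, 0 < p e)
    (hP : IsPerronData S.init S.term p S.a S.b q x y g) : ∃ C : ℝ, 0 < C ∧
    ∀ (v : V) (δ : ℝ) (n : ℕ),
      ((S.cut δ v n).map fun w => ENNReal.ofReal (pathWeight p w ^ q *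
        (pathWeight S.a w ^ x * pathWeight S.b w ^ y))).sum ≤ ENNReal.ofReal C ∧
      1 ≤ ENNReal.ofReal C * ((S.cut δ v n).map fun w => ENNReal.ofReal (pathWeight p w ^ q *
        (pathWeight S.a w ^ x * pathWeight S.b w ^ y))).sum := by
  obtain ⟨U, hU0, hU⟩ := exists_vertex_weights S.edge_exists hp S.a_mem S.b_mem hP
  obtain ⟨m, hm0, hm⟩ := exists_pos_le_of_forall_pos hU0
  obtain ⟨M, hM0, hM⟩ := exists_pos_ge U
  have hpos : ∀ w, 0 < pathWeight p w ^ q * (pathWeight S.a w ^ x * pathWeight S.b w ^ y) := by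
    intro w
    have h1 := pathWeight_pos hp w
    have h2 := pathWeight_pos (fun e => (S.a_mem e).1) w
    have h3 := pathWeight_pos (fun e => (S.b_mem e).1) w
    positivity
  refine ⟨M / m, by positivity, fun v δ n => ?_⟩
  set W : List E → ℝ := fun w =>
    pathWeight p w ^ q * (pathWeight S.a w ^ x * pathWeight S.b w ^ y) with hW
  have hsum : ((S.cut δ v n).map fun w => ENNReal.ofReal (W w * U (S.endV v w))).sum =
      ENNReal.ofReal (U v) := by
    rw [sum_cut_eq]
    · simp [hW, endV]
    · intro w
      rw [hU (S.endV v w), Finset.mul_sum, ENNReal.ofReal_sum_of_nonneg]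
      · refine Finset.sum_congr rfl fun e _ => ?_
        split_ifs with he
        · congr 1
          simp only [hW, pathWeight_cons, endV]
          rw [Real.mul_rpow (hp e).le (pathWeight_pos hp w).le,
            Real.mul_rpow (S.a_mem e).1.le (pathWeight_pos (fun e => (S.a_mem e).1) w).le,
            Real.mul_rpow (S.b_mem e).1.le (pathWeight_pos (fun e => (S.b_mem e).1) w).le]
          ring
        · simp
      · intro e _
        refine mul_nonneg (hpos w).le ?_
        split_ifs
        · have := hp e; have := (S.a_mem e).1; have := (S.b_mem e).1; have := hU0 (S.term e)
          positivity
        · exact le_rfl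
  constructor
  · calc ((S.cut δ v n).map fun w => ENNReal.ofReal (W w)).sum
        ≤ ((S.cut δ v n).map fun w => ENNReal.ofReal m⁻¹ *
            ENNReal.ofReal (W w * U (S.endV v w))).sum := by
          refine Multiset.sum_map_le_sum_map _ _ fun w _ => ?_
          rw [← ENNReal.ofReal_mul (by positivity)]
          refine ENNReal.ofReal_le_ofReal ?_
          rw [inv_mul_eq_div, le_div_iff₀ hm0]
          exact mul_le_mul_of_nonneg_left (hm _) (hpos w).le
      _ = ENNReal.ofReal m⁻¹ * ENNReal.ofReal (U v) := by rw [Multiset.sum_map_mul_left, hsum]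
      _ ≤ ENNReal.ofReal (M / m) := by
          rw [← ENNReal.ofReal_mul (by positivity), inv_mul_eq_div]
          exact ENNReal.ofReal_le_ofReal (div_le_div_of_nonneg_right (hM v) hm0.le)
  · calc (1 : ℝ≥0∞) = ENNReal.ofReal m⁻¹ * ENNReal.ofReal m := by
          rw [← ENNReal.ofReal_mul (by positivity), inv_mul_cancel₀ hm0.ne', ENNReal.ofReal_one]
      _ ≤ ENNReal.ofReal m⁻¹ * ENNReal.ofReal (U v) := by gcongr; exact hm v
      _ ≤ ENNReal.ofReal m⁻¹ * ((S.cut δ v n).map fun w => ENNReal.ofReal M *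
            ENNReal.ofReal (W w)).sum := by
          rw [← hsum]
          gcongr
          refine Multiset.sum_map_le_sum_map _ _ fun w _ => ?_
          rw [← ENNReal.ofReal_mul hM0.le, mul_comm M]
          exact ENNReal.ofReal_le_ofReal (mul_le_mul_of_nonneg_left (hM _) (hpos w).le)
      _ = _ := by
          rw [Multiset.sum_map_mul_left, ← mul_assoc, ← ENNReal.ofReal_mul (by positivity),
            inv_mul_eq_div]

lemma exists_uniform_moment_bounds {τ : ℝ} (hq : 0 ≤ q) (hμ : ∀ v, IsProbabilityMeasure (μ v))
    {π : ℝ × ℝ → ℝ} (hπ : Measurable π) (hsq : ∀ v, ∀ᵐ z ∂μ v, π z ∈ Icc (0 : ℝ) 1)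
    (h : ∀ v, HasLq1 ((μ v).map π) q τ) {η K : ℝ} (hη : 0 < η) (hK : 1 ≤ K) :
    ∃ C : ℝ, 0 < C ∧ ∀ v ε, 0 < ε → ε ≤ K →
      ENNReal.ofReal (ε ^ (-τ + η)) ≤ ENNReal.ofReal C * shiftedSum q ((μ v).map π) ε 0 ∧
      shiftedSum q ((μ v).map π) ε 0 ≤ ENNReal.ofReal (C * ε ^ (-τ - η)) := by
  have hprob : ∀ v, IsProbabilityMeasure ((μ v).map π) := fun v =>
    Measure.isProbabilityMeasure_map hπ.aemeasurable
  choose C hC0 hC using fun v => exists_moment_bounds hq ((μ v).map π)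
    ((ae_map_iff hπ.aemeasurable measurableSet_Icc).2 (hsq v)) (h v) hη hK
  obtain ⟨M, hM0, hM⟩ := exists_pos_ge C
  refine ⟨M, hM0, fun v ε hε hεK => ⟨(hC v ε hε hεK).1.trans ?_, (hC v ε hε hεK).2.trans ?_⟩⟩
  · gcongr
    exact hM v
  · refine ENNReal.ofReal_le_ofReal ?_
    gcongr
    exact hM v

variable {τA τB κ : ℝ}

lemma exists_longSum_le (hq : 0 ≤ q) (hμ : ∀ v, IsProbabilityMeasure (μ v))
    (hsq : ∀ v, ∀ᵐ z ∂μ v, z ∈ closedSq)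
    (hA : ∀ v, HasLq1 ((μ v).map Prod.fst) q τA) (hB : ∀ v, HasLq1 ((μ v).map Prod.snd) q τB)
    (hκ0 : 0 < κ) (hκ1 : κ ≤ 1) (hx : τA ≤ x) (hy : τB ≤ y) {η : ℝ} (hη : 0 < η) :
    ∃ C : ℝ, 0 < C ∧ ∀ (v : V) (δ : ℝ) (w : List E), 0 < δ →
      κ * δ ≤ pathWeight S.a w → κ * δ ≤ pathWeight S.b w →
      pathWeight S.a w ≤ 1 → pathWeight S.b w ≤ 1 →
      (pathWeight S.a w < δ ∨ pathWeight S.b w < δ) →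
      S.longSum q μ v δ w ≤ ENNReal.ofReal (C * (δ ^ (-(x + y) - η) *
        (pathWeight S.a w ^ x * pathWeight S.b w ^ y))) := by
  obtain ⟨CA, hCA0, hCA⟩ := exists_uniform_moment_bounds hq hμ measurable_fst
    (fun v => (hsq v).mono fun z hz => hz.1) hA hη (one_le_inv₀ hκ0 |>.2 hκ1)
  obtain ⟨CB, hCB0, hCB⟩ := exists_uniform_moment_bounds hq hμ measurable_snd
    (fun v => (hsq v).mono fun z hz => hz.2) hB hη (one_le_inv₀ hκ0 |>.2 hκ1)
  refine ⟨CA * κ ^ (-|x - τA| - |y|) + CB * κ ^ (-|y - τB| - |x|), by positivity,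
    fun v δ w hδ0 hcκ hdκ hc1 hd1 hlt => ?_⟩
  set c := pathWeight S.a w
  set d := pathWeight S.b w
  have hκδ := mul_pos hκ0 hδ0
  have hc0 : 0 < c := hκδ.trans_le hcκ
  have hd0 : 0 < d := hκδ.trans_le hdκ
  have hscale : ∀ t, 0 < t → κ * δ ≤ t → δ / t ≤ κ⁻¹ := by
    intro t ht h
    rw [div_le_iff₀ ht, ← div_eq_inv_mul, le_div_iff₀ hκ0, mul_comm]
    exact h
  have hpos : 0 ≤ δ ^ (-(x + y) - η) * (c ^ x * d ^ y) := by positivity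
  rw [longSum]
  split_ifs with hdc
  · refine ((hCA _ _ (div_pos hδ0 hc0) (hscale c hc0 hcκ)).2).trans (ENNReal.ofReal_le_ofReal ?_)
    have hdδ : d ≤ δ := hlt.elim (fun h => hdc.trans h.le) le_of_lt
    have := long_side_upper (y := y) hκ0 hκ1 hδ0 hdκ hdc hc1 hdδ hx hη
    calc CA * (δ / c) ^ (-τA - η) ≤ CA * (κ ^ (-|x - τA| - |y|) *
          (δ ^ (-(x + y) - η) * (c ^ x * d ^ y))) := mul_le_mul_of_nonneg_left this hCA0.le
      _ = CA * κ ^ (-|x - τA| - |y|) * (δ ^ (-(x + y) - η) * (c ^ x * d ^ y)) := by ring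
      _ ≤ _ := mul_le_mul_of_nonneg_right (le_add_of_nonneg_right (by positivity)) hpos
  · rw [not_le] at hdc
    refine ((hCB _ _ (div_pos hδ0 hd0) (hscale d hd0 hdκ)).2).trans (ENNReal.ofReal_le_ofReal ?_)
    have hcδ : c ≤ δ := hlt.elim le_of_lt (fun h => hdc.le.trans h.le)
    have := long_side_upper (y := x) hκ0 hκ1 hδ0 hcκ hdc.le hd1 hcδ hy hη
    calc CB * (δ / d) ^ (-τB - η) ≤ CB * (κ ^ (-|y - τB| - |x|) *
          (δ ^ (-(y + x) - η) * (d ^ y * c ^ x))) := mul_le_mul_of_nonneg_left this hCB0.le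
      _ = CB * κ ^ (-|y - τB| - |x|) * (δ ^ (-(x + y) - η) * (c ^ x * d ^ y)) := by
        rw [add_comm y x]; ring
      _ ≤ _ := mul_le_mul_of_nonneg_right (le_add_of_nonneg_left (by positivity)) hpos

lemma pathWeight_le_one {g : E → ℝ} (hg : ∀ e, g e ∈ Ioo (0 : ℝ) 1) (w : List E) :
    pathWeight g w ≤ 1 := by
  simpa using pathWeight_le_pow (fun e => (hg e).1) one_pos (fun e => (hg e).2.le) w

lemma exists_planarSum_le [Fintype E] [Nonempty E] (hq : 0 ≤ q) (hμ : S.IsGDMeasure p μ) (hp : S.IsWeights p)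
    (hR : S.ROSC) (hdiag : ∀ e, S.diag e = true)
    (hA : ∀ v, HasLq1 ((μ v).map Prod.fst) q τA) (hB : ∀ v, HasLq1 ((μ v).map Prod.snd) q τB)
    {g : E → ℝ} (hP : IsPerronData S.init S.term p S.a S.b q x y g)
    (hx : τA ≤ x) (hy : τB ≤ y) {η : ℝ} (hη : 0 < η) :
    ∃ C : ℝ, 0 < C ∧ ∀ v δ, 0 < δ → δ ≤ 1 →
      planarSum q (μ v) δ ≤ ENNReal.ofReal (C * δ ^ (-(x + y) - η)) := by
  obtain ⟨κ, r, hκ0, hκ1, hr1, hr0, hr⟩ := exists_ratio_bounds S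
  have hsq := hμ.ae_mem_closedSq hp hR hdiag
  obtain ⟨C₁, hC₁, h₁⟩ := planarSum_comparison hq hμ hp hR hdiag hsq hκ0 hκ1 hr0
    (fun e => ⟨(hr e).1, (hr e).2.1⟩) (fun e => (hr e).2.2)
  obtain ⟨C₂, hC₂, h₂⟩ := exists_longSum_le (S := S) hq hμ.1 hsq hA hB hκ0 hκ1 hx hy hη
  obtain ⟨C₃, hC₃, h₃⟩ := exists_sum_cut_bounds hp.1 hP
  refine ⟨(C₁.toReal + 1) * (C₂ * C₃), by positivity, fun v δ hδ0 hδ1 => ?_⟩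
  obtain ⟨n, hn⟩ := exists_pow_lt_of_lt_one hδ0 hr1
  have hδs : 0 < δ ^ (-(x + y) - η) := Real.rpow_pos_of_pos hδ0 _
  calc planarSum q (μ v) δ ≤ C₁ * ((S.cut δ v n).map fun w =>
        ENNReal.ofReal (pathWeight p w ^ q) * S.longSum q μ v δ w).sum := (h₁ v δ n hδ0 hδ1 hn).1
    _ ≤ C₁ * ((S.cut δ v n).map fun w => ENNReal.ofReal (C₂ * δ ^ (-(x + y) - η)) *
        ENNReal.ofReal (pathWeight p w ^ q *
          (pathWeight S.a w ^ x * pathWeight S.b w ^ y))).sum := by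
        gcongr
        refine Multiset.sum_map_le_sum_map _ _ fun w hw => ?_
        obtain ⟨hcκ, hdκ⟩ := le_pathWeight_of_mem_cut hκ1 hδ0 hδ1
          (fun e => ⟨(hr e).1, (hr e).2.1⟩) hw
        have hlt := pathWeight_lt_of_mem_cut hr0 (fun e => (hr e).2.2) hn hw
        have hpw := pathWeight_pos hp.1 w
        refine (mul_le_mul_right (h₂ v δ w hδ0 hcκ hdκ (pathWeight_le_one S.a_mem w)
          (pathWeight_le_one S.b_mem w) hlt) _).trans (le_of_eq ?_)
        rw [← ENNReal.ofReal_mul (by positivity), ← ENNReal.ofReal_mul (by positivity)]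
        congr 1
        ring
    _ ≤ C₁ * (ENNReal.ofReal (C₂ * δ ^ (-(x + y) - η)) * ENNReal.ofReal C₃) := by
        rw [Multiset.sum_map_mul_left]
        gcongr
        exact (h₃ v δ n).1
    _ ≤ ENNReal.ofReal (C₁.toReal + 1) *
          (ENNReal.ofReal (C₂ * δ ^ (-(x + y) - η)) * ENNReal.ofReal C₃) := by
        gcongr
        rw [ENNReal.le_ofReal_iff_toReal_le hC₁ (by positivity)]
        linarith
    _ = _ := by
        rw [← ENNReal.ofReal_mul (by positivity), ← ENNReal.ofReal_mul (by positivity)]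
        congr 1
        ring

end BoxLikeGIFS

end LqGIFS

namespace LqGIFS

namespace BoxLikeGIFS

open scoped ENNReal

variable {V E : Type} {S : BoxLikeGIFS V E} {p : E → ℝ}
  {μ : V → Measure (ℝ × ℝ)} {q x τA τB κ : ℝ} {Y : ℝ → ℝ} {f : ℝ → E → ℝ}

lemma exists_tilt_right [Fintype E] [Nonempty E] (hSC : S.StronglyConnected) (hp : ∀ e, 0 < p e)
    (hP : ∀ x, IsPerronData S.init S.term p S.a S.b q x (Y x) (f x)) (hκ0 : 0 < κ)
    (hx : x = τA ∨ 1 ≤ slope S.a S.b (f x)) {η : ℝ} (hη : 0 < η) :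
    ∃ x' C β : ℝ, 0 < C ∧ 0 < β ∧ ∀ δ c d : ℝ, 0 < δ → κ * δ ≤ c → κ * δ ≤ d → c ≤ 1 → d ≤ 1 →
      (x = τA ∨ c / d ≤ δ ^ (-η)) ∨ c ^ x * d ^ Y x ≤ C * δ ^ β * (c ^ x' * d ^ Y x') := by
  rcases hx with hx | hx
  · exact ⟨x, 1, 1, one_pos, one_pos, fun _ _ _ _ _ _ _ _ => Or.inl (Or.inl hx)⟩
  obtain ⟨θ, hθ, h⟩ := exists_right_displacement hSC hp S.a_mem S.b_mem hP
    (η := η / 4) (by linarith) hx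
  refine ⟨x + θ, κ ^ (-(2 * (η / 4 * θ))), η * θ - 2 * (η / 4 * θ), by positivity,
    by nlinarith [mul_pos hη hθ], fun δ c d hδ hc hd hc1 hd1 => ?_⟩
  have hα : 0 < η / 4 * θ := by positivity
  exact (eccentric_bound hκ0 hδ hc hd hc1 hd1 hθ hα (by linarith) h).imp_left Or.inr

lemma exists_tilt_left [Fintype E] [Nonempty E] (hSC : S.StronglyConnected) (hp : ∀ e, 0 < p e)
    (hP : ∀ x, IsPerronData S.init S.term p S.a S.b q x (Y x) (f x)) (hκ0 : 0 < κ)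
    (hx : Y x = τB ∨ slope S.a S.b (f x) ≤ 1) {η : ℝ} (hη : 0 < η) :
    ∃ x' C β : ℝ, 0 < C ∧ 0 < β ∧ ∀ δ c d : ℝ, 0 < δ → κ * δ ≤ c → κ * δ ≤ d → c ≤ 1 → d ≤ 1 →
      (Y x = τB ∨ d / c ≤ δ ^ (-η)) ∨ c ^ x * d ^ Y x ≤ C * δ ^ β * (c ^ x' * d ^ Y x') := by
  rcases hx with hx | hx
  · exact ⟨x, 1, 1, one_pos, one_pos, fun _ _ _ _ _ _ _ _ => Or.inl (Or.inl hx)⟩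
  obtain ⟨θ, hθ, h⟩ := exists_left_displacement hSC hp S.a_mem S.b_mem hP
    (η := η / 4) (by linarith) hx
  refine ⟨x - θ, κ ^ (-(2 * (η / 4 * θ))), η * θ - 2 * (η / 4 * θ), by positivity,
    by nlinarith [mul_pos hη hθ], fun δ c d hδ hc hd hc1 hd1 => ?_⟩
  have hα : 0 < η / 4 * θ := by positivity
  have := (eccentric_bound (η := η) (x := Y x) (y := x) (x' := Y (x - θ)) (y' := x - θ) hκ0 hδ hd hc
    hd1 hc1 hθ hα h (by linarith)).imp_left (Or.inr (a := Y x = τB))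
  rwa [mul_comm (c ^ x), mul_comm (c ^ (x - θ))]

lemma exists_le_longSum [Fintype V] {y : ℝ} (hq : 0 ≤ q) (hμ : ∀ v, IsProbabilityMeasure (μ v))
    (hsq : ∀ v, ∀ᵐ z ∂μ v, z ∈ closedSq)
    (hA : ∀ v, HasLq1 ((μ v).map Prod.fst) q τA) (hB : ∀ v, HasLq1 ((μ v).map Prod.snd) q τB)
    (hκ0 : 0 < κ) (hκ1 : κ ≤ 1) {η : ℝ} (hη : 0 < η) :
    ∃ C : ℝ, 0 < C ∧ ∀ (v : V) (δ : ℝ) (w : List E), 0 < δ → δ ≤ 1 →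
      κ * δ ≤ pathWeight S.a w → κ * δ ≤ pathWeight S.b w →
      pathWeight S.a w ≤ 1 → pathWeight S.b w ≤ 1 →
      (pathWeight S.a w < δ ∨ pathWeight S.b w < δ) →
      (x = τA ∨ pathWeight S.a w / pathWeight S.b w ≤ δ ^ (-η)) →
      (y = τB ∨ pathWeight S.b w / pathWeight S.a w ≤ δ ^ (-η)) →
      ENNReal.ofReal (pathWeight S.a w ^ x * pathWeight S.b w ^ y) ≤
        ENNReal.ofReal (C * δ ^ (x + y - η * (1 + |x - τA| + |y - τB|))) * S.longSum q μ v δ w := by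
  obtain ⟨CA, hCA0, hCA⟩ := exists_uniform_moment_bounds hq hμ measurable_fst
    (fun v => (hsq v).mono fun z hz => hz.1) hA hη (one_le_inv₀ hκ0 |>.2 hκ1)
  obtain ⟨CB, hCB0, hCB⟩ := exists_uniform_moment_bounds hq hμ measurable_snd
    (fun v => (hsq v).mono fun z hz => hz.2) hB hη (one_le_inv₀ hκ0 |>.2 hκ1)
  refine ⟨κ ^ (-|x - τA| - |y|) * CA + κ ^ (-|y - τB| - |x|) * CB, by positivity,
    fun v δ w hδ0 hδ1 hcκ hdκ hc1 hd1 hlt hgx hgy => ?_⟩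
  set c := pathWeight S.a w
  set d := pathWeight S.b w
  have hκδ := mul_pos hκ0 hδ0
  have hc0 : 0 < c := hκδ.trans_le hcκ
  have hd0 : 0 < d := hκδ.trans_le hdκ
  have hscale : ∀ t, 0 < t → κ * δ ≤ t → δ / t ≤ κ⁻¹ := by
    intro t ht h
    rw [div_le_iff₀ ht, ← div_eq_inv_mul, le_div_iff₀ hκ0, mul_comm]
    exact h
  rw [longSum]
  split_ifs with hdc
  · have hdδ : d ≤ δ := hlt.elim (fun h => hdc.trans h.le) le_of_lt
    have h1 := long_side_lower (y := y) hκ0 hκ1 hδ0 hδ1 hdκ hdc hc1 hdδ hgx hη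
    have h2 := (hCA (S.endV v w) _ (div_pos hδ0 hc0) (hscale c hc0 hcκ)).1
    have h3 : δ ^ (x + y - η * (1 + |x - τA|)) ≤ δ ^ (x + y - η * (1 + |x - τA| + |y - τB|)) :=
      Real.rpow_le_rpow_of_exponent_ge hδ0 hδ1 (by nlinarith [abs_nonneg (y - τB)])
    calc ENNReal.ofReal (c ^ x * d ^ y)
        ≤ ENNReal.ofReal (κ ^ (-|x - τA| - |y|) * δ ^ (x + y - η * (1 + |x - τA|))) *
          ENNReal.ofReal ((δ / c) ^ (-τA + η)) := by
          rw [← ENNReal.ofReal_mul (by positivity)]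
          exact ENNReal.ofReal_le_ofReal h1
      _ ≤ ENNReal.ofReal (κ ^ (-|x - τA| - |y|) * δ ^ (x + y - η * (1 + |x - τA|))) *
          (ENNReal.ofReal CA * _) := mul_le_mul_right h2 _
      _ ≤ _ := by
          rw [← mul_assoc, ← ENNReal.ofReal_mul (by positivity)]
          refine mul_le_mul_left (ENNReal.ofReal_le_ofReal ?_) _
          rw [mul_right_comm]
          exact mul_le_mul (le_add_of_nonneg_right (by positivity)) h3 (by positivity) (by positivity)
  · rw [not_le] at hdc
    have hcδ : c ≤ δ := hlt.elim le_of_lt (fun h => hdc.le.trans h.le)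
    have h1 := long_side_lower (y := x) hκ0 hκ1 hδ0 hδ1 hcκ hdc.le hd1 hcδ hgy hη
    have h2 := (hCB (S.endV v w) _ (div_pos hδ0 hd0) (hscale d hd0 hdκ)).1
    have h3 : δ ^ (y + x - η * (1 + |y - τB|)) ≤ δ ^ (x + y - η * (1 + |x - τA| + |y - τB|)) :=
      Real.rpow_le_rpow_of_exponent_ge hδ0 hδ1 (by nlinarith [abs_nonneg (x - τA)])
    calc ENNReal.ofReal (c ^ x * d ^ y)
        ≤ ENNReal.ofReal (κ ^ (-|y - τB| - |x|) * δ ^ (y + x - η * (1 + |y - τB|))) *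
          ENNReal.ofReal ((δ / d) ^ (-τB + η)) := by
          rw [← ENNReal.ofReal_mul (by positivity), mul_comm (c ^ x)]
          exact ENNReal.ofReal_le_ofReal h1
      _ ≤ ENNReal.ofReal (κ ^ (-|y - τB| - |x|) * δ ^ (y + x - η * (1 + |y - τB|))) *
          (ENNReal.ofReal CB * _) := mul_le_mul_right h2 _
      _ ≤ _ := by
          rw [← mul_assoc, ← ENNReal.ofReal_mul (by positivity)]
          refine mul_le_mul_left (ENNReal.ofReal_le_ofReal ?_) _
          rw [mul_right_comm]
          exact mul_le_mul (le_add_of_nonneg_left (by positivity)) h3 (by positivity) (by positivity)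

lemma exists_le_planarSum [Fintype V] [Fintype E] [Nonempty E] (hSC : S.StronglyConnected) (hq : 0 ≤ q)
    (hμ : S.IsGDMeasure p μ) (hp : S.IsWeights p) (hR : S.ROSC) (hdiag : ∀ e, S.diag e = true)
    (hA : ∀ v, HasLq1 ((μ v).map Prod.fst) q τA) (hB : ∀ v, HasLq1 ((μ v).map Prod.snd) q τB)
    (hP : ∀ x, IsPerronData S.init S.term p S.a S.b q x (Y x) (f x))
    (hx : x = τA ∨ 1 ≤ slope S.a S.b (f x)) (hy : Y x = τB ∨ slope S.a S.b (f x) ≤ 1)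
    {η : ℝ} (hη : 0 < η) : ∃ C : ℝ, 0 < C ∧ ∀ᶠ δ in nhdsWithin (0 : ℝ) (Ioi 0), ∀ v,
      ENNReal.ofReal (C * δ ^ (-(x + Y x) + η)) ≤ planarSum q (μ v) δ := by
  obtain ⟨κ, r, hκ0, hκ1, hr1, hr0, hr⟩ := exists_ratio_bounds S
  have hsq := hμ.ae_mem_closedSq hp hR hdiag
  set K := 1 + |x - τA| + |Y x - τB| with hK
  have hK0 : 0 < K := by positivity
  have hηK : 0 < η / K := by positivity
  obtain ⟨C₁, hC₁, h₁⟩ := planarSum_comparison hq hμ hp hR hdiag hsq hκ0 hκ1 hr0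
    (fun e => ⟨(hr e).1, (hr e).2.1⟩) (fun e => (hr e).2.2)
  obtain ⟨C₂, hC₂, h₂⟩ := exists_le_longSum (S := S) (x := x) (y := Y x) hq hμ.1 hsq hA hB hκ0 hκ1 hηK
  obtain ⟨x', C', β', hC', hβ', h'⟩ := exists_tilt_right hSC hp.1 hP hκ0 hx hηK
  obtain ⟨x'', C'', β'', hC'', hβ'', h''⟩ := exists_tilt_left hSC hp.1 hP hκ0 hy hηK
  obtain ⟨C₃, hC₃, h₃⟩ := exists_sum_cut_bounds hp.1 (hP x)
  obtain ⟨D', hD', hd'⟩ := exists_sum_cut_bounds hp.1 (hP x')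
  obtain ⟨D'', hD'', hd''⟩ := exists_sum_cut_bounds hp.1 (hP x'')
  set G := C₃ * (C₂ * (C₁.toReal + 1)) with hG
  have hG0 : 0 < G := by positivity
  have hsmall : ∀ᶠ δ in nhdsWithin (0 : ℝ) (Ioi 0),
      C₃ * (C' * δ ^ β' * D' + C'' * δ ^ β'' * D'') < 1 / 2 := by
    have hc : ContinuousAt (fun δ : ℝ => C₃ * (C' * δ ^ β' * D' + C'' * δ ^ β'' * D'')) 0 := by
      have e1 := Real.continuousAt_rpow_const 0 β' (Or.inr hβ'.le)
      have e2 := Real.continuousAt_rpow_const 0 β'' (Or.inr hβ''.le)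
      fun_prop
    have h0 := hc.tendsto
    rw [Real.zero_rpow hβ'.ne', Real.zero_rpow hβ''.ne'] at h0
    simp only [mul_zero, zero_mul, add_zero] at h0
    exact (h0.mono_left nhdsWithin_le_nhds).eventually_lt_const (by norm_num)
  refine ⟨(2 * G)⁻¹, by positivity, ?_⟩
  filter_upwards [hsmall, Ioo_mem_nhdsGT (zero_lt_one (α := ℝ))] with δ hδs hδ v
  obtain ⟨hδ0, hδ1⟩ := hδ
  obtain ⟨n, hn⟩ := exists_pow_lt_of_lt_one hδ0 hr1
  set A := C₂ * δ ^ (x + Y x - η / K * K) with hAdef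
  have hA0 : 0 < A := mul_pos hC₂ (Real.rpow_pos_of_pos hδ0 _)
  have hδβ' := Real.rpow_pos_of_pos hδ0 β'
  have hδβ'' := Real.rpow_pos_of_pos hδ0 β''
  set W : ℝ → List E → ℝ := fun x w =>
    pathWeight p w ^ q * (pathWeight S.a w ^ x * pathWeight S.b w ^ Y x) with hW
  have hword : ∀ w ∈ S.cut δ v n, ENNReal.ofReal (W x w) ≤
      ENNReal.ofReal A * (ENNReal.ofReal (pathWeight p w ^ q) * S.longSum q μ v δ w) +
      (ENNReal.ofReal (C' * δ ^ β') * ENNReal.ofReal (W x' w) +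
        ENNReal.ofReal (C'' * δ ^ β'') * ENNReal.ofReal (W x'' w)) := by
    intro w hw
    obtain ⟨hcκ, hdκ⟩ := le_pathWeight_of_mem_cut hκ1 hδ0 hδ1.le
      (fun e => ⟨(hr e).1, (hr e).2.1⟩) hw
    have hlt := pathWeight_lt_of_mem_cut hr0 (fun e => (hr e).2.2) hn hw
    have hc1 := pathWeight_le_one S.a_mem w
    have hd1 := pathWeight_le_one S.b_mem w
    have hpw : 0 < pathWeight p w ^ q := Real.rpow_pos_of_pos (pathWeight_pos hp.1 w) _
    rcases h' δ _ _ hδ0 hcκ hdκ hc1 hd1 with hgx | hbad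
    · rcases h'' δ _ _ hδ0 hcκ hdκ hc1 hd1 with hgy | hbad
      · refine le_trans ?_ le_self_add
        rw [mul_left_comm, hW, ENNReal.ofReal_mul hpw.le]
        exact mul_le_mul_right (h₂ v δ w hδ0 hδ1.le hcκ hdκ hc1 hd1 hlt hgx hgy) _
      · refine le_trans ?_ (le_add_self.trans le_add_self)
        rw [← ENNReal.ofReal_mul (by positivity)]
        refine ENNReal.ofReal_le_ofReal ((mul_le_mul_of_nonneg_left hbad hpw.le).trans
          (le_of_eq ?_))
        simp only [hW]; ring
    · refine le_trans ?_ (le_self_add.trans le_add_self)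
      rw [← ENNReal.ofReal_mul (by positivity)]
      refine ENNReal.ofReal_le_ofReal ((mul_le_mul_of_nonneg_left hbad hpw.le).trans
        (le_of_eq ?_))
      simp only [hW]; ring
  have hsum := Multiset.sum_map_le_sum_map _ _ hword
  rw [Multiset.sum_map_add, Multiset.sum_map_add, Multiset.sum_map_mul_left,
    Multiset.sum_map_mul_left, Multiset.sum_map_mul_left] at hsum
  set P := planarSum q (μ v) δ with hPdef
  have hC₁' : C₁ ≤ ENNReal.ofReal (C₁.toReal + 1) := by
    rw [ENNReal.le_ofReal_iff_toReal_le hC₁ (by positivity)]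
    linarith
  have hmain : (1 : ℝ≥0∞) ≤ ENNReal.ofReal (G * δ ^ (x + Y x - η)) * P + ENNReal.ofReal (1 / 2) := by
    calc (1 : ℝ≥0∞) ≤ ENNReal.ofReal C₃ *
          ((S.cut δ v n).map fun w => ENNReal.ofReal (W x w)).sum := (h₃ v δ n).2
      _ ≤ ENNReal.ofReal C₃ * (ENNReal.ofReal A * (ENNReal.ofReal (C₁.toReal + 1) * P) +
          (ENNReal.ofReal (C' * δ ^ β') * ENNReal.ofReal D' +
            ENNReal.ofReal (C'' * δ ^ β'') * ENNReal.ofReal D'')) := by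
          refine mul_le_mul_right (hsum.trans ?_) _
          refine add_le_add (mul_le_mul_right ((h₁ v δ n hδ0 hδ1.le hn).2.trans ?_) _)
            (add_le_add (mul_le_mul_right (hd' v δ n).1 _) (mul_le_mul_right (hd'' v δ n).1 _))
          exact mul_le_mul_left hC₁' _
      _ = ENNReal.ofReal (G * δ ^ (x + Y x - η)) * P +
          ENNReal.ofReal (C₃ * (C' * δ ^ β' * D' + C'' * δ ^ β'' * D'')) := by
          rw [mul_add]
          congr 1
          · rw [← mul_assoc, ← mul_assoc, ← ENNReal.ofReal_mul (by positivity),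
              ← ENNReal.ofReal_mul (by positivity)]
            congr 2
            rw [hAdef, hG, div_mul_cancel₀ _ hK0.ne']
            ring
          · rw [← ENNReal.ofReal_mul (by positivity), ← ENNReal.ofReal_mul (by positivity),
              ← ENNReal.ofReal_add (by positivity) (by positivity),
              ← ENNReal.ofReal_mul (by positivity)]
      _ ≤ _ := by gcongr
  have hhalf : ENNReal.ofReal (1 / 2) ≤ ENNReal.ofReal (G * δ ^ (x + Y x - η)) * P := by
    refine ENNReal.le_of_add_le_add_right (a := ENNReal.ofReal (1 / 2)) ENNReal.ofReal_ne_top ?_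
    rw [← ENNReal.ofReal_add (by norm_num) (by norm_num), add_halves, ENNReal.ofReal_one]
    exact hmain
  have hX : 0 < G * δ ^ (x + Y x - η) := mul_pos hG0 (Real.rpow_pos_of_pos hδ0 _)
  calc ENNReal.ofReal ((2 * G)⁻¹ * δ ^ (-(x + Y x) + η))
      = ENNReal.ofReal ((G * δ ^ (x + Y x - η))⁻¹) * ENNReal.ofReal (1 / 2) := by
        rw [← ENNReal.ofReal_mul (by positivity)]
        congr 1
        rw [show -(x + Y x) + η = -(x + Y x - η) by ring, Real.rpow_neg hδ0.le, mul_inv 2 G,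
          mul_inv G]
        ring
    _ ≤ ENNReal.ofReal ((G * δ ^ (x + Y x - η))⁻¹) *
          (ENNReal.ofReal (G * δ ^ (x + Y x - η)) * P) := mul_le_mul_right hhalf _
    _ = P := by
        rw [← mul_assoc, ← ENNReal.ofReal_mul (by positivity), inv_mul_cancel₀ hX.ne',
          ENNReal.ofReal_one, one_mul]

end BoxLikeGIFS

end LqGIFS

namespace LqGIFS

namespace BoxLikeGIFS

variable {V E : Type} {S : BoxLikeGIFS V E} {p : E → ℝ} {μ : V → Measure (ℝ × ℝ)}
  {q x τA τB : ℝ} {Y : ℝ → ℝ} {f : ℝ → E → ℝ}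

/-- The planar spectrum is `x + Y x` at every point of the pressure curve above `(τA, τB)` at which
either endpoint is reached or the tilt points inwards. -/
lemma hasLq2_of_critical [Fintype V] [Fintype E] [Nonempty E] (hSC : S.StronglyConnected)
    (hq : 0 ≤ q) (hμ : S.IsGDMeasure p μ) (hp : S.IsWeights p) (hR : S.ROSC)
    (hdiag : ∀ e, S.diag e = true)
    (hA : ∀ v, HasLq1 ((μ v).map Prod.fst) q τA) (hB : ∀ v, HasLq1 ((μ v).map Prod.snd) q τB)
    (hP : ∀ x, IsPerronData S.init S.term p S.a S.b q x (Y x) (f x))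
    (hxA : τA ≤ x) (hyB : τB ≤ Y x)
    (hx : x = τA ∨ 1 ≤ slope S.a S.b (f x)) (hy : Y x = τB ∨ slope S.a S.b (f x) ≤ 1) (v : V) :
    HasLq2 (μ v) q (x + Y x) := by
  have := hμ.1 v
  refine hasLq2_of_bounds hq (μ v) (fun η hη => ?_) (fun η hη => ?_)
  · obtain ⟨C, hC, h⟩ := exists_planarSum_le hq hμ hp hR hdiag hA hB (hP x) hxA hyB hη
    refine ⟨C, hC, ?_⟩
    filter_upwards [Ioo_mem_nhdsGT (zero_lt_one (α := ℝ))] with δ hδ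
    exact h v δ hδ.1 hδ.2.le
  · obtain ⟨C, hC, h⟩ := exists_le_planarSum hSC hq hμ hp hR hdiag hA hB hP hx hy hη
    exact ⟨C, hC, h.mono fun δ hδ => hδ v⟩

/-- A critical point minimises `x + Y x` over the arc of the pressure curve above `(τA, τB)`. -/
lemma add_curve_le_of_critical [Fintype E] [Nonempty E] (hp : ∀ e, 0 < p e)
    (hP : ∀ x, IsPerronData S.init S.term p S.a S.b q x (Y x) (f x)) {xB x' : ℝ}
    (hx : x = τA ∨ 1 ≤ slope S.a S.b (f x)) (hy : x = xB ∨ slope S.a S.b (f x) ≤ 1)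
    (hA : τA ≤ x') (hB : x' ≤ xB) : x + Y x ≤ x' + Y x' := by
  have h := curve_supporting_line hp S.a_mem S.b_mem hP x x'
  have key : 0 ≤ (x' - x) * (1 - slope S.a S.b (f x)) := by
    rcases le_total x x' with hxx | hxx
    · rcases hy with rfl | hy
      · simp [le_antisymm hB hxx]
      · exact mul_nonneg (by linarith) (by linarith)
    · rcases hx with rfl | hx
      · simp [le_antisymm hA hxx]
      · exact mul_nonneg_of_nonpos_of_nonpos (by linarith) (by linarith)
  linarith

/-- Existence of a critical point on the arc of the pressure curve over `[τA, xB]`. -/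
lemma exists_critical [Fintype E] [Nonempty E] (hSC : S.StronglyConnected) (hp : ∀ e, 0 < p e)
    (hP : ∀ x, IsPerronData S.init S.term p S.a S.b q x (Y x) (f x)) {xB : ℝ} (hAB : τA ≤ xB) :
    ∃ x ∈ Icc τA xB, (x = τA ∨ 1 ≤ slope S.a S.b (f x)) ∧
      (x = xB ∨ slope S.a S.b (f x) ≤ 1) ∧
      ((¬ 0 ≤ ∑ e, f τA e * Real.log (S.a e / S.b e)) →
        (¬ ∑ e, f xB e * Real.log (S.a e / S.b e) ≤ 0) →
        ∑ e, f x e * Real.log (S.a e / S.b e) = 0) := by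
  have hle : ∀ x, slope S.a S.b (f x) ≤ 1 ↔ 0 ≤ ∑ e, f x e * Real.log (S.a e / S.b e) :=
    fun x => slope_le_one_iff (hP x).pos S.a_mem S.b_mem
  have hge : ∀ x, 1 ≤ slope S.a S.b (f x) ↔ ∑ e, f x e * Real.log (S.a e / S.b e) ≤ 0 :=
    fun x => one_le_slope_iff (hP x).pos S.a_mem S.b_mem
  by_cases h1 : 0 ≤ ∑ e, f τA e * Real.log (S.a e / S.b e)
  · exact ⟨τA, left_mem_Icc.2 hAB, Or.inl rfl, Or.inr ((hle _).2 h1), fun h => absurd h1 h⟩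
  by_cases h2 : ∑ e, f xB e * Real.log (S.a e / S.b e) ≤ 0
  · exact ⟨xB, right_mem_Icc.2 hAB, Or.inr ((hge _).2 h2), Or.inl rfl, fun _ h => absurd h2 h⟩
  have hf := perronWeights_continuous hSC hp S.a_mem S.b_mem hP
  have hc : Continuous fun x => ∑ e, f x e * Real.log (S.a e / S.b e) :=
    continuous_finsetSum _ fun e _ => ((continuous_apply e).comp hf).mul continuous_const
  obtain ⟨x, hx, h0⟩ := intermediate_value_Icc hAB hc.continuousOn
    ⟨(not_le.1 h1).le, (not_le.1 h2).le⟩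
  exact ⟨x, hx, Or.inr ((hge _).2 h0.le), Or.inr ((hle _).2 h0.ge), fun _ _ => h0⟩

end BoxLikeGIFS

end LqGIFS

/-- closed form, non-rotational, case (b).  All `T_e` diagonal, ROSC,
`q ≥ 0`, and `min{γ_A(q), γ_B(q)} ≥ t(q)`.  Then every `τ_{μ_v}(q)` exists and equals the
minimum of `x + y` over pairs with `ρ(F^{(q)}_{x,y}) = 1` in either of the stated ranges;
moreover (b1)/(b2)/(b3) identify this value via the Perron vector data `f^{(q)}`. -/
theorem statement3
    {V E : Type} [Fintype V] [Fintype E] [Nonempty V]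
    (S : BoxLikeGIFS V E) (hSC : S.StronglyConnected) (hROSC : S.ROSC)
    (hdiag : ∀ e : E, S.diag e = true)
    (p : E → ℝ) (hp : S.IsWeights p)
    (μ : V → Measure (ℝ × ℝ)) (hμ : S.IsGDMeasure p μ)
    (τA τB : ℝ → ℝ)
    (hτA : ∀ q : ℝ, 0 ≤ q → ∀ v : V, HasLq1 ((μ v).map Prod.fst) q (τA q))
    (hτB : ∀ q : ℝ, 0 ≤ q → ∀ v : V, HasLq1 ((μ v).map Prod.snd) q (τB q))
    (q : ℝ) (hq : 0 ≤ q)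
    (γA γB : ℝ)
    (hγA : specRad (S.Fmat p q (τA q) (γA - τA q)) = 1)
    (hγB : specRad (S.Fmat p q (γB - τB q) (τB q)) = 1)
    (hcase : τA q + τB q ≤ min γA γB)
    (Y : ℝ → ℝ) (f : ℝ → E → ℝ)
    (hPerron : ∀ x : ℝ, IsPerronData S.init S.term p S.a S.b q x (Y x) (f x)) :
    ∃ τ : ℝ, (∀ v : V, HasLq2 (μ v) q τ) ∧
      IsLeast {s : ℝ | ∃ x y : ℝ, specRad (S.Fmat p q x y) = 1 ∧
        τA q ≤ x ∧ x ≤ γB - τB q ∧ s = x + y} τ ∧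
      IsLeast {s : ℝ | ∃ x y : ℝ, specRad (S.Fmat p q x y) = 1 ∧
        τB q ≤ y ∧ y ≤ γA - τA q ∧ s = x + y} τ ∧
      ((0 ≤ ∑ e : E, f (τA q) e * Real.log (S.a e / S.b e)) → τ = γA) ∧
      ((∑ e : E, f (γB - τB q) e * Real.log (S.a e / S.b e)) ≤ 0 → τ = γB) ∧
      ((¬ (0 ≤ ∑ e : E, f (τA q) e * Real.log (S.a e / S.b e)) ∧
        ¬ ((∑ e : E, f (γB - τB q) e * Real.log (S.a e / S.b e)) ≤ 0)) →
        ∃ x y : ℝ, τA q ≤ x ∧ x ≤ γB - τB q ∧ τB q ≤ y ∧ y ≤ γA - τA q ∧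
          specRad (S.Fmat p q x y) = 1 ∧
          (∑ e : E, f x e * Real.log (S.a e / S.b e)) = 0 ∧ τ = x + y) := by
  obtain ⟨e₀, -⟩ := S.edge_exists (Classical.arbitrary V)
  have : Nonempty E := ⟨e₀⟩
  have hcurve : ∀ {x y : ℝ}, specRad (S.Fmat p q x y) = 1 → y = Y x := fun h =>
    eq_of_specRad_eq_one hp.1 S.a_mem S.b_mem hPerron h
  have hYA : γA - τA q = Y (τA q) := hcurve hγA
  have hYB : τB q = Y (γB - τB q) := hcurve hγB
  have hanti : StrictAnti Y := curve_strictAnti hp.1 S.a_mem S.b_mem hPerron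
  have hAB : τA q ≤ γB - τB q := by linarith [min_le_right γA γB]
  obtain ⟨x, ⟨hxA, hxB⟩, hcA, hcB, h0⟩ := BoxLikeGIFS.exists_critical hSC hp.1 hPerron hAB
  have hyB : τB q ≤ Y x := hYB.trans_le (hanti.antitone hxB)
  have hyA : Y x ≤ γA - τA q := (hanti.antitone hxA).trans_eq hYA.symm
  have hmin : ∀ x', τA q ≤ x' → x' ≤ γB - τB q → x + Y x ≤ x' + Y x' := fun x' h h' =>
    BoxLikeGIFS.add_curve_le_of_critical hp.1 hPerron hcA hcB h h'
  refine ⟨x + Y x, BoxLikeGIFS.hasLq2_of_critical hSC hq hμ hp hROSC hdiag (hτA q hq) (hτB q hq)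
    hPerron hxA hyB hcA (hcB.imp_left fun h => by rw [h, ← hYB]),
    ⟨⟨x, Y x, (hPerron x).1, hxA, hxB, rfl⟩, ?_⟩, ⟨⟨x, Y x, (hPerron x).1, hyB, hyA, rfl⟩, ?_⟩,
    fun h => ?_, fun h => ?_,
    fun h => ⟨x, Y x, hxA, hxB, hyB, hyA, (hPerron x).1, h0 h.1 h.2, rfl⟩⟩
  · rintro _ ⟨x', y', h, h1, h2, rfl⟩
    rw [hcurve h]
    exact hmin x' h1 h2
  · rintro _ ⟨x', y', h, h1, h2, rfl⟩
    obtain rfl := hcurve h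
    rw [hYB] at h1
    rw [hYA] at h2
    exact hmin x' (hanti.le_iff_ge.1 h2) (hanti.le_iff_ge.1 h1)
  · have hA := BoxLikeGIFS.add_curve_le_of_critical hp.1 hPerron (Or.inl rfl)
      (Or.inr ((slope_le_one_iff (hPerron _).pos S.a_mem S.b_mem).2 h)) hxA hxB
    linarith [hmin (τA q) le_rfl hAB]
  · have hB := BoxLikeGIFS.add_curve_le_of_critical hp.1 hPerron
      (Or.inr ((one_le_slope_iff (hPerron _).pos S.a_mem S.b_mem).2 h)) (Or.inl rfl) hxA hxB
    linarith [hmin (γB - τB q) hAB le_rfl]
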